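/- Let N ≥ 1. (i) If 0 < σ < max(1, 4/(N+1)), then E_min(m) < -m for all m > 0. (ii) If max(1, 4/(N+1)) ≤ σ ≤ 4/N, then, with M = sup{Q_κ(u) : u ∈ H²(ℝ^N) \ {0}} for s = 2, p = 2σ+2, κ = σ/(σ+1), the number m₀ = (σ+1)^{1/σ} M^{-(2σ+2)/σ} is positive and satisfies: E_min(m) = -m for all m ∈ (0, m₀] and E_min(m) < -m for all m > m₀. (iii) If σ = 4/N and m₀ is as in (ii), and k* = (σ+1)^{1/σ} B(N,σ)^{-1/σ}, then m₀ < k*, E_min(m) = -m for m ∈ (0, m₀], and -∞ < E_min(m) < -m for m ∈ (m₀, k*). -/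

import Mathlib

open MeasureTheory Filter Topology

noncomputable section

abbrev Esp (N : ℕ) := EuclideanSpace ℝ (Fin N)

/-- Smooth compactly supported test functions. -/
def TestFun {N : ℕ} (φ : Esp N → ℂ) : Prop :=
  ContDiff ℝ (⊤ : ℕ∞) φ ∧ HasCompactSupport φ

/-- Partial derivative in the `i`-th coordinate direction. -/
def pderivC {N : ℕ} (i : Fin N) (φ : Esp N → ℂ) : Esp N → ℂ :=
  fun x => fderiv ℝ φ x (EuclideanSpace.single i (1 : ℝ))

/-- The Laplacian of a (smooth) function. -/
def lapC {N : ℕ} (φ : Esp N → ℂ) : Esp N → ℂ :=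
  fun x => ∑ i, pderivC i (pderivC i φ) x

/-- `v` is the weak `i`-th partial derivative of `u`. -/
def IsWeakPDeriv {N : ℕ} (u : Esp N → ℂ) (i : Fin N) (v : Esp N → ℂ) : Prop :=
  ∀ φ : Esp N → ℂ, TestFun φ → ∫ x, u x * pderivC i φ x = - ∫ x, v x * φ x

/-- `v` is the weak Laplacian of `u`. -/
def IsWeakLap {N : ℕ} (u v : Esp N → ℂ) : Prop :=
  ∀ φ : Esp N → ℂ, TestFun φ → ∫ x, u x * lapC φ x = ∫ x, v x * φ x

/-- An element of the Sobolev space `H²(ℝ^N, ℂ)`: an `L²` function together with its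
weak partial derivatives and its weak Laplacian, all in `L²`. -/
structure H2 (N : ℕ) where
  u : Esp N → ℂ
  grad : Fin N → Esp N → ℂ
  lapl : Esp N → ℂ
  u_mem : MemLp u 2 (volume : Measure (Esp N))
  grad_mem : ∀ i, MemLp (grad i) 2 (volume : Measure (Esp N))
  lapl_mem : MemLp lapl 2 (volume : Measure (Esp N))
  grad_spec : ∀ i, IsWeakPDeriv u i (grad i)
  lapl_spec : IsWeakLap u lapl

namespace H2

variable {N : ℕ}

/-- `∫ |u|²`. -/
def massSq (U : H2 N) : ℝ := ∫ x, ‖U.u x‖ ^ 2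

/-- `∫ |∇u|²`. -/
def gradSq (U : H2 N) : ℝ := ∑ i, ∫ x, ‖U.grad i x‖ ^ 2

/-- `∫ |Δu|²`. -/
def lapSq (U : H2 N) : ℝ := ∫ x, ‖U.lapl x‖ ^ 2

/-- `∫ |u|^{2σ+2}`. -/
def pPow (σ : ℝ) (U : H2 N) : ℝ := ∫ x, ‖U.u x‖ ^ (2 * σ + 2)

/-- The energy `E(u) = ∫|Δu|² - 2∫|∇u|² - (1/(σ+1))∫|u|^{2σ+2}`. -/
def energy (σ : ℝ) (U : H2 N) : ℝ :=
  U.lapSq - 2 * U.gradSq - (1 / (σ + 1)) * U.pPow σ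

/-- The square of the `H²` norm. -/
def h2NormSq (U : H2 N) : ℝ := U.massSq + U.gradSq + U.lapSq

/-- `u` does not vanish almost everywhere. -/
def Nontriv (U : H2 N) : Prop := ¬ (U.u =ᵐ[(volume : Measure (Esp N))] 0)

end H2

/-- `E_min(m) = inf {E(u) : u ∈ H², ∫|u|² = m}`, with values in `EReal`. -/
def EminE (N : ℕ) (σ m : ℝ) : EReal :=
  ⨅ (U : H2 N) (_ : U.massSq = m), ((U.energy σ : ℝ) : EReal)

/-- The `L^p` norm (as a real number) of a function on `ℝ^N`. -/
def rLp {N : ℕ} (p : ℝ) (f : Esp N → ℂ) : ℝ :=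
  (eLpNorm f (ENNReal.ofReal p) (volume : Measure (Esp N))).toReal


/-- The best constant `B(N,σ)` in the Gagliardo–Nirenberg–Sobolev inequality
`‖u‖_{L^{2σ+2}}^{2σ+2} ≤ B ‖Δu‖_{L²}^{Nσ/2} ‖u‖_{L²}^{2+2σ-Nσ/2}`. -/
def GNconst (N : ℕ) (σ : ℝ) : ℝ :=
  sSup {r : ℝ | ∃ U : H2 N, U.Nontriv ∧
    r = U.pPow σ /
      (rLp 2 U.lapl ^ ((N : ℝ) * σ / 2) * rLp 2 U.u ^ (2 + 2 * σ - (N : ℝ) * σ / 2))}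

/-- `k* = (σ+1)^{1/σ} B(N,σ)^{-1/σ}`. -/
def kstar (N : ℕ) (σ : ℝ) : ℝ := (σ + 1) ^ (1 / σ) * GNconst N σ ^ (-(1 / σ))

/-- Strong `H²` convergence of `v k (· + xs k)` to `U`. -/
def H2TendstoTrans {N : ℕ} (v : ℕ → H2 N) (xs : ℕ → Esp N) (U : H2 N) : Prop :=
  Tendsto (fun k => eLpNorm (fun x => (v k).u (x + xs k) - U.u x) 2
      (volume : Measure (Esp N))) atTop (nhds 0) ∧
  (∀ i, Tendsto (fun k => eLpNorm (fun x => (v k).grad i (x + xs k) - U.grad i x) 2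
      (volume : Measure (Esp N))) atTop (nhds 0)) ∧
  Tendsto (fun k => eLpNorm (fun x => (v k).lapl (x + xs k) - U.lapl x) 2
      (volume : Measure (Esp N))) atTop (nhds 0)

/-- `u` is a weak (`H^{-2}`) solution of `Δ²u + 2Δu + (1+c)u - |u|^{2σ}u = 0`. -/
def SolvesSW {N : ℕ} (σ c : ℝ) (U : H2 N) : Prop :=
  ∀ φ : Esp N → ℂ, TestFun φ →
    (∫ x, U.lapl x * lapC φ x) + 2 * (∫ x, U.lapl x * φ x) +
        ((1 + c : ℝ) : ℂ) * (∫ x, U.u x * φ x) -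
        (∫ x, ((‖U.u x‖ ^ (2 * σ) : ℝ) : ℂ) * U.u x * φ x) = 0

/-- `T_c(u) = ∫|Δu|² - 2∫|∇u|² + (1+c)∫|u|²`. -/
def Tfun {N : ℕ} (c : ℝ) (U : H2 N) : ℝ := U.lapSq - 2 * U.gradSq + (1 + c) * U.massSq

/-- `t(c) = inf {T_c(u) : ∫|u|^{2σ+2} = 1}`. -/
def tmin (N : ℕ) (σ c : ℝ) : ℝ := sInf {r : ℝ | ∃ U : H2 N, U.pPow σ = 1 ∧ r = Tfun c U}

/-- The action `S_c(u) = E(u) + (1+c)‖u‖_{L²}² = T_c(u) - (1/(σ+1))∫|u|^{2σ+2}`. -/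
def action {N : ℕ} (σ c : ℝ) (U : H2 N) : ℝ := U.energy σ + (1 + c) * U.massSq

/-- The best constant `M` in the inequality
`‖u‖_{L^{2σ+2}} ≤ M ‖u‖_{L²}^{σ/(σ+1)} ‖Δu + u‖_{L²}^{1/(σ+1)}`, i.e. the supremum of
`Q_κ` over `H² \ {0}` with `s = 2`, `p = 2σ+2`, `κ = σ/(σ+1)`
(recall `‖(|D|²-1)u‖_{L²} = ‖Δu + u‖_{L²}`). -/
def Mconst (N : ℕ) (σ : ℝ) : ℝ :=
  sSup {r : ℝ | ∃ U : H2 N, U.Nontriv ∧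
    r = rLp (2 * σ + 2) U.u /
      (rLp 2 U.u ^ (σ / (σ + 1)) *
        rLp 2 (fun x => U.lapl x + U.u x) ^ (1 - σ / (σ + 1)))}

/-- `m₀ = (σ+1)^{1/σ} M^{-(2σ+2)/σ}`. -/
def m0c (N : ℕ) (σ : ℝ) : ℝ := (σ + 1) ^ (1 / σ) * Mconst N σ ^ (-((2 * σ + 2) / σ))


section P1
open scoped FourierTransform SchwartzMap ENNReal
open LineDeriv

namespace SW
variable {N : ℕ}

/-- Inverse Fourier transform on `L²`, as a function. -/
def T (g : Esp N → ℂ) : Esp N → ℂ :=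
  open Classical in
  if h : MemLp g 2 (volume : Measure (Esp N)) then
    ((𝓕⁻ (h.toLp g) : Lp ℂ 2 (volume : Measure (Esp N))) : Esp N → ℂ) else 0

lemma T_def {g : Esp N → ℂ} (h : MemLp g 2 (volume : Measure (Esp N))) :
    T g = ((𝓕⁻ (h.toLp g) : Lp ℂ 2 (volume : Measure (Esp N))) : Esp N → ℂ) := by
  unfold T; rw [dif_pos h]

lemma T_memLp {g : Esp N → ℂ} (h : MemLp g 2 (volume : Measure (Esp N))) :
    MemLp (T g) 2 (volume : Measure (Esp N)) := by
  rw [T_def h]; exact Lp.memLp _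

lemma T_congr {g g' : Esp N → ℂ} (h : g =ᵐ[volume] g') : T g = T g' := by
  by_cases hg : MemLp g 2 (volume : Measure (Esp N))
  · have hg' := (memLp_congr_ae h).1 hg
    rw [T_def hg, T_def hg', (MemLp.toLp_eq_toLp_iff hg hg').2 h]
  · have hg' : ¬ MemLp g' 2 (volume : Measure (Esp N)) := fun hh => hg ((memLp_congr_ae h).2 hh)
    unfold T; rw [dif_neg hg, dif_neg hg']

lemma T_eLpNorm {g : Esp N → ℂ} (h : MemLp g 2 (volume : Measure (Esp N))) :
    eLpNorm (T g) 2 volume = eLpNorm g 2 volume := by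
  rw [T_def h]
  have h1 : ‖(𝓕⁻ (h.toLp g) : Lp ℂ 2 (volume : Measure (Esp N)))‖ = ‖h.toLp g‖ := by
    rw [← Lp.norm_fourier_eq (𝓕⁻ (h.toLp g)), FourierTransform.fourier_fourierInv_eq]
  have h2 : ‖(𝓕⁻ (h.toLp g) : Lp ℂ 2 (volume : Measure (Esp N)))‖ₑ = ‖h.toLp g‖ₑ := by
    rw [← ofReal_norm, h1, ofReal_norm]
  rw [Lp.enorm_def, Lp.enorm_def] at h2
  rw [h2]; exact eLpNorm_congr_ae h.coeFn_toLp

lemma eLpNorm_two_sq (f : Esp N → ℂ) :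
    (eLpNorm f 2 volume) ^ 2 = ∫⁻ x, ‖f x‖ₑ ^ 2 := by
  have := eLpNorm_nnreal_pow_eq_lintegral (f := f) (μ := (volume : Measure (Esp N)))
    (p := (2 : NNReal)) (by norm_num)
  simpa using this

lemma T_lintegral {g : Esp N → ℂ} (h : MemLp g 2 (volume : Measure (Esp N))) :
    ∫⁻ x, ‖T g x‖ₑ ^ 2 = ∫⁻ x, ‖g x‖ₑ ^ 2 := by
  rw [← eLpNorm_two_sq, ← eLpNorm_two_sq, T_eLpNorm h]

lemma T_add {g g' : Esp N → ℂ} (h : MemLp g 2 (volume : Measure (Esp N)))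
    (h' : MemLp g' 2 (volume : Measure (Esp N))) :
    T (fun x => g x + g' x) =ᵐ[volume] fun x => T g x + T g' x := by
  have := T_def (h.add h')
  have e : (h.add h').toLp = h.toLp g + h'.toLp g' := rfl
  rw [e, FourierTransform.fourierInv_add] at this
  have h3 : T (fun x => g x + g' x) = T (g + g') := rfl
  rw [h3, this, T_def h, T_def h']
  exact Lp.coeFn_add _ _

lemma T_surj {u : Esp N → ℂ} (h : MemLp u 2 (volume : Measure (Esp N))) :
    ∃ g : Esp N → ℂ, MemLp g 2 (volume : Measure (Esp N)) ∧ T g =ᵐ[volume] u := by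
  refine ⟨((𝓕 (h.toLp u) : Lp ℂ 2 (volume : Measure (Esp N))) : Esp N → ℂ), Lp.memLp _, ?_⟩
  rw [T_def (Lp.memLp _), Lp.toLp_coeFn, FourierTransform.fourierInv_fourier_eq]
  exact h.coeFn_toLp

lemma T_pair {g : Esp N → ℂ} (h : MemLp g 2 (volume : Measure (Esp N))) (φ : 𝓢(Esp N, ℂ)) :
    ∫ x, T g x * φ x = ∫ x, g x * (𝓕⁻ φ) x := by
  have h1 := Lp.fourierInv_toTemperedDistribution_eq (h.toLp g)
  have h2 := congrArg (fun F : 𝓢'(Esp N, ℂ) => F φ) h1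
  simp only [TemperedDistribution.fourierInv_apply, Lp.toTemperedDistribution_apply] at h2
  rw [T_def h]
  simp only [smul_eq_mul] at h2
  simp_rw [mul_comm _ (φ _)]
  rw [← h2]
  apply integral_congr_ae
  filter_upwards [h.coeFn_toLp] with x hx
  rw [hx, mul_comm]

/-- real test functions as Schwartz functions -/
lemma exists_schwartz {φ : Esp N → ℂ} (h1 : ContDiff ℝ (⊤ : ℕ∞) φ) (h2 : HasCompactSupport φ) :
    ∃ ψ : 𝓢(Esp N, ℂ), ∀ x, ψ x = φ x :=
  ⟨h2.toSchwartzMap h1, fun _ => rfl⟩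

lemma ae_zero_of_pair {f : Esp N → ℂ} (hf : LocallyIntegrable f volume)
    (h : ∀ φ : 𝓢(Esp N, ℂ), HasCompactSupport φ → ∫ x, f x * φ x = 0) : f =ᵐ[volume] 0 := by
  apply ae_eq_zero_of_integral_contDiff_smul_eq_zero hf
  intro g hg hgc
  obtain ⟨ψ, hψ⟩ := exists_schwartz (φ := fun x => (g x : ℂ))
    (Complex.ofRealCLM.contDiff.comp hg) (hgc.comp_left (g := fun t : ℝ => (t : ℂ)) (by simp))
  have h3 := h ψ (by
    have : (ψ : Esp N → ℂ) = fun x => (g x : ℂ) := funext hψ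
    rw [this]; exact hgc.comp_left (g := fun t : ℝ => (t : ℂ)) (by simp))
  rw [← h3]
  congr 1; ext x
  rw [hψ, Complex.real_smul, mul_comm]

lemma integral_pair {g : Esp N → ℂ} (h1 : Integrable g (volume : Measure (Esp N)))
    (φ : 𝓢(Esp N, ℂ)) :
    ∫ x, (𝓕⁻ g) x * φ x = ∫ x, g x * (𝓕⁻ φ) x := by
  have := VectorFourier.integral_bilin_fourierIntegral_eq_flip (ContinuousLinearMap.mul ℂ ℂ)
    (L := innerₗ (Esp N)) (μ := volume) (ν := volume)
    Real.continuous_fourierChar continuous_inner h1 (𝓕⁻ (𝓕⁻ φ)).integrable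
  have e : ∀ x, (𝓕 (𝓕⁻ (𝓕⁻ φ))) x = (𝓕⁻ φ) x := fun x => by
    rw [FourierTransform.fourier_fourierInv_eq]
  have e2 : ∀ x, (𝓕⁻ (𝓕⁻ φ)) x = φ (-x) := fun x => by
    rw [SchwartzMap.fourierInv_coe, Real.fourierInv_eq_fourier_neg, ← SchwartzMap.fourier_coe,
      FourierTransform.fourier_fourierInv_eq]
  have t1 : ∫ x, (𝓕 g) x * (𝓕⁻ (𝓕⁻ φ)) x = ∫ x, g x * (𝓕 (𝓕⁻ (𝓕⁻ φ))) x := by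
    simp only [flip_innerₗ, ContinuousLinearMap.mul_apply'] at this
    exact this
  simp_rw [e, e2] at t1
  rw [← t1, ← integral_neg_eq_self]
  simp_rw [Real.fourierInv_eq_fourier_neg, neg_neg]

lemma T_eq_integral {g : Esp N → ℂ} (h1 : Integrable g (volume : Measure (Esp N)))
    (h2 : MemLp g 2 (volume : Measure (Esp N))) : T g =ᵐ[volume] 𝓕⁻ g := by
  have hc : Continuous (𝓕⁻ g) := by
    have : (𝓕⁻ g) = fun x => (𝓕 g) (-x) := by
      ext x; rw [Real.fourierInv_eq_fourier_neg]
    rw [this]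
    exact (VectorFourier.fourierIntegral_continuous Real.continuous_fourierChar
      (L := innerₗ (Esp N)) continuous_inner h1).comp continuous_neg
  have hl : LocallyIntegrable (fun x => T g x - (𝓕⁻ g) x) volume :=
    ((T_memLp h2).locallyIntegrable (by norm_num)).sub hc.locallyIntegrable
  have := ae_zero_of_pair hl (fun φ hφ => by
    have i1 : Integrable (fun x => T g x * φ x) volume :=
      (T_memLp h2).integrable_mul (φ.memLp 2 volume)
    have i2 : Integrable (fun x => (𝓕⁻ g) x * φ x) volume :=
      (hc.mul φ.continuous).integrable_of_hasCompactSupport hφ.mul_left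
    simp_rw [sub_mul]
    rw [integral_sub i1 i2, T_pair h2, integral_pair h1, sub_self])
  filter_upwards [this] with x hx
  exact sub_eq_zero.1 hx

lemma norm_fourierInv_le (g : Esp N → ℂ) (x : Esp N) :
    ‖(𝓕⁻ g) x‖ₑ ≤ ∫⁻ y, ‖g y‖ₑ := by
  rw [Real.fourierInv_eq]
  refine (enorm_integral_le_lintegral_enorm _).trans (le_of_eq ?_)
  congr 1; ext y
  rw [← ofReal_norm, ← ofReal_norm, Circle.norm_smul]
end SW
end P1

section P2
open scoped FourierTransform SchwartzMap ENNReal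
open LineDeriv

namespace SW
variable {N : ℕ}

lemma pderivC_mul (i : Fin N) {a b : Esp N → ℂ} (ha : Differentiable ℝ a) (hb : Differentiable ℝ b) :
    pderivC i (fun x => a x * b x) = fun x => pderivC i a x * b x + a x * pderivC i b x := by
  ext x
  unfold pderivC
  rw [fderiv_fun_mul (ha x) (hb x)]
  simp; ring

lemma pderivC_add (i : Fin N) {a b : Esp N → ℂ} (ha : Differentiable ℝ a) (hb : Differentiable ℝ b) :
    pderivC i (fun x => a x + b x) = fun x => pderivC i a x + pderivC i b x := by
  ext x
  unfold pderivC
  rw [fderiv_fun_add (ha x) (hb x)]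
  simp

lemma pderivC_const_mul (i : Fin N) (c : ℂ) {a : Esp N → ℂ} (ha : Differentiable ℝ a) :
    pderivC i (fun x => c * a x) = fun x => c * pderivC i a x := by
  ext x
  unfold pderivC
  rw [fderiv_const_mul (ha x)]
  simp

lemma pderivC_scale (i : Fin N) (ε : ℝ) {a : Esp N → ℂ} (ha : Differentiable ℝ a) :
    pderivC i (fun x => a (ε • x)) = fun x => (ε : ℂ) * pderivC i a (ε • x) := by
  ext x
  unfold pderivC
  have h1 : HasFDerivAt (fun x : Esp N => ε • x) (ε • ContinuousLinearMap.id ℝ (Esp N)) x :=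
    (hasFDerivAt_id x).const_smul ε
  have := ((ha (ε • x)).hasFDerivAt.comp x h1).fderiv
  have e : (fun x => a (ε • x)) = a ∘ (fun x : Esp N => ε • x) := rfl
  rw [e, this]
  simp

lemma contDiff_pderivC (i : Fin N) {a : Esp N → ℂ} (ha : ContDiff ℝ (⊤ : ℕ∞) a) :
    ContDiff ℝ (⊤ : ℕ∞) (pderivC i a) := by
  unfold pderivC
  exact (ha.fderiv_right (m := (⊤ : ℕ∞)) (by simp)).clm_apply contDiff_const

lemma hcs_pderivC (i : Fin N) {a : Esp N → ℂ} (ha : HasCompactSupport a) :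
    HasCompactSupport (pderivC i a) := by
  unfold pderivC
  exact ha.fderiv_apply (𝕜 := ℝ) _

lemma diff_of {a : Esp N → ℂ} (ha : ContDiff ℝ (⊤ : ℕ∞) a) : Differentiable ℝ a :=
  ha.differentiable (by simp)

/-- schwartz partial derivative -/
lemma pderivC_schwartz (i : Fin N) (ψ : 𝓢(Esp N, ℂ)) :
    pderivC i ψ = (∂_{(EuclideanSpace.single i (1 : ℝ) : Esp N)} ψ : 𝓢(Esp N, ℂ)) := rfl

lemma exists_cutoff (N : ℕ) : ∃ c : Esp N → ℂ, TestFun c ∧ c 0 = 1 := by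
  let b : ContDiffBump (0 : Esp N) := ⟨1, 2, by norm_num, by norm_num⟩
  refine ⟨fun x => (b x : ℂ), ⟨?_, ?_⟩, ?_⟩
  · exact Complex.ofRealCLM.contDiff.comp b.contDiff
  · exact b.hasCompactSupport.comp_left (g := fun t : ℝ => (t : ℂ)) (by simp)
  · have : b 0 = 1 := b.one_of_mem_closedBall (by simp [b])
    simp [this]

lemma bdd_of_test {a : Esp N → ℂ} (h : Continuous a) (h' : HasCompactSupport a) :
    ∃ K : ℝ, ∀ x, ‖a x‖ ≤ K := h.bounded_above_of_compact_support h'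

lemma tendsto_eps : Tendsto (fun n : ℕ => (1 / ((n : ℝ) + 1))) atTop (𝓝 0) :=
  tendsto_one_div_add_atTop_nhds_zero_nat

/-- A dominated convergence package. -/
lemma cutoff_tendsto {u a ψ : Esp N → ℂ} (hu : MemLp u 2 (volume : Measure (Esp N)))
    (ha : Continuous a) (ha' : HasCompactSupport a) (hψ : MemLp ψ 2 (volume : Measure (Esp N)))
    (d : ℕ → ℝ) (D : ℝ) (hd : Tendsto d atTop (𝓝 D)) (hd1 : ∀ n, |d n| ≤ 1) :
    Tendsto (fun n : ℕ => ∫ x, u x * ((d n : ℂ) * (a ((1 / ((n : ℝ) + 1)) • x) * ψ x))) atTop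
      (𝓝 (∫ x, u x * ((D : ℂ) * (a 0 * ψ x)))) ∧
    ∀ n : ℕ, Integrable (fun x => u x * ((d n : ℂ) * (a ((1 / ((n : ℝ) + 1)) • x) * ψ x)))
      (volume : Measure (Esp N)) := by
  obtain ⟨K, hK⟩ := bdd_of_test ha ha'
  have hK0 : 0 ≤ K := (norm_nonneg _).trans (hK 0)
  have hm : ∀ n : ℕ, AEStronglyMeasurable
      (fun x => u x * ((d n : ℂ) * (a ((1 / ((n : ℝ) + 1)) • x) * ψ x)))
      (volume : Measure (Esp N)) := by
    intro n
    refine hu.1.mul (aestronglyMeasurable_const.mul (AEStronglyMeasurable.mul ?_ hψ.1))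
    exact (ha.comp (continuous_const_smul _)).aestronglyMeasurable
  have hb : ∀ n : ℕ, ∀ x, ‖u x * ((d n : ℂ) * (a ((1 / ((n : ℝ) + 1)) • x) * ψ x))‖
      ≤ K * (‖u x‖ * ‖ψ x‖) := by
    intro n x
    rw [norm_mul, norm_mul, norm_mul, Complex.norm_real, Real.norm_eq_abs]
    calc ‖u x‖ * (|d n| * (‖a ((1 / ((n : ℝ) + 1)) • x)‖ * ‖ψ x‖))
        ≤ ‖u x‖ * (1 * (K * ‖ψ x‖)) := by
          gcongr
          · exact hd1 n
          · exact hK _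
      _ = _ := by ring
  have hi : Integrable (fun x => K * (‖u x‖ * ‖ψ x‖)) (volume : Measure (Esp N)) :=
    (hu.norm.integrable_mul hψ.norm).const_mul K
  refine ⟨?_, fun n => hi.mono' (hm n) (Eventually.of_forall (hb n))⟩
  refine tendsto_integral_of_dominated_convergence _ hm hi
    (fun n => Eventually.of_forall (hb n)) (Eventually.of_forall fun x => ?_)
  have h1 : Tendsto (fun n : ℕ => a ((1 / ((n : ℝ) + 1)) • x)) atTop (𝓝 (a 0)) := by
    have : Tendsto (fun n : ℕ => (1 / ((n : ℝ) + 1)) • x) atTop (𝓝 ((0 : ℝ) • x)) :=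
      tendsto_eps.smul_const x
    rw [zero_smul] at this
    exact (ha.tendsto 0).comp this
  have h2 : Tendsto (fun n => (d n : ℂ)) atTop (𝓝 (D : ℂ)) :=
    (Complex.continuous_ofReal.tendsto D).comp hd
  exact (h2.mul (h1.mul_const _)).const_mul _

lemma eps_abs (n : ℕ) : |(1 / ((n : ℝ) + 1))| ≤ 1 := by
  have : (0 : ℝ) ≤ n := n.cast_nonneg
  rw [abs_of_nonneg (by positivity), div_le_one (by positivity)]; linarith

lemma weak_pderiv_ext {u v : Esp N → ℂ} {i : Fin N} (hu : MemLp u 2 (volume : Measure (Esp N)))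
    (hv : MemLp v 2 (volume : Measure (Esp N))) (h : IsWeakPDeriv u i v) (ψ : 𝓢(Esp N, ℂ)) :
    ∫ x, u x * pderivC i ψ x = - ∫ x, v x * ψ x := by
  obtain ⟨c, ⟨hc1, hc2⟩, hc0⟩ := exists_cutoff N
  have hψ := ψ.memLp 2 (volume : Measure (Esp N))
  have hψ' : MemLp (pderivC i ψ) 2 (volume : Measure (Esp N)) := by
    rw [pderivC_schwartz]; exact SchwartzMap.memLp _ 2 _
  have hψc : ContDiff ℝ (⊤ : ℕ∞) ψ := ψ.smooth _
  set e : ℕ → ℝ := fun n => 1 / ((n : ℝ) + 1) with he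
  have t1 := cutoff_tendsto hu (contDiff_pderivC i hc1).continuous (hcs_pderivC i hc2) hψ e 0
    tendsto_eps eps_abs
  have t2 := cutoff_tendsto hu hc1.continuous hc2 hψ' (fun _ => 1) 1 tendsto_const_nhds (by simp)
  have t3 := cutoff_tendsto hv hc1.continuous hc2 hψ (fun _ => 1) 1 tendsto_const_nhds (by simp)
  have key : ∀ n : ℕ, ∫ x, v x * (((1 : ℝ) : ℂ) * (c ((1 / ((n : ℝ) + 1)) • x) * ψ x)) =
      -((∫ x, u x * ((e n : ℂ) * (pderivC i c ((1 / ((n : ℝ) + 1)) • x) * ψ x))) +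
      ∫ x, u x * (((1 : ℝ) : ℂ) * (c ((1 / ((n : ℝ) + 1)) • x) * pderivC i ψ x))) := by
    intro n
    rw [← integral_add (t1.2 n) (t2.2 n)]
    have hcn : ContDiff ℝ (⊤ : ℕ∞) (fun x : Esp N => c ((1 / ((n : ℝ) + 1)) • x)) :=
      hc1.comp (contDiff_const_smul _)
    have hcs : HasCompactSupport (fun x : Esp N => c ((1 / ((n : ℝ) + 1)) • x)) :=
      hc2.comp_smul (by positivity)
    have := h (fun x => c ((1 / ((n : ℝ) + 1)) • x) * ψ x) ⟨hcn.mul hψc, hcs.mul_right⟩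
    rw [pderivC_mul i (diff_of hcn) (diff_of hψc), pderivC_scale i _ (diff_of hc1)] at this
    simp only [Complex.ofReal_one, one_mul]
    rw [eq_neg_iff_add_eq_zero, add_comm, ← eq_neg_iff_add_eq_zero, ← this]
    congr 1; ext x; simp only [he]; ring
  have l1 := tendsto_nhds_unique t3.1 (((t1.1.add t2.1).neg).congr (fun n => (key n).symm))
  simp only [hc0, Complex.ofReal_one, Complex.ofReal_zero, one_mul, zero_mul, mul_zero,
    integral_zero, zero_add] at l1
  rw [l1, neg_neg]

lemma weak_lap_ext {u v : Esp N → ℂ} (hu : MemLp u 2 (volume : Measure (Esp N)))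
    (hv : MemLp v 2 (volume : Measure (Esp N))) (h : IsWeakLap u v) (ψ : 𝓢(Esp N, ℂ)) :
    ∫ x, u x * lapC ψ x = ∫ x, v x * ψ x := by
  obtain ⟨c, ⟨hc1, hc2⟩, hc0⟩ := exists_cutoff N
  have hψ := ψ.memLp 2 (volume : Measure (Esp N))
  have hψ' : ∀ i, MemLp (pderivC i ψ) 2 (volume : Measure (Esp N)) := fun i => by
    rw [pderivC_schwartz]; exact SchwartzMap.memLp _ 2 _
  have hψ'' : ∀ i, MemLp (pderivC i (pderivC i ψ)) 2 (volume : Measure (Esp N)) := fun i => by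
    rw [pderivC_schwartz, pderivC_schwartz]; exact SchwartzMap.memLp _ 2 _
  have hψc : ContDiff ℝ (⊤ : ℕ∞) ψ := ψ.smooth _
  have hc1' : ∀ i, ContDiff ℝ (⊤ : ℕ∞) (pderivC i c) := fun i => contDiff_pderivC i hc1
  set e : ℕ → ℝ := fun n => 1 / ((n : ℝ) + 1) with he
  have te : Tendsto e atTop (𝓝 0) := tendsto_eps
  have t1 := fun i => cutoff_tendsto hu (contDiff_pderivC i (hc1' i)).continuous
    (hcs_pderivC i (hcs_pderivC i hc2)) hψ (fun n => e n * e n) (0 * 0)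
    (te.mul te) (fun n => by
      rw [abs_mul]; exact mul_le_one₀ (eps_abs n) (abs_nonneg _) (eps_abs n))
  have t2 := fun i => cutoff_tendsto hu (hc1' i).continuous (hcs_pderivC i hc2) (hψ' i) e 0
    te eps_abs
  have t2b := fun i => cutoff_tendsto hu hc1.continuous hc2 (hψ'' i) (fun _ => 1) 1
    tendsto_const_nhds (by simp)
  have t3 := cutoff_tendsto hv hc1.continuous hc2 hψ (fun _ => 1) 1 tendsto_const_nhds (by simp)
  have key : ∀ n : ℕ, ∫ x, v x * (((1 : ℝ) : ℂ) * (c ((1 / ((n : ℝ) + 1)) • x) * ψ x)) =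
      ∑ i, ((∫ x, u x * (((e n * e n : ℝ) : ℂ) *
        (pderivC i (pderivC i c) ((1 / ((n : ℝ) + 1)) • x) * ψ x))) +
      2 * (∫ x, u x * ((e n : ℂ) * (pderivC i c ((1 / ((n : ℝ) + 1)) • x) * pderivC i ψ x))) +
      ∫ x, u x * (((1 : ℝ) : ℂ) * (c ((1 / ((n : ℝ) + 1)) • x) * pderivC i (pderivC i ψ) x))) := by
    intro n
    have hcn : ContDiff ℝ (⊤ : ℕ∞) (fun x : Esp N => c ((1 / ((n : ℝ) + 1)) • x)) :=
      hc1.comp (contDiff_const_smul _)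
    have hcn' : ∀ i, ContDiff ℝ (⊤ : ℕ∞) (fun x : Esp N => pderivC i c ((1 / ((n : ℝ) + 1)) • x)) :=
      fun i => (hc1' i).comp (contDiff_const_smul _)
    have hcs : HasCompactSupport (fun x : Esp N => c ((1 / ((n : ℝ) + 1)) • x)) :=
      hc2.comp_smul (by positivity)
    have hψi : ∀ i, ContDiff ℝ (⊤ : ℕ∞) (pderivC i ψ) := fun i => contDiff_pderivC i hψc
    have := h (fun x => c ((1 / ((n : ℝ) + 1)) • x) * ψ x) ⟨hcn.mul hψc, hcs.mul_right⟩
    simp only [Complex.ofReal_one, one_mul]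
    rw [← this]
    have e1 : ∀ i, (fun x => u x * pderivC i (pderivC i
        (fun x => c ((1 / ((n : ℝ) + 1)) • x) * ψ x)) x) =
        fun x => (u x * (((e n * e n : ℝ) : ℂ) *
        (pderivC i (pderivC i c) ((1 / ((n : ℝ) + 1)) • x) * ψ x)) +
        2 * (u x * ((e n : ℂ) * (pderivC i c ((1 / ((n : ℝ) + 1)) • x) * pderivC i ψ x)))) +
        u x * (((1 : ℝ) : ℂ) * (c ((1 / ((n : ℝ) + 1)) • x) * pderivC i (pderivC i ψ) x)) := by
      intro i
      rw [pderivC_mul i (diff_of hcn) (diff_of hψc), pderivC_scale i _ (diff_of hc1)]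
      rw [pderivC_add i (diff_of ((contDiff_const.mul (hcn' i)).mul hψc))
        (diff_of (hcn.mul (hψi i))), pderivC_mul i (diff_of (contDiff_const.mul (hcn' i)))
        (diff_of hψc), pderivC_const_mul i _ (diff_of (hcn' i)), pderivC_scale i _
        (diff_of (hc1' i)), pderivC_mul i (diff_of hcn) (diff_of (hψi i)),
        pderivC_scale i _ (diff_of hc1)]
      ext x
      simp only [he]; push_cast; ring
    have i1 : ∀ i, Integrable (fun x => (u x * (((e n * e n : ℝ) : ℂ) *
        (pderivC i (pderivC i c) ((1 / ((n : ℝ) + 1)) • x) * ψ x)) +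
        2 * (u x * ((e n : ℂ) * (pderivC i c ((1 / ((n : ℝ) + 1)) • x) * pderivC i ψ x)))))
        (volume : Measure (Esp N)) := fun i => ((t1 i).2 n).add (((t2 i).2 n).const_mul 2)
    unfold lapC
    simp_rw [Finset.mul_sum]
    rw [integral_finsetSum _ (fun i _ => by
      rw [e1 i]; exact (i1 i).add ((t2b i).2 n))]
    refine Finset.sum_congr rfl fun i _ => ?_
    rw [e1 i, integral_add (i1 i) ((t2b i).2 n), integral_add ((t1 i).2 n)
      (((t2 i).2 n).const_mul 2), integral_const_mul]
    simp
  have lim := tendsto_finsetSum Finset.univ fun i _ =>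
    (((t1 i).1.add ((t2 i).1.const_mul 2)).add (t2b i).1)
  have l1 := tendsto_nhds_unique t3.1 (lim.congr (fun n => (key n).symm))
  simp only [hc0, Complex.ofReal_one, Complex.ofReal_zero, one_mul, zero_mul, mul_zero,
    integral_zero, zero_add] at l1
  rw [l1]
  unfold lapC
  simp_rw [Finset.mul_sum]
  have hi : ∀ i, Integrable (fun x => u x * pderivC i (pderivC i ψ) x) volume :=
    fun i => hu.integrable_mul (hψ'' i)
  rw [integral_finsetSum _ (fun i _ => hi i)]

end SW
end P2

section P3
open scoped FourierTransform SchwartzMap ENNReal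
open LineDeriv
namespace SW
variable {N : ℕ}

/-- Fourier symbol of the partial derivative. -/
def D1 (i : Fin N) (g : Esp N → ℂ) : Esp N → ℂ :=
  fun ξ => (2 * Real.pi * Complex.I * ((ξ i : ℝ) : ℂ)) * g ξ

/-- Fourier symbol of the Laplacian. -/
def D2 (g : Esp N → ℂ) : Esp N → ℂ :=
  fun ξ => ((-(4 * Real.pi ^ 2 * ‖ξ‖ ^ 2) : ℝ) : ℂ) * g ξ

lemma fourierInv_pderiv (i : Fin N) (ψ : 𝓢(Esp N, ℂ)) (ξ : Esp N) :
    (𝓕⁻ (∂_{(EuclideanSpace.single i (1 : ℝ) : Esp N)} ψ : 𝓢(Esp N, ℂ))) ξ =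
      -(2 * Real.pi * Complex.I * ((ξ i : ℝ) : ℂ)) * (𝓕⁻ ψ) ξ := by
  rw [SchwartzMap.fourierInv_lineDerivOp_eq]
  have : (fun x : Esp N => inner ℝ x (EuclideanSpace.single i (1 : ℝ))).HasTemperateGrowth := by
    fun_prop
  have e : inner ℝ ξ (EuclideanSpace.single i (1 : ℝ)) = ξ i := by
    rw [EuclideanSpace.inner_single_right]; simp
  simp [SchwartzMap.smulLeftCLM_apply_apply this, e]
  ring

lemma pair_pderiv {g : Esp N → ℂ} (i : Fin N) (h : MemLp g 2 (volume : Measure (Esp N)))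
    (ψ : 𝓢(Esp N, ℂ)) : ∫ x, T g x * pderivC i ψ x = - ∫ x, D1 i g x * (𝓕⁻ ψ) x := by
  rw [pderivC_schwartz, T_pair h, ← integral_neg]
  congr 1; ext x
  rw [fourierInv_pderiv]; unfold D1; ring

lemma pair_lap {g : Esp N → ℂ} (h : MemLp g 2 (volume : Measure (Esp N)))
    (ψ : 𝓢(Esp N, ℂ)) : ∫ x, T g x * lapC ψ x = ∫ x, D2 g x * (𝓕⁻ ψ) x := by
  have e : lapC ψ = ⇑(∑ i, (∂_{(EuclideanSpace.single i (1 : ℝ) : Esp N)}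
      (∂_{(EuclideanSpace.single i (1 : ℝ) : Esp N)} ψ : 𝓢(Esp N, ℂ)) : 𝓢(Esp N, ℂ))) := by
    ext x
    rw [sum_apply]
    rfl
  rw [e, T_pair h]
  congr 1; ext x
  have e2 : (𝓕⁻ (∑ i, (∂_{(EuclideanSpace.single i (1 : ℝ) : Esp N)}
      (∂_{(EuclideanSpace.single i (1 : ℝ) : Esp N)} ψ : 𝓢(Esp N, ℂ)) : 𝓢(Esp N, ℂ)))) =
      ∑ i, 𝓕⁻ (∂_{(EuclideanSpace.single i (1 : ℝ) : Esp N)}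
      (∂_{(EuclideanSpace.single i (1 : ℝ) : Esp N)} ψ : 𝓢(Esp N, ℂ)) : 𝓢(Esp N, ℂ)) :=
    map_sum (FourierTransform.fourierInvCLM ℂ 𝓢(Esp N, ℂ)) _ _
  rw [e2, sum_apply]
  simp_rw [fourierInv_pderiv]
  unfold D2
  rw [EuclideanSpace.real_norm_sq_eq]
  have : ∀ i, -(2 * Real.pi * Complex.I * ((x i : ℝ) : ℂ)) *
     (-(2 * Real.pi * Complex.I * ((x i : ℝ) : ℂ)) * (𝓕⁻ ψ) x) =
     ((-(4 * Real.pi^2) * (x i)^2 : ℝ) : ℂ) * (𝓕⁻ ψ) x := by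
    intro i
    push_cast
    linear_combination (4 * (Real.pi : ℂ)^2 * (x i : ℂ)^2 * (𝓕⁻ ψ) x) * Complex.I_sq
  simp_rw [this]
  rw [← Finset.sum_mul, ← Complex.ofReal_sum, ← Finset.mul_sum]
  ring_nf

lemma D1_meas (i : Fin N) {g : Esp N → ℂ} (h : AEStronglyMeasurable g (volume : Measure (Esp N))) :
    AEStronglyMeasurable (D1 i g) (volume : Measure (Esp N)) := by
  unfold D1
  refine AEStronglyMeasurable.mul (Continuous.aestronglyMeasurable ?_) h
  fun_prop

lemma D2_meas {g : Esp N → ℂ} (h : AEStronglyMeasurable g (volume : Measure (Esp N))) :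
    AEStronglyMeasurable (D2 g) (volume : Measure (Esp N)) := by
  unfold D2
  refine AEStronglyMeasurable.mul (Continuous.aestronglyMeasurable ?_) h
  fun_prop

lemma ae_eq_of_pair {f k : Esp N → ℂ} (hf : LocallyIntegrable f (volume : Measure (Esp N)))
    (hk : LocallyIntegrable k (volume : Measure (Esp N)))
    (h : ∀ φ : 𝓢(Esp N, ℂ), HasCompactSupport φ → ∫ x, f x * φ x = ∫ x, k x * φ x) :
    f =ᵐ[volume] k := by
  have h1 := ae_zero_of_pair (hf.sub hk) (fun φ hφ => by
    have i1 : Integrable (fun x => f x * φ x) volume := by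
      simpa [smul_eq_mul] using
        hf.integrable_smul_right_of_hasCompactSupport φ.continuous hφ
    have i2 : Integrable (fun x => k x * φ x) volume := by
      simpa [smul_eq_mul] using
        hk.integrable_smul_right_of_hasCompactSupport φ.continuous hφ
    have : ∀ x, (f - k) x * φ x = f x * φ x - k x * φ x := fun x => by
      simp [sub_mul]
    simp_rw [this]
    rw [integral_sub i1 i2, h φ hφ, sub_self])
  filter_upwards [h1] with x hx
  simpa [sub_eq_zero] using hx

lemma locInt {g : Esp N → ℂ} (h : MemLp g 2 (volume : Measure (Esp N))) :
    LocallyIntegrable g (volume : Measure (Esp N)) := h.locallyIntegrable (by norm_num)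

lemma locInt_D1 (i : Fin N) {g : Esp N → ℂ} (h : LocallyIntegrable g (volume : Measure (Esp N))) :
    LocallyIntegrable (D1 i g) (volume : Measure (Esp N)) := by
  have hc : Continuous (fun ξ : Esp N => (2 * Real.pi * Complex.I * ((ξ i : ℝ) : ℂ))) := by fun_prop
  have := LocallyIntegrable.continuous_smul hc h
  exact this

lemma locInt_D2 {g : Esp N → ℂ} (h : LocallyIntegrable g (volume : Measure (Esp N))) :
    LocallyIntegrable (D2 g) (volume : Measure (Esp N)) := by
  have hc : Continuous (fun ξ : Esp N => ((-(4 * Real.pi ^ 2 * ‖ξ‖ ^ 2) : ℝ) : ℂ)) := by fun_prop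
  have := LocallyIntegrable.continuous_smul hc h
  exact this

lemma weak_pderiv_fourier {g h : Esp N → ℂ} {u v : Esp N → ℂ} (i : Fin N)
    (hg : MemLp g 2 (volume : Measure (Esp N)))
    (hh : MemLp h 2 (volume : Measure (Esp N)))
    (hu : T g =ᵐ[volume] u) (hv : T h =ᵐ[volume] v) (hw : IsWeakPDeriv u i v) :
    h =ᵐ[volume] D1 i g := by
  refine ae_eq_of_pair (locInt hh) (locInt_D1 i (locInt hg)) fun φ _ => ?_
  have h1 := weak_pderiv_ext ((memLp_congr_ae hu).1 (T_memLp hg))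
    ((memLp_congr_ae hv).1 (T_memLp hh)) hw (𝓕 φ)
  have h2 : ∫ x, u x * pderivC i (⇑(𝓕 φ : 𝓢(Esp N, ℂ))) x = ∫ x, T g x * pderivC i (⇑(𝓕 φ : 𝓢(Esp N, ℂ))) x :=
    integral_congr_ae (by filter_upwards [hu] with x hx; rw [hx])
  have h3 : ∫ x, v x * (𝓕 φ) x = ∫ x, T h x * (𝓕 φ) x :=
    integral_congr_ae (by filter_upwards [hv] with x hx; rw [hx])
  rw [h2, h3, pair_pderiv i hg, T_pair hh, FourierTransform.fourierInv_fourier_eq] at h1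
  exact (neg_injective h1).symm

lemma weak_lap_fourier {g h : Esp N → ℂ} {u v : Esp N → ℂ}
    (hg : MemLp g 2 (volume : Measure (Esp N)))
    (hh : MemLp h 2 (volume : Measure (Esp N)))
    (hu : T g =ᵐ[volume] u) (hv : T h =ᵐ[volume] v) (hw : IsWeakLap u v) :
    h =ᵐ[volume] D2 g := by
  refine ae_eq_of_pair (locInt hh) (locInt_D2 (locInt hg)) fun φ _ => ?_
  have h1 := weak_lap_ext ((memLp_congr_ae hu).1 (T_memLp hg))
    ((memLp_congr_ae hv).1 (T_memLp hh)) hw (𝓕 φ)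
  have h2 : ∫ x, u x * lapC (⇑(𝓕 φ : 𝓢(Esp N, ℂ))) x = ∫ x, T g x * lapC (⇑(𝓕 φ : 𝓢(Esp N, ℂ))) x :=
    integral_congr_ae (by filter_upwards [hu] with x hx; rw [hx])
  have h3 : ∫ x, v x * (𝓕 φ) x = ∫ x, T h x * (𝓕 φ) x :=
    integral_congr_ae (by filter_upwards [hv] with x hx; rw [hx])
  rw [h2, h3, pair_lap hg, T_pair hh, FourierTransform.fourierInv_fourier_eq] at h1
  exact h1.symm

/-- Fourier description of an element of `H2`. -/
structure Rep (U : H2 N) (g : Esp N → ℂ) : Prop where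
  mem : MemLp g 2 (volume : Measure (Esp N))
  mem1 : ∀ i, MemLp (D1 i g) 2 (volume : Measure (Esp N))
  mem2 : MemLp (D2 g) 2 (volume : Measure (Esp N))
  eq : U.u =ᵐ[volume] T g
  eq1 : ∀ i, U.grad i =ᵐ[volume] T (D1 i g)
  eq2 : U.lapl =ᵐ[volume] T (D2 g)

lemma exists_rep (U : H2 N) : ∃ g, Rep U g := by
  obtain ⟨g, hg, hu⟩ := T_surj U.u_mem
  obtain ⟨h, hh, hv⟩ := T_surj U.lapl_mem
  choose k hk hw using fun i => T_surj (U.grad_mem i)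
  have e1 := fun i => weak_pderiv_fourier i hg (hk i) hu (hw i) (U.grad_spec i)
  have e2 := weak_lap_fourier hg hh hu hv U.lapl_spec
  refine ⟨g, hg, fun i => (memLp_congr_ae (e1 i)).1 (hk i), (memLp_congr_ae e2).1 hh, hu.symm,
    fun i => ?_, ?_⟩
  · rw [← T_congr (e1 i)]; exact (hw i).symm
  · rw [← T_congr e2]; exact hv.symm

lemma mem_D1_of {g : Esp N → ℂ} (hg : MemLp g 2 (volume : Measure (Esp N)))
    (h2 : MemLp (D2 g) 2 (volume : Measure (Esp N))) (i : Fin N) :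
    MemLp (D1 i g) 2 (volume : Measure (Esp N)) := by
  refine MemLp.of_le (g := fun x => ‖g x‖ + ‖D2 g x‖) (hg.norm.add h2.norm) (D1_meas i hg.1) ?_
  refine Eventually.of_forall fun x => ?_
  have hx : |x i| ≤ ‖x‖ := by simpa using PiLp.norm_apply_le x i
  have : ‖D1 i g x‖ = 2 * Real.pi * |x i| * ‖g x‖ := by
    simp [D1, abs_of_pos Real.pi_pos]
  rw [this]
  have e : ‖D2 g x‖ = 4 * Real.pi ^ 2 * ‖x‖ ^ 2 * ‖g x‖ := by
    unfold D2
    rw [norm_mul, Complex.norm_real, Real.norm_eq_abs, abs_neg, abs_of_nonneg (by positivity)]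
  rw [e, Real.norm_eq_abs]
  refine le_trans ?_ (le_abs_self _)
  have h3 : 2 * Real.pi * |x i| ≤ 1 + 4 * Real.pi ^ 2 * ‖x‖ ^ 2 := by
    have : 2 * Real.pi * |x i| ≤ 2 * Real.pi * ‖x‖ := by gcongr
    nlinarith [sq_nonneg (2 * Real.pi * ‖x‖ - 1)]
  nlinarith [norm_nonneg (g x)]

/-- Build an element of `H2` from its Fourier transform. -/
def mkH2 (g : Esp N → ℂ) (hg : MemLp g 2 (volume : Measure (Esp N)))
    (h2 : MemLp (D2 g) 2 (volume : Measure (Esp N))) : H2 N where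
  u := T g
  grad i := T (D1 i g)
  lapl := T (D2 g)
  u_mem := T_memLp hg
  grad_mem i := T_memLp (mem_D1_of hg h2 i)
  lapl_mem := T_memLp h2
  grad_spec i := by
    rintro φ ⟨h1, hc⟩
    obtain ⟨ψ, hψ⟩ := exists_schwartz h1 hc
    obtain rfl : ⇑ψ = φ := funext hψ
    rw [pair_pderiv i hg, T_pair (mem_D1_of hg h2 i)]
  lapl_spec := by
    rintro φ ⟨h1, hc⟩
    obtain ⟨ψ, hψ⟩ := exists_schwartz h1 hc
    obtain rfl : ⇑ψ = φ := funext hψ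
    rw [pair_lap hg, T_pair h2]

lemma rep_mkH2 {g : Esp N → ℂ} (hg : MemLp g 2 (volume : Measure (Esp N)))
    (h2 : MemLp (D2 g) 2 (volume : Measure (Esp N))) : Rep (mkH2 g hg h2) g :=
  ⟨hg, mem_D1_of hg h2, h2, EventuallyEq.rfl, fun _ => EventuallyEq.rfl, EventuallyEq.rfl⟩

end SW
end P3

section P4
open scoped FourierTransform SchwartzMap ENNReal
open LineDeriv
namespace SW
variable {N : ℕ}

/-- The symbol of `-(Δ+1)`. -/
def wt (ξ : Esp N) : ℝ := 4 * Real.pi ^ 2 * ‖ξ‖ ^ 2 - 1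

/-- `∫ |Δu + u|²`. -/
def Bsq (U : H2 N) : ℝ := ∫ x, ‖U.lapl x + U.u x‖ ^ 2

lemma integral_sq_eq {f : Esp N → ℂ} (hf : AEStronglyMeasurable f (volume : Measure (Esp N))) :
    ∫ x, ‖f x‖ ^ 2 = (∫⁻ x, ‖f x‖ₑ ^ 2).toReal := by
  rw [integral_eq_lintegral_of_nonneg_ae (Eventually.of_forall fun x => by positivity)
    (by simpa using hf.norm.aemeasurable.pow_const (2 : ℕ) |>.aestronglyMeasurable)]
  congr 2; ext x
  rw [ENNReal.ofReal_pow (norm_nonneg _), ofReal_norm]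

lemma T_integral {g : Esp N → ℂ} (h : MemLp g 2 (volume : Measure (Esp N))) :
    ∫ x, ‖T g x‖ ^ 2 = ∫ x, ‖g x‖ ^ 2 := by
  rw [integral_sq_eq (T_memLp h).1, integral_sq_eq h.1, T_lintegral h]

lemma int_sq {g : Esp N → ℂ} (h : MemLp g 2 (volume : Measure (Esp N))) :
    Integrable (fun x => ‖g x‖ ^ 2) volume := h.integrable_norm_pow (by norm_num)

lemma norm_D2 (g : Esp N → ℂ) (x : Esp N) : ‖D2 g x‖ = 4 * Real.pi ^ 2 * ‖x‖ ^ 2 * ‖g x‖ := by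
  unfold D2
  rw [norm_mul, Complex.norm_real, Real.norm_eq_abs, abs_neg, abs_of_nonneg (by positivity)]

lemma norm_D1 (i : Fin N) (g : Esp N → ℂ) (x : Esp N) :
    ‖D1 i g x‖ = 2 * Real.pi * |x i| * ‖g x‖ := by
  simp [D1, abs_of_pos Real.pi_pos]

lemma norm_D2add (g : Esp N → ℂ) (x : Esp N) : ‖D2 g x + g x‖ = |wt x| * ‖g x‖ := by
  have : D2 g x + g x = ((- wt x : ℝ) : ℂ) * g x := by
    unfold D2 wt; push_cast; ring
  rw [this, norm_mul, Complex.norm_real, Real.norm_eq_abs, abs_neg]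


lemma Rep.massSq {U : H2 N} {g : Esp N → ℂ} (h : Rep U g) : U.massSq = ∫ x, ‖g x‖ ^ 2 := by
  rw [← T_integral h.mem]
  exact integral_congr_ae (by filter_upwards [h.eq] with x hx; rw [hx])

lemma Rep.lapSq' {U : H2 N} {g : Esp N → ℂ} (h : Rep U g) : U.lapSq = ∫ x, ‖D2 g x‖ ^ 2 := by
  rw [← T_integral h.mem2]
  exact integral_congr_ae (by filter_upwards [h.eq2] with x hx; rw [hx])

lemma Rep.lapSq {U : H2 N} {g : Esp N → ℂ} (h : Rep U g) : U.lapSq = ∫ x, (4 * Real.pi ^ 2 * ‖x‖ ^ 2) ^ 2 * ‖g x‖ ^ 2 := by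
  rw [h.lapSq']
  congr 1; ext x; rw [norm_D2, mul_pow]

lemma Rep.gradSq {U : H2 N} {g : Esp N → ℂ} (h : Rep U g) : U.gradSq = ∫ x, (4 * Real.pi ^ 2 * ‖x‖ ^ 2) * ‖g x‖ ^ 2 := by
  have e : ∀ i, ∫ x, ‖U.grad i x‖ ^ 2 = ∫ x, ‖D1 i g x‖ ^ 2 := fun i => by
    rw [← T_integral (h.mem1 i)]
    exact integral_congr_ae (by filter_upwards [h.eq1 i] with x hx; rw [hx])
  unfold H2.gradSq
  simp_rw [e]
  rw [← integral_finsetSum _ fun i _ => int_sq (h.mem1 i)]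
  congr 1; ext x
  simp_rw [norm_D1, EuclideanSpace.real_norm_sq_eq, mul_pow, sq_abs]
  rw [← Finset.sum_mul, ← Finset.mul_sum]; ring

lemma Rep.int0 {U : H2 N} {g : Esp N → ℂ} (h : Rep U g) : Integrable (fun x => ‖g x‖ ^ 2) volume := int_sq h.mem

lemma Rep.int2 {U : H2 N} {g : Esp N → ℂ} (h : Rep U g) : Integrable (fun x => (4 * Real.pi ^ 2 * ‖x‖ ^ 2) ^ 2 * ‖g x‖ ^ 2) volume := by
  have := int_sq h.mem2
  simp_rw [norm_D2, mul_pow _ (‖g _‖)] at this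
  exact this

lemma Rep.int1 {U : H2 N} {g : Esp N → ℂ} (h : Rep U g) : Integrable (fun x => (4 * Real.pi ^ 2 * ‖x‖ ^ 2) * ‖g x‖ ^ 2) volume := by
  have := integrable_finsetSum Finset.univ fun i _ => int_sq (h.mem1 i)
  refine this.congr (Eventually.of_forall fun x => ?_)
  simp only
  simp_rw [norm_D1, EuclideanSpace.real_norm_sq_eq, mul_pow, sq_abs]
  rw [← Finset.sum_mul, ← Finset.mul_sum]; ring

lemma Rep.eqB {U : H2 N} {g : Esp N → ℂ} (h : Rep U g) : (fun x => U.lapl x + U.u x) =ᵐ[volume] T (fun x => D2 g x + g x) := by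
  filter_upwards [T_add h.mem2 h.mem, h.eq, h.eq2] with x h1 h2 h3
  rw [h1, h2, h3]

lemma Rep.Bsq {U : H2 N} {g : Esp N → ℂ} (h : Rep U g) : Bsq U = ∫ x, wt x ^ 2 * ‖g x‖ ^ 2 := by
  have := T_integral (h.mem2.add h.mem)
  have e : ∫ x, ‖(D2 g + g) x‖ ^ 2 = ∫ x, wt x ^ 2 * ‖g x‖ ^ 2 := by
    congr 1; ext x; rw [Pi.add_apply, norm_D2add, mul_pow, sq_abs]
  rw [← e, ← this]
  exact integral_congr_ae (by filter_upwards [h.eqB] with x hx; rw [hx]; rfl)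

lemma Rep.intB {U : H2 N} {g : Esp N → ℂ} (h : Rep U g) : Integrable (fun x => wt x ^ 2 * ‖g x‖ ^ 2) volume := by
  have := int_sq (h.mem2.add h.mem)
  refine this.congr (Eventually.of_forall fun x => ?_)
  simp only
  rw [Pi.add_apply, norm_D2add, mul_pow, sq_abs]

/-- quadratic form identity -/
lemma Rep.quad {U : H2 N} {g : Esp N → ℂ} (h : Rep U g) (t : ℝ) : ∫ x, (4 * Real.pi ^ 2 * ‖x‖ ^ 2 - t) ^ 2 * ‖g x‖ ^ 2 =
    U.lapSq - 2 * t * U.gradSq + t ^ 2 * U.massSq := by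
  rw [h.lapSq, h.gradSq, h.massSq, ← integral_const_mul, ← integral_const_mul,
    ← integral_sub h.int2 (h.int1.const_mul _)]
  have hi : Integrable (fun x => (4 * Real.pi ^ 2 * ‖x‖ ^ 2) ^ 2 * ‖g x‖ ^ 2 -
      2 * t * (4 * Real.pi ^ 2 * ‖x‖ ^ 2 * ‖g x‖ ^ 2)) volume := h.int2.sub (h.int1.const_mul _)
  rw [← integral_add hi (h.int0.const_mul _)]
  congr 1; ext x; ring


lemma Bsq_eq (U : H2 N) : Bsq U = U.lapSq - 2 * U.gradSq + U.massSq := by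
  obtain ⟨g, h⟩ := exists_rep U
  have := h.quad 1
  rw [h.Bsq]; unfold wt; rw [this]; ring

lemma quad_nonneg (U : H2 N) (t : ℝ) : 0 ≤ U.lapSq - 2 * t * U.gradSq + t ^ 2 * U.massSq := by
  obtain ⟨g, h⟩ := exists_rep U
  rw [← h.quad t]
  exact integral_nonneg fun x => by positivity

lemma massSq_nonneg (U : H2 N) : 0 ≤ U.massSq := integral_nonneg fun x => by positivity
lemma lapSq_nonneg (U : H2 N) : 0 ≤ U.lapSq := integral_nonneg fun x => by positivity
lemma gradSq_nonneg (U : H2 N) : 0 ≤ U.gradSq :=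
  Finset.sum_nonneg fun _ _ => integral_nonneg fun x => by positivity
lemma Bsq_nonneg (U : H2 N) : 0 ≤ Bsq U := integral_nonneg fun x => by positivity
lemma pPow_nonneg (σ : ℝ) (U : H2 N) : 0 ≤ U.pPow σ := integral_nonneg fun x => by positivity

lemma grad_cs (U : H2 N) : U.gradSq ^ 2 ≤ U.lapSq * U.massSq := by
  have := discrim_le_zero (a := U.massSq) (b := - 2 * U.gradSq) (c := U.lapSq)
    (fun t => by have := quad_nonneg U t; nlinarith)
  unfold discrim at this; nlinarith

lemma energy_eq (σ : ℝ) (U : H2 N) :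
    U.energy σ = Bsq U - (1 / (σ + 1)) * U.pPow σ - U.massSq := by
  rw [Bsq_eq]; unfold H2.energy; ring

lemma pPow_eq (σ : ℝ) (hσ : 0 < σ) (U : H2 N) :
    U.pPow σ = (∫⁻ x, ‖U.u x‖ₑ ^ (2 * σ + 2)).toReal := by
  unfold H2.pPow
  rw [integral_eq_lintegral_of_nonneg_ae (Eventually.of_forall fun x => by positivity)
    (U.u_mem.1.norm.aemeasurable.pow_const _).aestronglyMeasurable]
  congr 2; ext x
  rw [← ENNReal.ofReal_rpow_of_nonneg (norm_nonneg _) (by positivity), ofReal_norm]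

lemma rLp_two {f : Esp N → ℂ} (hf : AEStronglyMeasurable f (volume : Measure (Esp N))) :
    rLp 2 f = Real.sqrt (∫ x, ‖f x‖ ^ 2) := by
  rw [integral_sq_eq hf, ← eLpNorm_two_sq]
  unfold rLp
  simp

lemma rLp_pow (σ : ℝ) (hσ : 0 < σ) (U : H2 N) :
    rLp (2 * σ + 2) U.u = U.pPow σ ^ (1 / (2 * σ + 2)) := by
  unfold rLp
  rw [pPow_eq σ hσ, eLpNorm_eq_lintegral_rpow_enorm_toReal (by simp; linarith) (by simp),
    ENNReal.toReal_ofReal (by linarith), ENNReal.toReal_rpow]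

lemma nontriv_iff (U : H2 N) : U.Nontriv ↔ 0 < U.massSq := by
  unfold H2.Nontriv
  rw [not_iff_comm, not_lt]
  have h0 := massSq_nonneg U
  constructor
  · intro h
    have h1 : U.massSq = 0 := le_antisymm h h0
    unfold H2.massSq at h1
    rw [integral_eq_zero_iff_of_nonneg (fun x => by positivity) (int_sq U.u_mem)] at h1
    filter_upwards [h1] with x hx
    simpa using hx
  · intro h
    have : U.massSq = ∫ x : Esp N, (0 : ℝ) :=
      integral_congr_ae (by filter_upwards [h] with x hx; rw [hx]; simp)
    rw [this]; simp

/-- scalar multiple -/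
def smulH (c : ℂ) (U : H2 N) : H2 N where
  u := fun x => c * U.u x
  grad i := fun x => c * U.grad i x
  lapl := fun x => c * U.lapl x
  u_mem := U.u_mem.const_mul c
  grad_mem i := (U.grad_mem i).const_mul c
  lapl_mem := U.lapl_mem.const_mul c
  grad_spec i := by
    intro φ hφ
    have := U.grad_spec i φ hφ
    simp_rw [mul_assoc]
    rw [integral_const_mul, integral_const_mul, this]; ring
  lapl_spec := by
    intro φ hφ
    have := U.lapl_spec φ hφ
    simp_rw [mul_assoc]
    rw [integral_const_mul, integral_const_mul, this]

lemma smulH_mass (c : ℂ) (U : H2 N) : (smulH c U).massSq = ‖c‖ ^ 2 * U.massSq := by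
  unfold smulH H2.massSq; simp only [norm_mul, mul_pow]; rw [integral_const_mul]

lemma smulH_B (c : ℂ) (U : H2 N) : Bsq (smulH c U) = ‖c‖ ^ 2 * Bsq U := by
  unfold smulH Bsq; simp only [← mul_add, norm_mul, mul_pow]; rw [integral_const_mul]

lemma smulH_p (σ : ℝ) (c : ℂ) (U : H2 N) :
    (smulH c U).pPow σ = ‖c‖ ^ (2 * σ + 2) * U.pPow σ := by
  unfold smulH H2.pPow
  simp only [norm_mul, Real.mul_rpow (norm_nonneg _) (norm_nonneg _)]; rw [integral_const_mul]

lemma comp_smul_int (t : ℝ) (ht : 0 < t) {F : Type*} [NormedAddCommGroup F] [NormedSpace ℝ F]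
    (f : Esp N → F) : ∫ x, f (t • x) = (t ^ N)⁻¹ • ∫ x, f x := by
  rw [Measure.integral_comp_smul_of_nonneg volume f t (hR := ht.le)]
  simp

lemma memLp_dil {f : Esp N → ℂ} (hf : MemLp f 2 (volume : Measure (Esp N))) (t : ℝ) (ht : 0 < t) :
    MemLp (fun x => f (t • x)) 2 (volume : Measure (Esp N)) := by
  have e : (fun x => f (t • x)) = f ∘ (fun x : Esp N => t • x) := rfl
  have hm : Measurable (fun x : Esp N => t • x) := measurable_const_smul t
  have hmap : Measure.map (fun x : Esp N => t • x) volume =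
      ENNReal.ofReal |(t ^ Module.finrank ℝ (Esp N))⁻¹| • volume :=
    Measure.map_addHaar_smul volume ht.ne'
  rw [e]
  refine MemLp.comp_of_map ?_ hm.aemeasurable
  rw [hmap]
  exact hf.smul_measure (by simp)

/-- dilation -/
def dil (t : ℝ) (ht : 0 < t) (U : H2 N) : H2 N where
  u := fun x => U.u (t • x)
  grad i := fun x => (t : ℂ) * U.grad i (t • x)
  lapl := fun x => ((t ^ 2 : ℝ) : ℂ) * U.lapl (t • x)
  u_mem := memLp_dil U.u_mem t ht
  grad_mem i := (memLp_dil (U.grad_mem i) t ht).const_mul _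
  lapl_mem := (memLp_dil U.lapl_mem t ht).const_mul _
  grad_spec i := by
    intro φ hφ
    have hφ' : TestFun (fun x : Esp N => φ (t⁻¹ • x)) :=
      ⟨hφ.1.comp (contDiff_const_smul _), hφ.2.comp_smul (by positivity)⟩
    have h1 := U.grad_spec i _ hφ'
    rw [pderivC_scale i _ (diff_of hφ.1)] at h1
    have e1 := comp_smul_int t ht (fun y => U.u y * pderivC i φ (t⁻¹ • y))
    have e2 := comp_smul_int t ht (fun y => U.grad i y * φ (t⁻¹ • y))
    simp only [smul_smul, inv_mul_cancel₀ ht.ne', one_smul] at e1 e2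
    simp_rw [mul_assoc]
    rw [integral_const_mul, e1, e2]
    have h2 : ∫ y, U.u y * (((t⁻¹ : ℝ) : ℂ) * pderivC i φ (t⁻¹ • y)) =
        ((t⁻¹ : ℝ) : ℂ) * ∫ y, U.u y * pderivC i φ (t⁻¹ • y) := by
      rw [← integral_const_mul]; congr 1; ext y; ring
    rw [h2] at h1
    have ht' : (t : ℂ) ≠ 0 := by exact_mod_cast ht.ne'
    have h3 : ∫ y, U.u y * pderivC i φ (t⁻¹ • y) = - ((t : ℂ) *
      ∫ y, U.grad i y * φ (t⁻¹ • y)) := by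
      rw [← mul_neg, ← h1]; push_cast; field_simp
    rw [h3, smul_neg, mul_smul_comm]
  lapl_spec := by
    intro φ hφ
    have hφ' : TestFun (fun x : Esp N => φ (t⁻¹ • x)) :=
      ⟨hφ.1.comp (contDiff_const_smul _), hφ.2.comp_smul (by positivity)⟩
    have h1 := U.lapl_spec _ hφ'
    have el : lapC (fun x : Esp N => φ (t⁻¹ • x)) =
        fun y => (((t⁻¹) ^ 2 : ℝ) : ℂ) * lapC φ (t⁻¹ • y) := by
      ext y
      unfold lapC
      rw [Finset.mul_sum]
      refine Finset.sum_congr rfl fun i _ => ?_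
      have hd : ContDiff ℝ (⊤ : ℕ∞) (pderivC i φ) := contDiff_pderivC i hφ.1
      rw [pderivC_scale i _ (diff_of hφ.1), pderivC_const_mul i _
        (a := fun x => pderivC i φ (t⁻¹ • x)) (diff_of (hd.comp (contDiff_const_smul _))), pderivC_scale i _ (diff_of hd)]
      push_cast; ring
    rw [el] at h1
    have e1 := comp_smul_int t ht (fun y => U.u y * lapC φ (t⁻¹ • y))
    have e2 := comp_smul_int t ht (fun y => U.lapl y * φ (t⁻¹ • y))
    simp only [smul_smul, inv_mul_cancel₀ ht.ne', one_smul] at e1 e2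
    simp_rw [mul_assoc]
    rw [integral_const_mul, e1, e2, ← h1]
    have h2 : ∫ y, U.u y * ((((t⁻¹) ^ 2 : ℝ) : ℂ) * lapC φ (t⁻¹ • y)) =
        (((t⁻¹) ^ 2 : ℝ) : ℂ) * ∫ y, U.u y * lapC φ (t⁻¹ • y) := by
      rw [← integral_const_mul]; congr 1; ext y; ring
    rw [h2, mul_smul_comm, ← mul_assoc, ← Complex.ofReal_mul]
    have : t ^ 2 * t⁻¹ ^ 2 = 1 := by field_simp
    rw [this]; simp

lemma dil_mass (t : ℝ) (ht : 0 < t) (U : H2 N) : (dil t ht U).massSq = (t ^ N)⁻¹ * U.massSq := by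
  unfold dil H2.massSq
  exact comp_smul_int t ht (fun y => ‖U.u y‖ ^ 2)

lemma dil_p (σ : ℝ) (t : ℝ) (ht : 0 < t) (U : H2 N) :
    (dil t ht U).pPow σ = (t ^ N)⁻¹ * U.pPow σ := by
  unfold dil H2.pPow
  exact comp_smul_int t ht (fun y => ‖U.u y‖ ^ (2 * σ + 2))

lemma dil_lap (t : ℝ) (ht : 0 < t) (U : H2 N) :
    (dil t ht U).lapSq = t ^ 4 * ((t ^ N)⁻¹ * U.lapSq) := by
  unfold dil H2.lapSq
  have := comp_smul_int t ht (fun y => ‖U.lapl y‖ ^ 2)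
  simp only [norm_mul, mul_pow, Complex.norm_real, Real.norm_eq_abs, abs_of_pos (pow_pos ht 2)]
  rw [integral_const_mul, this, smul_eq_mul]; ring

lemma dil_grad (t : ℝ) (ht : 0 < t) (U : H2 N) :
    (dil t ht U).gradSq = t ^ 2 * ((t ^ N)⁻¹ * U.gradSq) := by
  unfold dil H2.gradSq
  rw [Finset.mul_sum, Finset.mul_sum]
  refine Finset.sum_congr rfl fun i _ => ?_
  have := comp_smul_int t ht (fun y => ‖U.grad i y‖ ^ 2)
  simp only [norm_mul, mul_pow, Complex.norm_real, Real.norm_eq_abs, abs_of_pos ht]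
  rw [integral_const_mul, this, smul_eq_mul]

end SW
end P4

section P5
open scoped FourierTransform SchwartzMap ENNReal
open LineDeriv
namespace SW
variable {N : ℕ}

lemma Rep.congr {U : H2 N} {g g' : Esp N → ℂ} (h : Rep U g) (e : g =ᵐ[volume] g') : Rep U g' := by
  have e1 : ∀ i, D1 i g =ᵐ[volume] D1 i g' := fun i => by
    filter_upwards [e] with x hx; simp [D1, hx]
  have e2 : D2 g =ᵐ[volume] D2 g' := by
    filter_upwards [e] with x hx; simp [D2, hx]
  exact ⟨(memLp_congr_ae e).1 h.mem, fun i => (memLp_congr_ae (e1 i)).1 (h.mem1 i),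
    (memLp_congr_ae e2).1 h.mem2, T_congr e ▸ h.eq, fun i => T_congr (e1 i) ▸ h.eq1 i,
    T_congr e2 ▸ h.eq2⟩

lemma exists_rep' (U : H2 N) : ∃ g, Measurable g ∧ Rep U g := by
  obtain ⟨g, h⟩ := exists_rep U
  exact ⟨h.mem.1.mk g, h.mem.1.stronglyMeasurable_mk.measurable, h.congr h.mem.1.ae_eq_mk⟩

/-- Cauchy-Schwarz -/
lemma lcs {α : Type*} [MeasurableSpace α] (μ : Measure α) {f g : α → ℝ≥0∞}
    (hf : AEMeasurable f μ) (hg : AEMeasurable g μ) :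
    (∫⁻ a, f a * g a ∂μ) ^ 2 ≤ (∫⁻ a, f a ^ 2 ∂μ) * (∫⁻ a, g a ^ 2 ∂μ) := by
  have := ENNReal.lintegral_mul_le_Lp_mul_Lq μ Real.HolderConjugate.two_two hf hg
  simp only [Pi.mul_apply, ENNReal.rpow_two] at this
  calc _ ≤ _ := pow_le_pow_left₀ zero_le this 2
    _ = _ := by
      rw [mul_pow, ← ENNReal.rpow_natCast, ← ENNReal.rpow_natCast, ← ENNReal.rpow_mul,
        ← ENNReal.rpow_mul]
      norm_num

/-- weighted Cauchy-Schwarz -/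
lemma lcs_weight {α : Type*} [MeasurableSpace α] (μ : Measure α) {f W : α → ℝ≥0∞}
    (hf : AEMeasurable f μ) (hW : AEMeasurable W μ) (h0 : ∀ᵐ a ∂μ, W a ≠ 0)
    (h1 : ∀ᵐ a ∂μ, W a ≠ ⊤) :
    (∫⁻ a, f a ∂μ) ^ 2 ≤ (∫⁻ a, W a * f a ^ 2 ∂μ) * (∫⁻ a, (W a)⁻¹ ∂μ) := by
  have := lcs μ (f := fun a => W a ^ (1/2 : ℝ) * f a) (g := fun a => W a ^ (-(1/2) : ℝ))
    ((hW.pow_const _).mul hf) (hW.pow_const _)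
  have e1 : ∫⁻ a, W a ^ (1/2 : ℝ) * f a * W a ^ (-(1/2) : ℝ) ∂μ = ∫⁻ a, f a ∂μ := by
    apply lintegral_congr_ae
    filter_upwards [h0, h1] with a h0 h1
    rw [mul_right_comm, ← ENNReal.rpow_add _ _ h0 h1]; simp
  have e2 : ∫⁻ a, (W a ^ (1/2 : ℝ) * f a) ^ 2 ∂μ = ∫⁻ a, W a * f a ^ 2 ∂μ := by
    congr 1; ext a
    rw [mul_pow, ← ENNReal.rpow_natCast, ← ENNReal.rpow_mul]; norm_num
  have e3 : ∫⁻ a, (W a ^ (-(1/2) : ℝ)) ^ 2 ∂μ = ∫⁻ a, (W a)⁻¹ ∂μ := by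
    congr 1; ext a
    rw [← ENNReal.rpow_natCast, ← ENNReal.rpow_mul, ← ENNReal.rpow_neg_one]; norm_num
  rwa [e1, e2, e3] at this

/-- sup bound -/
lemma T_sup {h : Esp N → ℂ} (hm : MemLp h 2 (volume : Measure (Esp N))) :
    ∀ᵐ x, ‖T h x‖ₑ ≤ ∫⁻ y, ‖h y‖ₑ := by
  by_cases hf : ∫⁻ y, ‖h y‖ₑ < ⊤
  · filter_upwards [T_eq_integral ⟨hm.1, hf⟩ hm] with x hx
    rw [hx]; exact norm_fourierInv_le h x
  · rw [not_lt, top_le_iff] at hf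
    rw [hf]; exact Eventually.of_forall fun x => le_top

lemma T_split {g : Esp N → ℂ} (hm : MemLp g 2 (volume : Measure (Esp N))) {s : Set (Esp N)}
    (hs : MeasurableSet s) : T g =ᵐ[volume] fun x => T (s.indicator g) x + T (sᶜ.indicator g) x := by
  have := T_add (hm.indicator hs) (hm.indicator hs.compl)
  have e : (fun x => s.indicator g x + sᶜ.indicator g x) = g := by
    ext x; exact congrFun (Set.indicator_self_add_compl s g) x
  rwa [e] at this

lemma lint_ind (g : Esp N → ℂ) {s : Set (Esp N)} (hs : MeasurableSet s) :
    ∫⁻ x, ‖s.indicator g x‖ₑ ^ 2 = ∫⁻ x in s, ‖g x‖ₑ ^ 2 := by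
  rw [← lintegral_indicator hs]
  congr 1; ext x
  by_cases hx : x ∈ s <;> simp [hx]

lemma lint_ind1 (g : Esp N → ℂ) {s : Set (Esp N)} (hs : MeasurableSet s) :
    ∫⁻ x, ‖s.indicator g x‖ₑ = ∫⁻ x in s, ‖g x‖ₑ := by
  rw [← lintegral_indicator hs]
  congr 1; ext x
  by_cases hx : x ∈ s <;> simp [hx]

/-- Chebyshev -/
lemma cheb {h : Esp N → ℂ} (hm : MemLp h 2 (volume : Measure (Esp N))) {a : ℝ} (ha : 0 < a) :
    volume {x | a ≤ ‖T h x‖} ≤ ENNReal.ofReal (a⁻¹ ^ 2) * ∫⁻ y, ‖h y‖ₑ ^ 2 := by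
  rw [← T_lintegral hm]
  have h1 := mul_meas_ge_le_lintegral₀ (μ := (volume : Measure (Esp N)))
    (f := fun x => ‖T h x‖ₑ ^ 2) ((T_memLp hm).1.enorm.pow_const 2) (ENNReal.ofReal (a ^ 2))
  have e : {x : Esp N | ENNReal.ofReal (a ^ 2) ≤ ‖T h x‖ₑ ^ 2} = {x | a ≤ ‖T h x‖} := by
    ext x
    simp only [Set.mem_ofPred_eq]
    rw [← ofReal_norm, ← ENNReal.ofReal_pow (norm_nonneg _), ENNReal.ofReal_le_ofReal_iff
      (by positivity), pow_le_pow_iff_left₀ ha.le (norm_nonneg _) (by norm_num)]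
  rw [e] at h1
  calc _ = ENNReal.ofReal (a⁻¹ ^ 2) * (ENNReal.ofReal (a ^ 2) * volume {x | a ≤ ‖T h x‖}) := by
        rw [← mul_assoc, ← ENNReal.ofReal_mul (by positivity), ← mul_pow, inv_mul_cancel₀ ha.ne']
        simp
    _ ≤ _ := by gcongr

lemma level (g : Esp N → ℂ) (hg : Measurable g) (hm : MemLp g 2 (volume : Measure (Esp N)))
    {K γ q : ℝ} (hK : 0 < K) (hγ : 0 < γ) (hq : 2 < q)
    (hb : ∀ ρ : ℝ, 0 < ρ → ∫⁻ ξ in {ξ : Esp N | ‖ξ‖ < ρ}, ‖g ξ‖ₑ ≤ ENNReal.ofReal (K * ρ ^ γ)) :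
    ∫⁻ x, ‖T g x‖ₑ ^ q ≤ ENNReal.ofReal (4 * q / (q - 2) * (2 * K) ^ (q - 2)) *
      ∫⁻ ξ, ENNReal.ofReal (‖ξ‖ ^ (γ * (q - 2))) * ‖g ξ‖ₑ ^ 2 := by
  have e0 : ∫⁻ x, ‖T g x‖ₑ ^ q = ∫⁻ x, ENNReal.ofReal (‖T g x‖ ^ q) := by
    congr 1; ext x
    rw [← ENNReal.ofReal_rpow_of_nonneg (norm_nonneg _) (by linarith), ofReal_norm]
  have key : ∀ t : ℝ, 0 < t → volume {x | t < ‖T g x‖} ≤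
      ENNReal.ofReal (4 * t⁻¹ ^ 2) * ∫⁻ ξ in {ξ : Esp N | t ≤ 2 * K * ‖ξ‖ ^ γ}, ‖g ξ‖ₑ ^ 2 := by
    intro t ht
    set s : Set (Esp N) := {ξ : Esp N | ‖ξ‖ < (t / (2 * K)) ^ (1 / γ)} with hs
    have hsm : MeasurableSet s := measurableSet_lt measurable_norm measurable_const
    have hsc : sᶜ = {ξ : Esp N | t ≤ 2 * K * ‖ξ‖ ^ γ} := by
      ext ξ
      simp only [hs, Set.mem_compl_iff, Set.mem_ofPred_eq, not_lt]
      rw [one_div, Real.rpow_inv_le_iff_of_pos (by positivity) (norm_nonneg _) hγ, div_le_iff₀ (by positivity), mul_comm]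
    have h1 : ∀ᵐ x, ‖T (s.indicator g) x‖ ≤ t / 2 := by
      filter_upwards [T_sup (hm.indicator hsm)] with x hx
      rw [lint_ind1 g hsm] at hx
      have := hx.trans (hb _ (by positivity))
      rw [← ofReal_norm, ENNReal.ofReal_le_ofReal_iff (by positivity), ← Real.rpow_mul
        (by positivity), one_div_mul_cancel hγ.ne', Real.rpow_one] at this
      refine this.trans (le_of_eq ?_); field_simp
    have h2 := cheb (hm.indicator hsm.compl) (a := t / 2) (by positivity)
    rw [lint_ind g hsm.compl, hsc] at h2
    have e4 : (t / 2)⁻¹ ^ 2 = 4 * t⁻¹ ^ 2 := by field_simp; norm_num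
    rw [e4] at h2
    refine le_trans (measure_mono_ae ?_) h2
    filter_upwards [h1, T_split hm hsm] with x h3 h4 h5
    have h5' : t < ‖T g x‖ := h5
    rw [h4] at h5'
    have := norm_add_le (T (s.indicator g) x) (T (sᶜ.indicator g) x)
    rw [hsc] at *
    change t / 2 ≤ _
    linarith
  rw [e0, lintegral_rpow_eq_lintegral_meas_lt_mul _ (Eventually.of_forall fun x => norm_nonneg _)
    (T_memLp hm).1.norm.aemeasurable (by linarith)]
  have s1 : ∫⁻ t in Set.Ioi (0 : ℝ), volume {x | t < ‖T g x‖} * ENNReal.ofReal (t ^ (q - 1)) ≤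
      ∫⁻ t in Set.Ioi (0 : ℝ), ∫⁻ ξ, ({p : ℝ × Esp N | p.1 ≤ 2 * K * ‖p.2‖ ^ γ}.indicator
        (fun p => ENNReal.ofReal (4 * p.1 ^ (q - 3)) * ‖g p.2‖ₑ ^ 2) (t, ξ)) := by
    refine setLIntegral_mono' measurableSet_Ioi fun t ht => ?_
    have ht' : 0 < t := ht
    calc _ ≤ ENNReal.ofReal (4 * t⁻¹ ^ 2) * (∫⁻ ξ in {ξ : Esp N | t ≤ 2 * K * ‖ξ‖ ^ γ}, ‖g ξ‖ₑ ^ 2)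
          * ENNReal.ofReal (t ^ (q - 1)) := by gcongr; exact key t ht'
      _ = ENNReal.ofReal (4 * t ^ (q - 3)) *
          ∫⁻ ξ in {ξ : Esp N | t ≤ 2 * K * ‖ξ‖ ^ γ}, ‖g ξ‖ₑ ^ 2 := by
          rw [mul_right_comm, ← ENNReal.ofReal_mul (by positivity)]
          congr 2
          have : q - 1 = (q - 3) + 2 := by ring
          rw [this, Real.rpow_add ht', Real.rpow_two]
          field_simp
      _ = _ := by
          have hms : MeasurableSet {ξ : Esp N | t ≤ 2 * K * ‖ξ‖ ^ γ} :=
            measurableSet_le measurable_const (by fun_prop)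
          rw [← lintegral_indicator hms, ← lintegral_const_mul _
            ((hg.enorm.pow_const 2).indicator hms)]
          congr 1; ext ξ
          by_cases hx : t ≤ 2 * K * ‖ξ‖ ^ γ
          · simp [Set.indicator, hx]
          · simp [Set.indicator, hx]
  have s2 : ∀ ξ : Esp N, ∫⁻ t in Set.Ioi (0 : ℝ), ({p : ℝ × Esp N | p.1 ≤ 2 * K * ‖p.2‖ ^ γ}.indicator
        (fun p => ENNReal.ofReal (4 * p.1 ^ (q - 3)) * ‖g p.2‖ₑ ^ 2) (t, ξ)) =
        ENNReal.ofReal (4 / (q - 2) * (2 * K) ^ (q - 2)) *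
        (ENNReal.ofReal (‖ξ‖ ^ (γ * (q - 2))) * ‖g ξ‖ₑ ^ 2) := by
    intro ξ
    set R := 2 * K * ‖ξ‖ ^ γ with hR
    have hR0 : 0 ≤ R := by positivity
    have e1 : ∀ t, ({p : ℝ × Esp N | p.1 ≤ 2 * K * ‖p.2‖ ^ γ}.indicator
        (fun p => ENNReal.ofReal (4 * p.1 ^ (q - 3)) * ‖g p.2‖ₑ ^ 2) (t, ξ)) =
        (Set.Iic R).indicator (fun t => ENNReal.ofReal (4 * t ^ (q - 3)) * ‖g ξ‖ₑ ^ 2) t := by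
      intro t
      by_cases hx : t ≤ R
      · have : t ≤ 2 * K * ‖ξ‖ ^ γ := hx
        simp [Set.indicator, hx, this]
      · have : ¬ t ≤ 2 * K * ‖ξ‖ ^ γ := hx
        simp [Set.indicator, hx, this]
    simp_rw [e1]
    rw [lintegral_indicator measurableSet_Iic, Measure.restrict_restrict measurableSet_Iic,
      Set.Iic_inter_Ioi, lintegral_mul_const _ (by fun_prop)]
    have hintg : IntegrableOn (fun t : ℝ => 4 * t ^ (q - 3)) (Set.Ioc 0 R) := by
      rw [← intervalIntegrable_iff_integrableOn_Ioc_of_le hR0]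
      exact (intervalIntegral.intervalIntegrable_rpow' (by linarith)).const_mul 4
    rw [← ofReal_integral_eq_lintegral_ofReal hintg (by
      filter_upwards [ae_restrict_mem measurableSet_Ioc] with t ht
      have := ht.1
      positivity), ← intervalIntegral.integral_of_le hR0, intervalIntegral.integral_const_mul,
      integral_rpow (Or.inl (by linarith)), ← mul_assoc, ← ENNReal.ofReal_mul (by
        have : 0 < q - 2 := by linarith
        positivity)]
    congr 2
    have e5 : q - 3 + 1 = q - 2 := by ring
    rw [e5, Real.zero_rpow (by linarith), hR, Real.mul_rpow (by positivity) (by positivity),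
      ← Real.rpow_mul (norm_nonneg _)]
    ring
  have hmeas : Measurable (fun p : ℝ × Esp N => ({p : ℝ × Esp N | p.1 ≤ 2 * K * ‖p.2‖ ^ γ}.indicator
        (fun p => ENNReal.ofReal (4 * p.1 ^ (q - 3)) * ‖g p.2‖ₑ ^ 2) p)) := by
    refine Measurable.indicator ?_ (measurableSet_le measurable_fst (by fun_prop))
    fun_prop
  refine (mul_le_mul_right s1 _).trans (le_of_eq ?_)
  · · rw [lintegral_lintegral_swap hmeas.aemeasurable]
      simp_rw [s2]
      rw [lintegral_const_mul _ (by fun_prop), ← mul_assoc, ← ENNReal.ofReal_mul (by linarith)]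
      congr 2; ring

end SW
end P5

section P6
open scoped FourierTransform SchwartzMap ENNReal
open LineDeriv
namespace SW
variable {N : ℕ}

lemma le_of_sq_le {x : ℝ≥0∞} {y : ℝ} (h : x ^ 2 ≤ ENNReal.ofReal (y ^ 2)) (hy : 0 ≤ y) :
    x ≤ ENNReal.ofReal y := by
  rw [ENNReal.ofReal_pow hy] at h
  exact (ENNReal.pow_le_pow_left_iff (by norm_num)).1 h

lemma T_zero_of {g : Esp N → ℂ} (hm : MemLp g 2 (volume : Measure (Esp N)))
    (h0 : ∫⁻ x, ‖g x‖ₑ ^ 2 = 0) {q : ℝ} (hq : 0 < q) : ∫⁻ x, ‖T g x‖ₑ ^ q = 0 := by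
  rw [← T_lintegral hm, lintegral_eq_zero_iff' ((T_memLp hm).1.enorm.pow_const 2)] at h0
  rw [lintegral_eq_zero_iff' ((T_memLp hm).1.enorm.pow_const q)]
  filter_upwards [h0] with x hx
  have : ‖T g x‖ₑ = 0 := by simpa using hx
  simp [this, hq]

lemma fin_sq {g : Esp N → ℂ} (hm : MemLp g 2 (volume : Measure (Esp N))) :
    ∫⁻ x, ‖g x‖ₑ ^ 2 ≠ ⊤ := by
  rw [← eLpNorm_two_sq]
  exact ENNReal.pow_ne_top hm.2.ne

lemma gn1 (N : ℕ) (hN : 1 ≤ N) : ∃ C : ℝ, 0 < C ∧ ∀ g : Esp N → ℂ, Measurable g →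
    MemLp g 2 (volume : Measure (Esp N)) →
    ∫⁻ x, ‖T g x‖ₑ ^ (2 * (4 / (N : ℝ)) + 2) ≤ ENNReal.ofReal C *
      ((∫⁻ ξ, ‖g ξ‖ₑ ^ 2) ^ (4 / (N : ℝ)) *
      ∫⁻ ξ, ENNReal.ofReal ((4 * Real.pi ^ 2 * ‖ξ‖ ^ 2) ^ 2) * ‖g ξ‖ₑ ^ 2) := by
  have hN0 : (0 : ℝ) < N := by exact_mod_cast hN
  set q : ℝ := 2 * (4 / (N : ℝ)) + 2 with hq
  have hq2 : 0 < q - 2 := by rw [hq]; ring_nf; positivity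
  have : Nonempty (Fin N) := ⟨⟨0, hN⟩⟩
  set V : ℝ := (volume (Metric.ball (0 : Esp N) 1)).toReal with hV
  have hVt : volume (Metric.ball (0 : Esp N) 1) ≠ ⊤ := measure_ball_lt_top.ne
  have hV0 : 0 < V := ENNReal.toReal_pos (Metric.measure_ball_pos _ _ one_pos).ne' hVt
  refine ⟨4 * q / (q - 2) * (4 * V) ^ (4 / (N : ℝ)), by positivity, fun g hg hm => ?_⟩
  rcases eq_or_ne (∫⁻ ξ, ‖g ξ‖ₑ ^ 2) 0 with h0 | h0
  · rw [T_zero_of hm h0 (by linarith)]; exact zero_le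
  set a : ℝ := (∫⁻ ξ, ‖g ξ‖ₑ ^ 2).toReal with ha
  have ha' : ∫⁻ ξ, ‖g ξ‖ₑ ^ 2 = ENNReal.ofReal a := (ENNReal.ofReal_toReal (fin_sq hm)).symm
  have ha0 : 0 < a := ENNReal.toReal_pos h0 (fin_sq hm)
  have hb : ∀ ρ : ℝ, 0 < ρ → ∫⁻ ξ in {ξ : Esp N | ‖ξ‖ < ρ}, ‖g ξ‖ₑ ≤
      ENNReal.ofReal (Real.sqrt (V * a) * ρ ^ ((N : ℝ) / 2)) := by
    intro ρ hρ
    apply le_of_sq_le _ (by positivity)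
    have hball : {ξ : Esp N | ‖ξ‖ < ρ} = Metric.ball 0 ρ := by ext; simp
    have h1 := lcs (volume.restrict {ξ : Esp N | ‖ξ‖ < ρ}) (f := fun ξ => ‖g ξ‖ₑ)
      (g := fun _ => 1) hg.enorm.aemeasurable aemeasurable_const
    simp only [mul_one, one_pow, lintegral_one, Measure.restrict_apply MeasurableSet.univ,
      Set.univ_inter] at h1
    refine h1.trans ?_
    rw [hball, Measure.addHaar_ball _ _ hρ.le, ← ENNReal.ofReal_toReal hVt, ← hV]
    calc _ ≤ ENNReal.ofReal a * (ENNReal.ofReal (ρ ^ Module.finrank ℝ (Esp N)) *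
            ENNReal.ofReal V) := by
          rw [← ha']; gcongr; exact Measure.restrict_le_self
      _ = _ := by
          rw [← ENNReal.ofReal_mul (by positivity), ← ENNReal.ofReal_mul (by positivity)]
          congr 1
          rw [mul_pow, Real.sq_sqrt (by positivity), ← Real.rpow_natCast (ρ ^ ((N : ℝ) / 2)),
            ← Real.rpow_mul hρ.le]
          simp; ring
  refine (level g hg hm (by positivity) (by positivity) (by linarith) hb).trans ?_
  have e1 : ∀ ξ : Esp N, ‖ξ‖ ^ ((N : ℝ) / 2 * (q - 2)) = ‖ξ‖ ^ 4 := fun ξ => by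
    rw [← Real.rpow_natCast]; congr 1; rw [hq]; field_simp; norm_num
  have e2 : (2 * Real.sqrt (V * a)) ^ (q - 2) = (4 * V) ^ (4 / (N : ℝ)) * a ^ (4 / (N : ℝ)) := by
    have : q - 2 = 2 * (4 / (N : ℝ)) := by rw [hq]; ring
    rw [this, Real.rpow_mul (by positivity), Real.rpow_two, mul_pow, Real.sq_sqrt (by positivity),
      ← Real.mul_rpow (by positivity) ha0.le]
    congr 1; ring
  simp_rw [e1]
  rw [e2, ha', ENNReal.ofReal_rpow_of_pos ha0, ← mul_assoc (4 * q / (q - 2)), ← mul_assoc,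
    ← ENNReal.ofReal_mul (by positivity)]
  gcongr with ξ
  have : 1 ≤ (4 * Real.pi ^ 2) ^ 2 := by
    have := Real.pi_gt_three; have h1 : 1 ≤ 4 * Real.pi ^ 2 := by nlinarith
    exact one_le_pow₀ h1
  calc ‖ξ‖ ^ 4 ≤ (4 * Real.pi ^ 2) ^ 2 * ‖ξ‖ ^ 4 := le_mul_of_one_le_left (by positivity) this
    _ = _ := by ring

lemma sing_int (N : ℕ) (hN : 1 ≤ N) : ∃ C : ℝ, 0 < C ∧ ∀ ρ : ℝ, 0 < ρ →
    ∫⁻ ξ in {ξ : Esp N | ‖ξ‖ < ρ}, ENNReal.ofReal (‖ξ‖ ^ (-((N : ℝ) / 2))) ≤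
      ENNReal.ofReal (C * ρ ^ ((N : ℝ) / 2)) := by
  have hN0 : (0 : ℝ) < N := by exact_mod_cast hN
  have : Nonempty (Fin N) := ⟨⟨0, hN⟩⟩
  set I : ℝ≥0∞ := ∫⁻ ξ in {ξ : Esp N | ‖ξ‖ < 1}, ENNReal.ofReal (‖ξ‖ ^ (-((N : ℝ) / 2))) with hI
  have hfin : I ≠ ⊤ := by
    have h1 : IntegrableOn (fun y : ℝ => y ^ (Module.finrank ℝ (Esp N) - 1) •
        (y ^ (-((N : ℝ) / 2)))) (Set.Ioo 0 1) := by
      have h2 : IntegrableOn (fun y : ℝ => y ^ ((N : ℝ) / 2 - 1)) (Set.Ioo 0 1) := by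
        rw [intervalIntegral.integrableOn_Ioo_rpow_iff one_pos]; linarith
      refine h2.congr_fun (fun y hy => ?_) measurableSet_Ioo
      simp only [finrank_euclideanSpace, Fintype.card_fin, smul_eq_mul]
      rw [← Real.rpow_natCast, ← Real.rpow_add hy.1]
      congr 1
      rw [Nat.cast_sub hN]; push_cast; ring
    have h3 := (integrableOn_fun_norm_addHaar (volume : Measure (Esp N))
      (f := fun y : ℝ => y ^ (-((N : ℝ) / 2))) (r := 1)).2 h1
    have hball : {ξ : Esp N | ‖ξ‖ < 1} = Metric.ball 0 1 := by ext; simp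
    rw [hI, hball]
    exact (hasFiniteIntegral_iff_ofReal (Eventually.of_forall fun x => by positivity)).1 h3.2 |>.ne
  refine ⟨I.toReal + 1, by positivity, fun ρ hρ => ?_⟩
  have hmap : Measure.map (fun x : Esp N => ρ • x) volume =
      ENNReal.ofReal |(ρ ^ Module.finrank ℝ (Esp N))⁻¹| • volume :=
    Measure.map_addHaar_smul volume hρ.ne'
  have hmeas : ∀ r : ℝ, MeasurableSet {ξ : Esp N | ‖ξ‖ < r} := fun r =>
    measurableSet_lt measurable_norm measurable_const
  set f : Esp N → ℝ≥0∞ := {ξ : Esp N | ‖ξ‖ < ρ}.indicator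
    (fun ξ => ENNReal.ofReal (‖ξ‖ ^ (-((N : ℝ) / 2)))) with hf
  have hfm : Measurable f := Measurable.indicator (by fun_prop) (hmeas ρ)
  have h4 : ∫⁻ x, f (ρ • x) = ENNReal.ofReal (ρ ^ (-((N : ℝ) / 2))) * I := by
    rw [hI, ← lintegral_indicator (hmeas 1), ← lintegral_const_mul _
      (Measurable.indicator (by fun_prop) (hmeas 1))]
    congr 1; ext x
    simp only [hf, Set.indicator, Set.mem_ofPred_eq, norm_smul, Real.norm_eq_abs, abs_of_pos hρ]
    have : ρ * ‖x‖ < ρ ↔ ‖x‖ < 1 := by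
      constructor
      · intro h; by_contra h'; nlinarith
      · intro h; nlinarith
    simp only [this]
    split_ifs
    · rw [Real.mul_rpow hρ.le (norm_nonneg _), ENNReal.ofReal_mul (by positivity)]
    · simp
  have h5 : ∫⁻ x, f (ρ • x) = ENNReal.ofReal ((ρ ^ N)⁻¹) * ∫⁻ x, f x := by
    rw [← lintegral_map hfm (by fun_prop : Measurable (fun x : Esp N => ρ • x)), hmap,
      lintegral_smul_measure]
    simp [abs_of_pos hρ]
  rw [← lintegral_indicator (hmeas ρ), ← hf]
  have h6 : ∫⁻ x, f x = ENNReal.ofReal (ρ ^ N) * (ENNReal.ofReal (ρ ^ (-((N : ℝ) / 2))) * I) := by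
    rw [← h4, h5, ← mul_assoc, ← ENNReal.ofReal_mul (by positivity), mul_inv_cancel₀ (by positivity)]
    simp
  rw [h6, ← ENNReal.ofReal_toReal hfin, ← mul_assoc, ← ENNReal.ofReal_mul (by positivity),
    ← ENNReal.ofReal_mul (by positivity)]
  apply ENNReal.ofReal_le_ofReal
  rw [← Real.rpow_natCast ρ N, ← Real.rpow_add hρ, mul_comm]
  have : (N : ℝ) + -((N : ℝ) / 2) = N / 2 := by ring
  rw [this]
  simp only [ENNReal.toReal_ofReal ENNReal.toReal_nonneg]
  gcongr
  linarith

lemma ae_norm_pos (hN : 1 ≤ N) : ∀ᵐ ξ : Esp N, 0 < ‖ξ‖ := by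
  have : Nonempty (Fin N) := ⟨⟨0, hN⟩⟩
  have h : ∀ᵐ ξ : Esp N, ξ ∉ ({0} : Set (Esp N)) := by
    rw [← measure_eq_zero_iff_ae_notMem]; exact measure_singleton _
  filter_upwards [h] with ξ hξ
  exact norm_pos_iff.2 hξ

lemma gn2 (N : ℕ) (hN : 1 ≤ N) (hN4 : N ≤ 4) : ∃ C : ℝ, 0 < C ∧ ∀ g : Esp N → ℂ, Measurable g →
    MemLp g 2 (volume : Measure (Esp N)) →
    ∫⁻ ξ, ENNReal.ofReal (4 * Real.pi ^ 2 * ‖ξ‖ ^ 2) * ‖g ξ‖ₑ ^ 2 ≠ ⊤ →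
    ∫⁻ x, ‖T g x‖ₑ ^ (2 * (4 / (N : ℝ)) + 2) ≤ ENNReal.ofReal C *
      ((∫⁻ ξ, ‖g ξ‖ₑ ^ 2) ^ (4 / (N : ℝ) - 1) *
      (∫⁻ ξ, ENNReal.ofReal (4 * Real.pi ^ 2 * ‖ξ‖ ^ 2) * ‖g ξ‖ₑ ^ 2) ^ 2) := by
  have hN0 : (0 : ℝ) < N := by exact_mod_cast hN
  have hN4' : (N : ℝ) ≤ 4 := by exact_mod_cast hN4
  set q : ℝ := 2 * (4 / (N : ℝ)) + 2 with hq
  have hq2 : 0 < q - 2 := by rw [hq]; ring_nf; positivity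
  obtain ⟨V, hV0, hV⟩ := sing_int N hN
  refine ⟨4 * q / (q - 2) * (4 * V) ^ (4 / (N : ℝ)), by positivity, fun g hg hm hG => ?_⟩
  rcases eq_or_ne (∫⁻ ξ, ‖g ξ‖ₑ ^ 2) 0 with h0 | h0
  · rw [T_zero_of hm h0 (by linarith)]; exact zero_le
  have hpi : 1 ≤ 4 * Real.pi ^ 2 := by have := Real.pi_gt_three; nlinarith
  have hG0 : ∫⁻ ξ, ENNReal.ofReal (4 * Real.pi ^ 2 * ‖ξ‖ ^ 2) * ‖g ξ‖ₑ ^ 2 ≠ 0 := by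
    intro h
    rw [lintegral_eq_zero_iff (by fun_prop)] at h
    apply h0
    rw [lintegral_eq_zero_iff (by fun_prop)]
    filter_upwards [h, ae_norm_pos hN] with ξ h1 h2
    simp only [Pi.zero_apply, mul_eq_zero, ENNReal.ofReal_eq_zero] at h1
    rcases h1 with h1 | h1
    · have : 0 < 4 * Real.pi ^ 2 * ‖ξ‖ ^ 2 := by positivity
      linarith
    · exact h1
  set a : ℝ := (∫⁻ ξ, ‖g ξ‖ₑ ^ 2).toReal with ha
  have ha' : ∫⁻ ξ, ‖g ξ‖ₑ ^ 2 = ENNReal.ofReal a := (ENNReal.ofReal_toReal (fin_sq hm)).symm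
  have ha0 : 0 < a := ENNReal.toReal_pos h0 (fin_sq hm)
  set b : ℝ := (∫⁻ ξ, ENNReal.ofReal (4 * Real.pi ^ 2 * ‖ξ‖ ^ 2) * ‖g ξ‖ₑ ^ 2).toReal with hb
  have hb' : ∫⁻ ξ, ENNReal.ofReal (4 * Real.pi ^ 2 * ‖ξ‖ ^ 2) * ‖g ξ‖ₑ ^ 2 = ENNReal.ofReal b :=
    (ENNReal.ofReal_toReal hG).symm
  have hb0 : 0 < b := ENNReal.toReal_pos hG0 hG
  set k : ℝ := a ^ (1 - (N : ℝ) / 4) * b ^ ((N : ℝ) / 4) with hk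
  have hk0 : 0 < k := by positivity
  have hkb : ∫⁻ ξ, ENNReal.ofReal (‖ξ‖ ^ ((N : ℝ) / 2)) * ‖g ξ‖ₑ ^ 2 ≤ ENNReal.ofReal k := by
    have h1 := ENNReal.lintegral_mul_norm_pow_le (μ := (volume : Measure (Esp N)))
      (f := fun ξ => ‖g ξ‖ₑ ^ 2) (g := fun ξ => ENNReal.ofReal (4 * Real.pi ^ 2 * ‖ξ‖ ^ 2) *
      ‖g ξ‖ₑ ^ 2) (by fun_prop) (by fun_prop) (p := 1 - (N : ℝ) / 4) (q := (N : ℝ) / 4)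
      (by linarith) (by positivity) (by ring)
    rw [ha', hb', ENNReal.ofReal_rpow_of_pos ha0, ENNReal.ofReal_rpow_of_pos hb0,
      ← ENNReal.ofReal_mul (by positivity)] at h1
    refine le_trans (lintegral_mono fun ξ => ?_) h1
    simp only
    rw [ENNReal.mul_rpow_of_nonneg _ _ (by positivity), mul_left_comm,
      ← ENNReal.rpow_add_of_nonneg _ _ (by linarith) (by positivity),
      ENNReal.ofReal_rpow_of_nonneg (by positivity) (by positivity)]
    have e : 1 - (N : ℝ) / 4 + N / 4 = 1 := by ring
    rw [e, ENNReal.rpow_one]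
    gcongr
    calc ‖ξ‖ ^ ((N : ℝ) / 2) = (‖ξ‖ ^ 2) ^ ((N : ℝ) / 4) := by
          rw [← Real.rpow_natCast, ← Real.rpow_mul (norm_nonneg _)]; congr 1; push_cast; ring
      _ ≤ _ := by
          apply Real.rpow_le_rpow (by positivity) _ (by positivity)
          exact le_mul_of_one_le_left (by positivity) hpi
  have hb : ∀ ρ : ℝ, 0 < ρ → ∫⁻ ξ in {ξ : Esp N | ‖ξ‖ < ρ}, ‖g ξ‖ₑ ≤
      ENNReal.ofReal (Real.sqrt (V * k) * ρ ^ ((N : ℝ) / 4)) := by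
    intro ρ hρ
    apply le_of_sq_le _ (by positivity)
    have hnp := ae_restrict_of_ae (s := {ξ : Esp N | ‖ξ‖ < ρ}) (ae_norm_pos hN)
    have h1 := lcs_weight (volume.restrict {ξ : Esp N | ‖ξ‖ < ρ}) (f := fun ξ => ‖g ξ‖ₑ)
      (W := fun ξ => ENNReal.ofReal (‖ξ‖ ^ ((N : ℝ) / 2))) hg.enorm.aemeasurable (by fun_prop)
      (by filter_upwards [hnp] with ξ h; simp; positivity) (by simp)
    refine h1.trans ?_
    have e3 : ∫⁻ ξ in {ξ : Esp N | ‖ξ‖ < ρ}, (ENNReal.ofReal (‖ξ‖ ^ ((N : ℝ) / 2)))⁻¹ =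
        ∫⁻ ξ in {ξ : Esp N | ‖ξ‖ < ρ}, ENNReal.ofReal (‖ξ‖ ^ (-((N : ℝ) / 2))) := by
      apply lintegral_congr_ae
      filter_upwards [hnp] with ξ h
      rw [← ENNReal.ofReal_inv_of_pos (by positivity), Real.rpow_neg h.le]
    rw [e3]
    calc _ ≤ ENNReal.ofReal k * ENNReal.ofReal (V * ρ ^ ((N : ℝ) / 2)) := by
          gcongr
          · exact (lintegral_mono' Measure.restrict_le_self le_rfl).trans hkb
          · exact hV ρ hρ
      _ = _ := by
          rw [← ENNReal.ofReal_mul (by positivity)]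
          congr 1
          rw [mul_pow, Real.sq_sqrt (by positivity), ← Real.rpow_natCast (ρ ^ ((N : ℝ) / 4)),
            ← Real.rpow_mul hρ.le]
          have : (N : ℝ) / 4 * ((2 : ℕ) : ℝ) = N / 2 := by push_cast; ring
          rw [this]; ring
  refine (level g hg hm (by positivity) (by positivity) (by linarith) hb).trans ?_
  have e1 : ∀ ξ : Esp N, ‖ξ‖ ^ ((N : ℝ) / 4 * (q - 2)) = ‖ξ‖ ^ 2 := fun ξ => by
    rw [← Real.rpow_natCast]; congr 1; rw [hq]; field_simp; norm_num
  have e2 : (2 * Real.sqrt (V * k)) ^ (q - 2) = (4 * V) ^ (4 / (N : ℝ)) *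
      (a ^ (4 / (N : ℝ) - 1) * b) := by
    have : q - 2 = 2 * (4 / (N : ℝ)) := by rw [hq]; ring
    rw [this, Real.rpow_mul (by positivity), Real.rpow_two, mul_pow, Real.sq_sqrt (by positivity)]
    have e4 : (2 : ℝ) ^ 2 * (V * k) = 4 * V * k := by ring
    rw [e4, Real.mul_rpow (by positivity) hk0.le, hk, Real.mul_rpow (x := a ^ _) (by positivity) (by positivity),
      ← Real.rpow_mul ha0.le, ← Real.rpow_mul hb0.le]
    have e5 : (1 - (N : ℝ) / 4) * (4 / N) = 4 / N - 1 := by field_simp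
    have e6 : (N : ℝ) / 4 * (4 / N) = 1 := by field_simp
    rw [e5, e6, Real.rpow_one]
  simp_rw [e1]
  rw [e2, ha', ENNReal.ofReal_rpow_of_pos ha0, hb', ← ENNReal.ofReal_pow hb0.le,
    ← ENNReal.ofReal_mul (by positivity), ← ENNReal.ofReal_mul (by positivity)]
  calc _ ≤ ENNReal.ofReal (4 * q / (q - 2) * ((4 * V) ^ (4 / (N : ℝ)) *
      (a ^ (4 / (N : ℝ) - 1) * b))) * ENNReal.ofReal b := by
        rw [← hb']
        gcongr with ξ
        exact le_mul_of_one_le_left (by positivity) hpi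
    _ = _ := by
        rw [← ENNReal.ofReal_mul (by positivity)]
        congr 1; ring

end SW
end P6

section P7
open scoped FourierTransform SchwartzMap ENNReal
open LineDeriv
namespace SW
variable {N : ℕ}

/-- `∫|g|²` -/
def A2 (g : Esp N → ℂ) : ℝ≥0∞ := ∫⁻ ξ, ‖g ξ‖ₑ ^ 2
/-- `∫w²|g|²` -/
def B2 (g : Esp N → ℂ) : ℝ≥0∞ := ∫⁻ ξ, ENNReal.ofReal (wt ξ ^ 2) * ‖g ξ‖ₑ ^ 2

/-- The inequality holds for functions with frequency support in `S`. -/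
def Good (σ : ℝ) (S : Set (Esp N)) : Prop :=
  ∃ C : ℝ, 0 < C ∧ ∀ g : Esp N → ℂ, Measurable g → MemLp g 2 (volume : Measure (Esp N)) →
    (∀ ξ, ξ ∉ S → g ξ = 0) →
    ∫⁻ x, ‖T g x‖ₑ ^ (2 * σ + 2) ≤ ENNReal.ofReal C * (A2 g ^ σ * B2 g)

lemma Good.mono {σ : ℝ} {S S' : Set (Esp N)} (h : Good σ S') (hS : S ⊆ S') : Good σ S := by
  obtain ⟨C, hC, h⟩ := h
  exact ⟨C, hC, fun g h1 h2 h3 => h g h1 h2 fun ξ hξ => h3 ξ fun hh => hξ (hS hh)⟩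

lemma A2_ind (g : Esp N → ℂ) (s : Set (Esp N)) : A2 (s.indicator g) ≤ A2 g := by
  refine lintegral_mono fun ξ => ?_
  by_cases h : ξ ∈ s <;> simp [h]

lemma B2_ind (g : Esp N → ℂ) (s : Set (Esp N)) : B2 (s.indicator g) ≤ B2 g := by
  refine lintegral_mono fun ξ => ?_
  by_cases h : ξ ∈ s <;> simp [h]

lemma Good.union {σ : ℝ} (hσ : 0 < σ) {S S' : Set (Esp N)} (hS : MeasurableSet S) (h : Good σ S)
    (h' : Good σ S') : Good σ (S ∪ S') := by
  obtain ⟨C, hC, h⟩ := h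
  obtain ⟨C', hC', h'⟩ := h'
  refine ⟨2 ^ (2 * σ + 1) * (C + C'), by positivity, fun g hg hm hs => ?_⟩
  have h1 := h (S.indicator g) (hg.indicator hS) (hm.indicator hS) (fun ξ hξ => by simp [hξ])
  have h2 := h' (Sᶜ.indicator g) (hg.indicator hS.compl) (hm.indicator hS.compl) (fun ξ hξ => by
    by_cases hx : ξ ∈ S
    · simp [hx]
    · simp [hx, hs ξ (by simp [hx, hξ])])
  have e : ∫⁻ x, ‖T g x‖ₑ ^ (2 * σ + 2) ≤ ∫⁻ x, 2 ^ (2 * σ + 1) *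
      (‖T (S.indicator g) x‖ₑ ^ (2 * σ + 2) + ‖T (Sᶜ.indicator g) x‖ₑ ^ (2 * σ + 2)) := by
    apply lintegral_mono_ae
    filter_upwards [T_split hm hS] with x hx
    rw [hx]
    calc _ ≤ (‖T (S.indicator g) x‖ₑ + ‖T (Sᶜ.indicator g) x‖ₑ) ^ (2 * σ + 2) := by
          gcongr; exact enorm_add_le _ _
      _ ≤ _ := by
          refine (ENNReal.rpow_add_le_mul_rpow_add_rpow _ _ (by linarith)).trans (le_of_eq ?_)
          congr 2; ring
  refine e.trans ?_
  rw [lintegral_const_mul' _ _ (by simp), lintegral_add_left'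
    ((T_memLp (hm.indicator hS)).1.enorm.pow_const _),
    ENNReal.ofReal_mul (by positivity), ENNReal.ofReal_add hC.le hC'.le,
    ← ENNReal.ofReal_rpow_of_pos (by norm_num), mul_assoc, add_mul]
  simp only [ENNReal.ofReal_ofNat]
  gcongr
  · refine h1.trans ?_
    gcongr
    · exact A2_ind g S
    · exact B2_ind g S
  · refine h2.trans ?_
    gcongr
    · exact A2_ind g _
    · exact B2_ind g _

lemma interp {u : Esp N → ℂ} (hu : AEStronglyMeasurable u (volume : Measure (Esp N)))
    {p q r θ : ℝ} (hp : 0 ≤ p) (hq : 0 ≤ q) (h0 : 0 ≤ θ) (h1 : θ ≤ 1)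
    (hr : r = p * (1 - θ) + q * θ) :
    ∫⁻ x, ‖u x‖ₑ ^ r ≤ (∫⁻ x, ‖u x‖ₑ ^ p) ^ (1 - θ) * (∫⁻ x, ‖u x‖ₑ ^ q) ^ θ := by
  have := ENNReal.lintegral_mul_norm_pow_le (μ := (volume : Measure (Esp N)))
    (f := fun x => ‖u x‖ₑ ^ p) (g := fun x => ‖u x‖ₑ ^ q) (hu.enorm.pow_const _)
    (hu.enorm.pow_const _) (p := 1 - θ) (q := θ) (by linarith) h0 (by ring)
  refine le_trans (le_of_eq ?_) this
  congr 1; ext x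
  rw [← ENNReal.rpow_mul, ← ENNReal.rpow_mul, ← ENNReal.rpow_add_of_nonneg _ _
    (mul_nonneg hp (by linarith)) (mul_nonneg hq h0), hr]

lemma A2_T {g : Esp N → ℂ} (hm : MemLp g 2 (volume : Measure (Esp N))) :
    ∫⁻ x, ‖T g x‖ₑ ^ (2 : ℝ) = A2 g := by
  unfold A2
  rw [← T_lintegral hm]; simp

lemma good_far (hN : 1 ≤ N) {σ : ℝ} (hσ : 0 < σ) (hσN : σ ≤ 4 / (N : ℝ)) :
    Good σ {ξ : Esp N | 1 / 2 ≤ |wt ξ|} := by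
  have hN0 : (0 : ℝ) < N := by exact_mod_cast hN
  obtain ⟨C, hC, h⟩ := gn1 N hN
  set θ : ℝ := σ * N / 4 with hθ
  have hθ0 : 0 ≤ θ := by positivity
  have hθ1 : θ ≤ 1 := by rw [le_div_iff₀ hN0] at hσN; rw [hθ]; linarith
  refine ⟨C ^ θ * 9, by positivity, fun g hg hm hs => ?_⟩
  have h1 := interp (T_memLp hm).1 (p := 2) (q := 2 * (4 / (N : ℝ)) + 2) (r := 2 * σ + 2)
    (by norm_num) (by positivity) hθ0 hθ1 (by rw [hθ]; field_simp; ring)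
  rw [A2_T hm] at h1
  have hA : A2 g ≤ ENNReal.ofReal 9 * B2 g := by
    unfold A2 B2
    rw [← lintegral_const_mul' _ _ (by simp)]
    refine lintegral_mono fun ξ => ?_
    by_cases hx : 1 / 2 ≤ |wt ξ|
    · simp only
      rw [← mul_assoc, ← ENNReal.ofReal_mul (by norm_num)]
      refine le_mul_of_one_le_left zero_le ?_
      rw [ENNReal.one_le_ofReal, ← sq_abs (wt ξ)]; nlinarith
    · simp [hs ξ hx]
  have hL : ∫⁻ ξ, ENNReal.ofReal ((4 * Real.pi ^ 2 * ‖ξ‖ ^ 2) ^ 2) * ‖g ξ‖ₑ ^ 2 ≤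
      ENNReal.ofReal 9 * B2 g := by
    unfold B2
    rw [← lintegral_const_mul' _ _ (by simp)]
    refine lintegral_mono fun ξ => ?_
    by_cases hx : 1 / 2 ≤ |wt ξ|
    · simp only
      rw [← mul_assoc, ← ENNReal.ofReal_mul (by norm_num)]
      gcongr
      have e : 4 * Real.pi ^ 2 * ‖ξ‖ ^ 2 = wt ξ + 1 := by unfold wt; ring
      rw [e]
      have h3 : 0 ≤ wt ξ + 1 := by rw [← e]; positivity
      have : |wt ξ + 1| ≤ 3 * |wt ξ| := (abs_add_le _ _).trans (by simp; linarith)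
      calc (wt ξ + 1) ^ 2 ≤ (3 * |wt ξ|) ^ 2 := by
            rw [abs_of_nonneg h3] at this
            exact pow_le_pow_left₀ h3 this 2
        _ = 9 * wt ξ ^ 2 := by rw [mul_pow, sq_abs]; norm_num
    · simp [hs ξ hx]
  refine h1.trans ?_
  calc _ ≤ A2 g ^ (1 - θ) * (ENNReal.ofReal C * (A2 g ^ (4 / (N : ℝ)) *
        (ENNReal.ofReal 9 * B2 g))) ^ θ := by
        gcongr
        refine (h g hg hm).trans ?_
        gcongr; exact le_of_eq rfl
    _ = ENNReal.ofReal (C ^ θ) * (A2 g ^ (1 - θ) * (A2 g ^ σ * (ENNReal.ofReal 9 * B2 g) ^ θ)) := by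
        rw [ENNReal.mul_rpow_of_nonneg _ _ hθ0, ENNReal.mul_rpow_of_nonneg _ _ hθ0,
          ← ENNReal.rpow_mul, ENNReal.ofReal_rpow_of_pos hC]
        have : 4 / (N : ℝ) * θ = σ := by rw [hθ]; field_simp
        rw [this]; ring
    _ ≤ ENNReal.ofReal (C ^ θ) * ((ENNReal.ofReal 9 * B2 g) ^ (1 - θ) *
        (A2 g ^ σ * (ENNReal.ofReal 9 * B2 g) ^ θ)) := by
        gcongr
    _ = ENNReal.ofReal (C ^ θ) * (A2 g ^ σ * (ENNReal.ofReal 9 * B2 g) ^ (1 - θ + θ)) := by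
        rw [ENNReal.rpow_add_of_nonneg _ _ (by linarith) hθ0]; ring
    _ = _ := by
        rw [sub_add_cancel, ENNReal.rpow_one, ENNReal.ofReal_mul (by positivity)]; ring

lemma sup_A2 {g : Esp N → ℂ} {S : Set (Esp N)} (hS : MeasurableSet S) (hg : Measurable g)
    (hs : ∀ ξ, ξ ∉ S → g ξ = 0) : (∫⁻ y, ‖g y‖ₑ) ^ 2 ≤ volume S * A2 g := by
  have e : ∫⁻ y, ‖g y‖ₑ = ∫⁻ y, ‖g y‖ₑ * S.indicator 1 y := by
    congr 1; ext y
    by_cases h : y ∈ S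
    · simp [h]
    · simp [h, hs y h]
  rw [e]
  refine (lcs volume hg.enorm.aemeasurable (measurable_one.indicator hS).aemeasurable).trans ?_
  rw [mul_comm]
  have : ∫⁻ y, S.indicator (1 : Esp N → ℝ≥0∞) y ^ 2 = volume S := by
    rw [← lintegral_indicator_one hS]
    congr 1; ext y
    by_cases h : y ∈ S <;> simp [h]
  rw [this]; rfl

lemma Good.up {σ σ' : ℝ} {S : Set (Esp N)} (hS : MeasurableSet S) (hSf : volume S ≠ ⊤)
    (hσ : 0 < σ) (h : Good σ S) (hσ' : σ ≤ σ') : Good σ' S := by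
  obtain ⟨C, hC, h⟩ := h
  refine ⟨((volume S).toReal + 1) ^ (σ' - σ) * C, by positivity, fun g hg hm hs => ?_⟩
  have hsup : ∀ᵐ x, ‖T g x‖ₑ ^ (2 : ℝ) ≤ ENNReal.ofReal ((volume S).toReal + 1) * A2 g := by
    filter_upwards [T_sup hm] with x hx
    calc _ ≤ (∫⁻ y, ‖g y‖ₑ) ^ 2 := by rw [ENNReal.rpow_two]; gcongr
      _ ≤ _ := sup_A2 hS hg hs
      _ ≤ _ := by
        gcongr
        rw [← ENNReal.ofReal_toReal hSf]
        apply ENNReal.ofReal_le_ofReal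
        simp
  calc _ ≤ ∫⁻ x, (ENNReal.ofReal ((volume S).toReal + 1) * A2 g) ^ (σ' - σ) *
        ‖T g x‖ₑ ^ (2 * σ + 2) := by
        apply lintegral_mono_ae
        filter_upwards [hsup] with x hx
        have : 2 * σ' + 2 = 2 * (σ' - σ) + (2 * σ + 2) := by ring
        rw [this, ENNReal.rpow_add_of_nonneg _ _ (by linarith) (by linarith), ENNReal.rpow_mul]
        gcongr
    _ = (ENNReal.ofReal ((volume S).toReal + 1) * A2 g) ^ (σ' - σ) *
        ∫⁻ x, ‖T g x‖ₑ ^ (2 * σ + 2) := by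
        rw [lintegral_const_mul'']
        exact (T_memLp hm).1.enorm.pow_const _
    _ ≤ (ENNReal.ofReal ((volume S).toReal + 1) * A2 g) ^ (σ' - σ) *
        (ENNReal.ofReal C * (A2 g ^ σ * B2 g)) := by gcongr; exact h g hg hm hs
    _ = _ := by
        have : σ' = (σ' - σ) + σ := by ring
        conv_rhs => rw [this, ENNReal.rpow_add_of_nonneg _ _ (by linarith) hσ.le]
        rw [add_sub_cancel_right, ENNReal.mul_rpow_of_nonneg _ _ (by linarith),
          ENNReal.ofReal_mul (by positivity), ENNReal.ofReal_rpow_of_pos (by positivity)]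
        ring

lemma wt_cont : Continuous (wt : Esp N → ℝ) := by unfold wt; fun_prop

/-- globalisation -/
lemma good_univ (hN : 1 ≤ N) {σ₀ σ : ℝ} (hσ₀ : 0 < σ₀) (hσ : σ₀ ≤ σ) (hσN : σ ≤ 4 / (N : ℝ))
    (hloc : ∀ ξ₀ : Esp N, ξ₀ ≠ 0 → ∃ r : ℝ, 0 < r ∧ Good σ₀ (Metric.ball ξ₀ r)) :
    Good σ (Set.univ : Set (Esp N)) := by
  have hσ0 : 0 < σ := by linarith
  set K : Set (Esp N) := {ξ | |wt ξ| ≤ 1 / 2} with hK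
  have hKc : IsCompact K := by
    apply Metric.isCompact_of_isClosed_isBounded
    · exact isClosed_le (wt_cont.abs) continuous_const
    · refine (Metric.isBounded_ball (x := (0 : Esp N)) (r := 1)).subset fun ξ hξ => ?_
      have h1 : |wt ξ| ≤ 1 / 2 := hξ
      have h2 := (abs_le.1 h1).2
      rw [mem_ball_zero_iff]
      by_contra h3
      push Not at h3
      unfold wt at h2
      have := Real.pi_gt_three
      nlinarith [mul_le_mul (one_le_pow₀ (n := 2) h3) (show (9 : ℝ) ≤ Real.pi ^ 2 by nlinarith)
        (by norm_num) (by positivity)]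
  have hgK : ∃ S, MeasurableSet S ∧ K ⊆ S ∧ Good σ S := by
    refine hKc.induction_on (p := fun s => ∃ S, MeasurableSet S ∧ s ⊆ S ∧ Good σ S) ?_ ?_ ?_ ?_
    · refine ⟨∅, MeasurableSet.empty, le_rfl, 1, one_pos, fun g hg hm hs => ?_⟩
      rw [T_zero_of hm (by simp [hs]) (by linarith)]; exact zero_le
    · rintro s t hst ⟨S, h1, h2, h3⟩
      exact ⟨S, h1, hst.trans h2, h3⟩
    · rintro s t ⟨S, h1, h2, h3⟩ ⟨S', h1', h2', h3'⟩
      exact ⟨S ∪ S', h1.union h1', Set.union_subset_union h2 h2', h3.union hσ0 h1 h3'⟩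
    · intro ξ₀ hξ₀
      have hne : ξ₀ ≠ 0 := by
        rintro rfl
        have h1 : |wt (0 : Esp N)| ≤ 1 / 2 := hξ₀
        unfold wt at h1
        norm_num at h1
      obtain ⟨r, hr, hg⟩ := hloc ξ₀ hne
      exact ⟨_, mem_nhdsWithin_of_mem_nhds (Metric.ball_mem_nhds ξ₀ hr), _,
        Metric.isOpen_ball.measurableSet, le_rfl,
        hg.up Metric.isOpen_ball.measurableSet measure_ball_lt_top.ne hσ₀ hσ⟩
  obtain ⟨S, h1, h2, h3⟩ := hgK
  refine (h3.union hσ0 h1 (good_far hN hσ0 hσN)).mono fun ξ _ => ?_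
  by_cases h : |wt ξ| ≤ 1 / 2
  · exact Or.inl (h2 h)
  · exact Or.inr (by push Not at h; exact h.le)

end SW
end P7

section P8
open scoped FourierTransform SchwartzMap ENNReal Convolution
open LineDeriv
namespace SW
variable {N : ℕ}

/-- convolution of complex functions -/
def cv (f g : Esp N → ℂ) : Esp N → ℂ := f ⋆[ContinuousLinearMap.mul ℂ ℂ] g

lemma cv_int {f g : Esp N → ℂ} (hf : Integrable f (volume : Measure (Esp N)))
    (hg : Integrable g (volume : Measure (Esp N))) : Integrable (cv f g) (volume : Measure (Esp N)) :=
  hf.integrable_convolution (ContinuousLinearMap.mul ℂ ℂ) hg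

lemma cv_le (f g : Esp N → ℂ) (ξ : Esp N) :
    ‖cv f g ξ‖ₑ ≤ ∫⁻ t, ‖f t‖ₑ * ‖g (ξ - t)‖ₑ := by
  refine (enorm_integral_le_lintegral_enorm _).trans (le_of_eq ?_)
  congr 1; ext t; simp

lemma memLp_two_of_bdd {f : Esp N → ℂ} (hf : Integrable f (volume : Measure (Esp N))) {K : ℝ≥0∞}
    (hK : K ≠ ⊤) (hb : ∀ x, ‖f x‖ₑ ≤ K) : MemLp f 2 (volume : Measure (Esp N)) := by
  refine ⟨hf.1, ?_⟩
  rw [eLpNorm_lt_top_iff_lintegral_rpow_enorm_lt_top (by norm_num) (by norm_num)]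
  refine lt_of_le_of_lt (b := ∫⁻ x, K * ‖f x‖ₑ) (lintegral_mono fun x => ?_) ?_
  · simp only [ENNReal.toReal_ofNat, ENNReal.rpow_two, sq]
    exact mul_le_mul_left (hb x) _
  · rw [lintegral_const_mul' _ _ hK]
    exact ENNReal.mul_lt_top hK.lt_top hf.2

lemma T_cv {f g : Esp N → ℂ} (hf : Integrable f (volume : Measure (Esp N)))
    (hg : Integrable g (volume : Measure (Esp N))) (hf2 : MemLp f 2 (volume : Measure (Esp N)))
    (hg2 : MemLp g 2 (volume : Measure (Esp N))) (h2 : MemLp (cv f g) 2 (volume : Measure (Esp N))) :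
    T (cv f g) =ᵐ[volume] fun x => T f x * T g x := by
  filter_upwards [T_eq_integral (cv_int hf hg) h2, T_eq_integral hf hf2, T_eq_integral hg hg2]
    with x h1 h2 h3
  rw [h1, h2, h3]
  simp only [Real.fourierInv_eq_fourier_neg]
  exact Real.fourier_mul_convolution_eq hf hg _

lemma cv_bdd_cs {f g : Esp N → ℂ} (hf : Measurable f) (hg : Measurable g) (ξ : Esp N) :
    ‖cv f g ξ‖ₑ ^ 2 ≤ A2 f * A2 g := by
  refine (pow_le_pow_left₀ zero_le (cv_le f g ξ) 2).trans ?_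
  refine (lcs volume (by fun_prop) (by fun_prop)).trans (le_of_eq ?_)
  unfold A2
  rw [lintegral_sub_left_eq_self (fun t => ‖g t‖ₑ ^ 2) ξ]

lemma A2_ne_top {g : Esp N → ℂ} (hm : MemLp g 2 (volume : Measure (Esp N))) : A2 g ≠ ⊤ := by
  unfold A2
  rw [← eLpNorm_two_sq]
  exact ENNReal.pow_ne_top hm.2.ne

lemma cv_mem2 {g : Esp N → ℂ} (hg : Measurable g) (hi : Integrable g (volume : Measure (Esp N)))
    (hm : MemLp g 2 (volume : Measure (Esp N))) : MemLp (cv g g) 2 (volume : Measure (Esp N)) := by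
  refine memLp_two_of_bdd (cv_int hi hi) (K := A2 g) (A2_ne_top hm) fun ξ => ?_
  have := cv_bdd_cs hg hg ξ
  rw [← sq] at this
  exact (ENNReal.pow_le_pow_left_iff two_ne_zero).1 this

lemma cv_mem3 {g : Esp N → ℂ} (hg : Measurable g) (hi : Integrable g (volume : Measure (Esp N)))
    (hm : MemLp g 2 (volume : Measure (Esp N))) : MemLp (cv (cv g g) g) 2 (volume : Measure (Esp N)) := by
  refine memLp_two_of_bdd (cv_int (cv_int hi hi) hi) (K := A2 g * ∫⁻ t, ‖g t‖ₑ)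
    (ENNReal.mul_ne_top (A2_ne_top hm) hi.2.ne) fun ξ => ?_
  refine (cv_le _ _ _).trans ?_
  rw [← lintegral_sub_left_eq_self (fun t => ‖g t‖ₑ) ξ, ← lintegral_const_mul' _ _ (A2_ne_top hm)]
  refine lintegral_mono fun t => mul_le_mul_left ?_ _
  have := cv_bdd_cs hg hg t
  rw [← sq] at this
  exact (ENNReal.pow_le_pow_left_iff two_ne_zero).1 this

lemma conv4 {g : Esp N → ℂ} (hg : Measurable g) (hi : Integrable g (volume : Measure (Esp N)))
    (hm : MemLp g 2 (volume : Measure (Esp N))) {a b : Esp N → ℝ≥0∞} (ha : Measurable a)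
    (hb : Measurable b) (hab : ∀ η, ‖g η‖ₑ = a η * b η) {K : ℝ≥0∞}
    (hK : ∀ ξ, ∫⁻ t, b t ^ 2 * b (ξ - t) ^ 2 ≤ K) :
    ∫⁻ x, ‖T g x‖ₑ ^ 4 ≤ (∫⁻ x, a x ^ 2) ^ 2 * K := by
  have h2 := cv_mem2 hg hi hm
  have e1 : ∫⁻ x, ‖T g x‖ₑ ^ 4 = A2 (cv g g) := by
    unfold A2
    rw [← T_lintegral h2]
    apply lintegral_congr_ae
    filter_upwards [T_cv hi hi hm hm h2] with x hx
    rw [hx, enorm_mul]; ring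
  rw [e1]
  calc A2 (cv g g) ≤ ∫⁻ ξ, (∫⁻ t, a t ^ 2 * a (ξ - t) ^ 2) * K := by
        refine lintegral_mono fun ξ => ?_
        refine (pow_le_pow_left₀ zero_le (cv_le g g ξ) 2).trans ?_
        have : ∀ t, ‖g t‖ₑ * ‖g (ξ - t)‖ₑ = (a t * a (ξ - t)) * (b t * b (ξ - t)) := by
          intro t; rw [hab, hab]; ring
        simp only [this]
        refine (lcs volume (by fun_prop) (by fun_prop)).trans ?_
        simp only [mul_pow]
        exact mul_le_mul_right (hK ξ) _
    _ = (∫⁻ ξ, ∫⁻ t, a t ^ 2 * a (ξ - t) ^ 2) * K := by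
        rw [lintegral_mul_const]
        exact Measurable.lintegral_prod_right' (f := fun p : Esp N × Esp N => a p.2 ^ 2 * a (p.1 - p.2) ^ 2)
          (by fun_prop)
    _ = _ := by
        congr 1
        rw [lintegral_lintegral_swap (by fun_prop), sq, ← lintegral_mul_const _ (by fun_prop)]
        congr 1; ext t
        rw [lintegral_const_mul _ (by fun_prop), lintegral_sub_right_eq_self (fun ξ => a ξ ^ 2) t]

lemma conv6 {g : Esp N → ℂ} (hg : Measurable g) (hi : Integrable g (volume : Measure (Esp N)))
    (hm : MemLp g 2 (volume : Measure (Esp N))) {a b : Esp N → ℝ≥0∞} (ha : Measurable a)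
    (hb : Measurable b) (hab : ∀ η, ‖g η‖ₑ = a η * b η) {K : ℝ≥0∞}
    (hK : ∀ ξ, ∫⁻ t, ∫⁻ s, b s ^ 2 * b t ^ 2 * b (ξ - s - t) ^ 2 ≤ K) :
    ∫⁻ x, ‖T g x‖ₑ ^ 6 ≤ (∫⁻ x, a x ^ 2) ^ 3 * K := by
  have h2 := cv_mem2 hg hi hm
  have h3 := cv_mem3 hg hi hm
  have e1 : ∫⁻ x, ‖T g x‖ₑ ^ 6 = A2 (cv (cv g g) g) := by
    unfold A2
    rw [← T_lintegral h3]
    apply lintegral_congr_ae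
    filter_upwards [T_cv hi hi hm hm h2, T_cv (cv_int hi hi) hi h2 hm h3] with x hx hx'
    rw [hx', hx, enorm_mul, enorm_mul]; ring
  rw [e1]
  calc A2 (cv (cv g g) g)
      ≤ ∫⁻ ξ, (∫⁻ p : Esp N × Esp N, a p.2 ^ 2 * a p.1 ^ 2 * a (ξ - p.2 - p.1) ^ 2) * K := by
        refine lintegral_mono fun ξ => ?_
        have s1 : ‖cv (cv g g) g ξ‖ₑ ≤
            ∫⁻ p : Esp N × Esp N, (a p.2 * a p.1 * a (ξ - p.2 - p.1)) *
              (b p.2 * b p.1 * b (ξ - p.2 - p.1)) := by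
          rw [Measure.volume_eq_prod, lintegral_prod _ (by fun_prop)]
          calc _ ≤ ∫⁻ t, (∫⁻ s, ‖g s‖ₑ * ‖g (t - s)‖ₑ) * ‖g (ξ - t)‖ₑ :=
                (cv_le _ _ _).trans (lintegral_mono fun t => mul_le_mul_left (cv_le _ _ _) _)
            _ = ∫⁻ t, ∫⁻ s, ‖g s‖ₑ * ‖g (t - s)‖ₑ * ‖g (ξ - t)‖ₑ := by
                congr 1; ext t; rw [lintegral_mul_const _ (by fun_prop)]
            _ = ∫⁻ s, ∫⁻ t, ‖g s‖ₑ * ‖g (t - s)‖ₑ * ‖g (ξ - t)‖ₑ := by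
                rw [lintegral_lintegral_swap (by fun_prop)]
            _ = ∫⁻ s, ∫⁻ t, ‖g s‖ₑ * ‖g t‖ₑ * ‖g (ξ - s - t)‖ₑ := by
                congr 1; ext s
                rw [← lintegral_add_right_eq_self _ s]
                congr 1; ext t
                rw [add_sub_cancel_right, show ξ - (t + s) = ξ - s - t by abel]
            _ = ∫⁻ t, ∫⁻ s, ‖g s‖ₑ * ‖g t‖ₑ * ‖g (ξ - s - t)‖ₑ := by
                rw [lintegral_lintegral_swap (by fun_prop)]
            _ = _ := by
                congr 1; ext t; congr 1; ext s; rw [hab, hab, hab]; ring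
        refine (pow_le_pow_left₀ zero_le s1 2).trans ?_
        refine (lcs volume (by fun_prop) (by fun_prop)).trans ?_
        simp only [mul_pow]
        refine mul_le_mul_right (le_trans (le_of_eq ?_) (hK ξ)) _
        rw [Measure.volume_eq_prod, lintegral_prod _ (by fun_prop)]
    _ = (∫⁻ ξ, ∫⁻ p : Esp N × Esp N, a p.2 ^ 2 * a p.1 ^ 2 * a (ξ - p.2 - p.1) ^ 2) * K := by
        rw [lintegral_mul_const]
        exact Measurable.lintegral_prod_right'
          (f := fun p : Esp N × (Esp N × Esp N) =>
            a p.2.2 ^ 2 * a p.2.1 ^ 2 * a (p.1 - p.2.2 - p.2.1) ^ 2) (by fun_prop)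
    _ = _ := by
        congr 1
        rw [lintegral_lintegral_swap (by fun_prop)]
        have : ∀ p : Esp N × Esp N, ∫⁻ ξ, a p.2 ^ 2 * a p.1 ^ 2 * a (ξ - p.2 - p.1) ^ 2 =
            a p.2 ^ 2 * a p.1 ^ 2 * ∫⁻ ξ, a ξ ^ 2 := by
          intro p
          rw [lintegral_const_mul _ (by fun_prop)]
          simp only [sub_sub]
          rw [lintegral_sub_right_eq_self (fun ξ => a ξ ^ 2)]
        simp only [this]
        rw [lintegral_mul_const _ (by fun_prop), Measure.volume_eq_prod, lintegral_prod _ (by fun_prop)]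
        simp only
        have : ∀ x : Esp N, ∫⁻ y, a y ^ 2 * a x ^ 2 = (∫⁻ y, a y ^ 2) * a x ^ 2 := fun x =>
          lintegral_mul_const _ (by fun_prop)
        simp only [this]
        rw [lintegral_const_mul _ (by fun_prop)]; ring
end SW
end P8

section P9
open scoped FourierTransform SchwartzMap ENNReal
open LineDeriv
namespace SW
variable {N : ℕ}

/-- Poisson kernel -/
def Pk (l x : ℝ) : ℝ≥0∞ := ENNReal.ofReal (l / (l ^ 2 + x ^ 2))

@[fun_prop]
lemma Pk_meas (l : ℝ) : Measurable (Pk l) := by unfold Pk; fun_prop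

lemma Pk_int {l : ℝ} (hl : 0 < l) {a : ℝ} (ha : a ≠ 0) (b : ℝ) :
    ∫⁻ x, Pk l (a * x + b) = ENNReal.ofReal (Real.pi / |a|) := by
  have hc : ∀ x : ℝ, l / (l ^ 2 + (a * x + b) ^ 2) = l⁻¹ * (1 + ((a * x + b) / l) ^ 2)⁻¹ := by
    intro x; field_simp
  have e2 : ∀ x : ℝ, (a * x + b) / l = (a / l) * (x + b / a) := by intro x; field_simp
  have hal : a / l ≠ 0 := div_ne_zero ha hl.ne'
  have i1 : Integrable (fun x : ℝ => (1 + ((a / l) * x) ^ 2)⁻¹) :=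
    integrable_inv_one_add_sq.comp_mul_left' hal
  have i2 : Integrable (fun x : ℝ => l⁻¹ * (1 + ((a / l) * (x + b / a)) ^ 2)⁻¹) :=
    (i1.comp_add_right (b / a)).const_mul _
  unfold Pk
  simp only [hc, e2]
  rw [← ofReal_integral_eq_lintegral_ofReal i2 (Eventually.of_forall fun x => by positivity),
    integral_const_mul, integral_add_right_eq_self (fun x : ℝ => (1 + ((a / l) * x) ^ 2)⁻¹),
    Measure.integral_comp_mul_left (fun x : ℝ => (1 + x ^ 2)⁻¹), integral_univ_inv_one_add_sq]
  congr 1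
  rw [inv_div, abs_div, abs_of_pos hl, smul_eq_mul]
  field_simp

lemma sub1 {f f' : ℝ → ℝ} {s : Set ℝ} (hs : MeasurableSet s)
    (hf : ∀ x ∈ s, HasDerivWithinAt f (f' x) s x) (hm : MonotoneOn f s) (u : ℝ → ℝ≥0∞) :
    ∫⁻ x in s, ENNReal.ofReal (f' x) * u (f x) ≤ ∫⁻ x, u x := by
  rw [← lintegral_image_eq_lintegral_deriv_mul_of_monotoneOn hs hf hm]
  exact setLIntegral_le_lintegral _ _

/-- the optimisation of the parameter -/
lemma opt {X A B K : ℝ≥0∞} (hA : A ≠ ⊤) (hB : B ≠ ⊤) (hK : K ≠ ⊤) {k : ℕ}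
    (h : ∀ l : ℝ, 0 < l → X ≤ K * (ENNReal.ofReal l * A + ENNReal.ofReal l⁻¹ * B) ^ k) :
    X ≤ K * 2 ^ k * (A * B) ^ ((k : ℝ) / 2) := by
  set a := A.toReal with ha
  set b := B.toReal with hb
  have hA' : A = ENNReal.ofReal a := (ENNReal.ofReal_toReal hA).symm
  have hB' : B = ENNReal.ofReal b := (ENNReal.ofReal_toReal hB).symm
  have ha0 : 0 ≤ a := ENNReal.toReal_nonneg
  have hb0 : 0 ≤ b := ENNReal.toReal_nonneg
  have key : ∀ ε : ℝ, 0 < ε → X ≤ K * 2 ^ k * (ENNReal.ofReal ((a + ε) * (b + ε))) ^ ((k : ℝ) / 2) := by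
    intro ε hε
    have p1 : 0 < a + ε := by positivity
    have p2 : 0 < b + ε := by positivity
    set s := Real.sqrt (a + ε) with hs
    set t := Real.sqrt (b + ε) with ht
    have s0 : 0 < s := Real.sqrt_pos.2 p1
    have t0 : 0 < t := Real.sqrt_pos.2 p2
    have s2 : s ^ 2 = a + ε := Real.sq_sqrt p1.le
    have t2 : t ^ 2 = b + ε := Real.sq_sqrt p2.le
    refine (h (t / s) (by positivity)).trans ?_
    have e : ENNReal.ofReal (t / s) * A + ENNReal.ofReal (t / s)⁻¹ * B ≤ ENNReal.ofReal (2 * (s * t)) := by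
      rw [hA', hB', ← ENNReal.ofReal_mul (by positivity), ← ENNReal.ofReal_mul (by positivity),
        ← ENNReal.ofReal_add (by positivity) (by positivity)]
      apply ENNReal.ofReal_le_ofReal
      have q1 : t / s * a ≤ t * s := by
        rw [div_mul_eq_mul_div, div_le_iff₀ s0]; nlinarith
      have q2 : (t / s)⁻¹ * b ≤ t * s := by
        rw [inv_div, div_mul_eq_mul_div, div_le_iff₀ t0]; nlinarith
      linarith
    rw [mul_assoc]
    refine mul_le_mul_right ((pow_le_pow_left₀ zero_le e k).trans (le_of_eq ?_)) _
    rw [← s2, ← t2, ← mul_pow, ENNReal.ofReal_mul (by norm_num), mul_pow, ENNReal.ofReal_ofNat]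
    congr 1
    rw [ENNReal.ofReal_pow (by positivity), ← ENNReal.rpow_natCast, ← ENNReal.rpow_natCast,
      ← ENNReal.rpow_mul]
    congr 1; push_cast; ring
  have lim : Tendsto (fun ε : ℝ => K * 2 ^ k * (ENNReal.ofReal ((a + ε) * (b + ε))) ^ ((k : ℝ) / 2))
      (𝓝[>] 0) (𝓝 (K * 2 ^ k * (ENNReal.ofReal ((a + 0) * (b + 0))) ^ ((k : ℝ) / 2))) := by
    refine ENNReal.Tendsto.const_mul ?_ (Or.inr (ENNReal.mul_ne_top hK (by simp)))
    refine (ENNReal.continuous_rpow_const.tendsto _).comp ?_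
    refine ENNReal.tendsto_ofReal ?_
    refine Tendsto.mono_left ?_ nhdsWithin_le_nhds
    exact Continuous.tendsto (by fun_prop) _
  have := ge_of_tendsto lim (eventually_nhdsWithin_of_forall fun ε hε => key ε hε)
  rwa [add_zero, add_zero, ENNReal.ofReal_mul ha0, ← hA', ← hB'] at this

/-- square root of the kernel -/
def bw (l : ℝ) (D : Set (Esp N)) : Esp N → ℝ≥0∞ :=
  D.indicator fun η => ENNReal.ofReal (Real.sqrt (l / (l ^ 2 + wt η ^ 2)))

def aw (l : ℝ) (g : Esp N → ℂ) : Esp N → ℝ≥0∞ := fun η =>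
  ‖g η‖ₑ * ENNReal.ofReal (Real.sqrt (l + l⁻¹ * wt η ^ 2))

lemma bw_sq {l : ℝ} (hl : 0 < l) (D : Set (Esp N)) (η : Esp N) :
    bw l D η ^ 2 = D.indicator (fun η => Pk l (wt η)) η := by
  unfold bw Pk
  by_cases h : η ∈ D
  · simp only [Set.indicator_of_mem h]
    rw [← ENNReal.ofReal_pow (Real.sqrt_nonneg _), Real.sq_sqrt (by positivity)]
  · simp [h]

lemma bw_meas (l : ℝ) {D : Set (Esp N)} (hD : MeasurableSet D) : Measurable (bw l D) := by
  have := (wt_cont (N := N)).measurable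
  refine Measurable.indicator (by fun_prop) hD

lemma aw_meas (l : ℝ) {g : Esp N → ℂ} (hg : Measurable g) : Measurable (aw l g) := by
  have := (wt_cont (N := N)).measurable
  unfold aw; fun_prop

lemma aw_bw {l : ℝ} (hl : 0 < l) {D : Set (Esp N)} {g : Esp N → ℂ} (hs : ∀ ξ, ξ ∉ D → g ξ = 0)
    (η : Esp N) : ‖g η‖ₑ = aw l g η * bw l D η := by
  by_cases h : η ∈ D
  · unfold aw bw
    rw [Set.indicator_of_mem h, mul_assoc, ← ENNReal.ofReal_mul (Real.sqrt_nonneg _),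
      ← Real.sqrt_mul (by positivity)]
    have : (l + l⁻¹ * wt η ^ 2) * (l / (l ^ 2 + wt η ^ 2)) = 1 := by field_simp
    rw [this]; simp
  · simp [aw, hs η h]

lemma aw_int {l : ℝ} (hl : 0 < l) {g : Esp N → ℂ} (hg : Measurable g) :
    ∫⁻ x, aw l g x ^ 2 = ENNReal.ofReal l * A2 g + ENNReal.ofReal l⁻¹ * B2 g := by
  have hw := (wt_cont (N := N)).measurable
  unfold A2 B2 aw
  rw [← lintegral_const_mul _ (by fun_prop), ← lintegral_const_mul _ (by fun_prop),
    ← lintegral_add_left (by fun_prop)]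
  congr 1; ext x
  rw [mul_pow, ← ENNReal.ofReal_pow (Real.sqrt_nonneg _), Real.sq_sqrt (by positivity),
    ENNReal.ofReal_add (by positivity) (by positivity), ENNReal.ofReal_mul (by positivity)]
  ring

lemma B2_zero_of {g : Esp N → ℂ} (hg : Measurable g) (h : A2 g = 0) : B2 g = 0 := by
  unfold A2 at h; unfold B2
  rw [lintegral_eq_zero_iff (by fun_prop)] at h
  have hw := (wt_cont (N := N)).measurable
  rw [lintegral_eq_zero_iff (by fun_prop)]
  filter_upwards [h] with x hx
  simp only [Pi.zero_apply] at hx ⊢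
  rw [hx, mul_zero]

lemma int_of_supp {g : Esp N → ℂ} (hg : Measurable g) (hm : MemLp g 2 (volume : Measure (Esp N)))
    {D : Set (Esp N)} (hD : MeasurableSet D) (hDf : volume D ≠ ⊤) (hs : ∀ ξ, ξ ∉ D → g ξ = 0) :
    Integrable g (volume : Measure (Esp N)) := by
  refine ⟨hg.aestronglyMeasurable, ?_⟩
  have := sup_A2 hD hg hs
  have h2 : volume D * A2 g < ⊤ := ENNReal.mul_lt_top hDf.lt_top (A2_ne_top hm).lt_top
  have h3 := this.trans_lt h2
  rw [hasFiniteIntegral_def]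
  by_contra hh
  rw [not_lt, top_le_iff] at hh
  rw [hh] at h3
  simp at h3
end SW
end P9

section P10
open scoped FourierTransform SchwartzMap ENNReal
open LineDeriv
namespace SW
variable {N : ℕ}

lemma good_wrap {σ : ℝ} (hσ : 0 < σ) {D : Set (Esp N)} {C : ℝ} (hC : 0 < C)
    (h : ∀ g : Esp N → ℂ, Measurable g → MemLp g 2 (volume : Measure (Esp N)) →
      (∀ ξ, ξ ∉ D → g ξ = 0) → B2 g ≠ ⊤ →
      ∫⁻ x, ‖T g x‖ₑ ^ (2 * σ + 2) ≤ ENNReal.ofReal C * (A2 g ^ σ * B2 g)) : Good σ D := by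
  refine ⟨C, hC, fun g hg hm hs => ?_⟩
  by_cases hB : B2 g = ⊤
  · have hA : A2 g ≠ 0 := by
      intro hA
      rw [B2_zero_of hg hA] at hB
      exact ENNReal.zero_ne_top hB
    have : A2 g ^ σ ≠ 0 := by
      intro hh
      rw [ENNReal.rpow_eq_zero_iff] at hh
      rcases hh with hh | hh
      · exact hA hh.1
      · exact A2_ne_top hm hh.1
    rw [hB, ENNReal.mul_top this, ENNReal.mul_top (by simpa using hC)]
    exact le_top
  · exact h g hg hm hs hB

lemma good_of_I1 {D : Set (Esp N)} (hD : MeasurableSet D) {K : ℝ}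
    (hK : 0 < K) (h : ∀ l : ℝ, 0 < l → ∫⁻ t, D.indicator (fun η => Pk l (wt η)) t ≤ ENNReal.ofReal K) :
    Good 2 D := by
  refine good_wrap (C := K ^ 2 * 4) (by norm_num) (by positivity) fun g hg hm hs hB => ?_
  have hA := A2_ne_top hm
  have key := opt (X := ∫⁻ x, ‖T g x‖ₑ ^ (2 * 2 + 2 : ℝ)) (K := ENNReal.ofReal K ^ 2 * A2 g) (k := 2)
    hA hB (ENNReal.mul_ne_top (by simp) hA) (fun l hl => by
      have hsup : ∀ᵐ x, ‖T g x‖ₑ ^ 2 ≤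
          (ENNReal.ofReal l * A2 g + ENNReal.ofReal l⁻¹ * B2 g) * ENNReal.ofReal K := by
        filter_upwards [T_sup hm] with x hx
        refine (pow_le_pow_left₀ zero_le hx 2).trans ?_
        simp only [aw_bw hl hs]
        refine (lcs volume (aw_meas l hg).aemeasurable (bw_meas l hD).aemeasurable).trans ?_
        rw [aw_int hl hg]
        simp only [bw_sq hl]
        exact mul_le_mul_right (h l hl) _
      have e : ∀ x, ‖T g x‖ₑ ^ (2 * 2 + 2 : ℝ) = (‖T g x‖ₑ ^ 2) ^ 2 * ‖T g x‖ₑ ^ 2 := by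
        intro x
        rw [show (2 * 2 + 2 : ℝ) = ((6 : ℕ) : ℝ) by norm_num, ENNReal.rpow_natCast]; ring
      simp only [e]
      calc _ ≤ ∫⁻ x, ((ENNReal.ofReal l * A2 g + ENNReal.ofReal l⁻¹ * B2 g) * ENNReal.ofReal K) ^ 2
              * ‖T g x‖ₑ ^ 2 := by
            apply lintegral_mono_ae
            filter_upwards [hsup] with x hx
            gcongr
        _ = _ := by
            rw [lintegral_const_mul', T_lintegral hm]
            · unfold A2; ring
            · refine ENNReal.pow_ne_top (ENNReal.mul_ne_top (ENNReal.add_ne_top.2 ⟨?_, ?_⟩) (by simp))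
              · exact ENNReal.mul_ne_top (by simp) hA
              · exact ENNReal.mul_ne_top (by simp) hB)
  refine key.trans (le_of_eq ?_)
  rw [show ((2 : ℕ) : ℝ) / 2 = 1 by norm_num, ENNReal.rpow_one,
    show (2 : ℝ) = ((2 : ℕ) : ℝ) by norm_num, ENNReal.rpow_natCast,
    ENNReal.ofReal_mul (by positivity), ENNReal.ofReal_pow hK.le]
  have : ENNReal.ofReal 4 = 2 ^ 2 := by norm_num
  rw [this]; ring

lemma good_of_I2 {D : Set (Esp N)} (hD : MeasurableSet D) (hDf : volume D ≠ ⊤) {K : ℝ}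
    (hK : 0 < K) (h : ∀ l : ℝ, 0 < l → ∀ ξ, ∫⁻ t, D.indicator (fun η => Pk l (wt η)) t *
      D.indicator (fun η => Pk l (wt η)) (ξ - t) ≤ ENNReal.ofReal K) :
    Good 1 D := by
  refine good_wrap (C := K * 4) (by norm_num) (by positivity) fun g hg hm hs hB => ?_
  have hA := A2_ne_top hm
  have hi := int_of_supp hg hm hD hDf hs
  have key := opt (X := ∫⁻ x, ‖T g x‖ₑ ^ 4) (K := ENNReal.ofReal K) (k := 2)
    hA hB (by simp) (fun l hl => by
      rw [← aw_int hl hg, mul_comm]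
      refine conv4 hg hi hm (aw_meas l hg) (bw_meas l hD) (aw_bw hl hs) fun ξ => ?_
      simp only [bw_sq hl]
      exact h l hl ξ)
  have e : ∀ x, ‖T g x‖ₑ ^ (2 * 1 + 2 : ℝ) = ‖T g x‖ₑ ^ 4 := by
    intro x
    rw [show (2 * 1 + 2 : ℝ) = ((4 : ℕ) : ℝ) by norm_num, ENNReal.rpow_natCast]
  simp only [e]
  refine key.trans (le_of_eq ?_)
  rw [show ((2 : ℕ) : ℝ) / 2 = 1 by norm_num, ENNReal.rpow_one, ENNReal.rpow_one,
    ENNReal.ofReal_mul (by positivity)]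
  have : ENNReal.ofReal 4 = 2 ^ 2 := by norm_num
  rw [this]

lemma good_of_I3 {D : Set (Esp N)} (hD : MeasurableSet D) (hDf : volume D ≠ ⊤) {K : ℝ}
    (hK : 0 < K) (h : ∀ l : ℝ, 0 < l → ∀ ξ, ∫⁻ t, ∫⁻ s, D.indicator (fun η => Pk l (wt η)) s *
      D.indicator (fun η => Pk l (wt η)) t *
      D.indicator (fun η => Pk l (wt η)) (ξ - s - t) ≤ ENNReal.ofReal K) :
    Good (4 / 3) D := by
  refine good_wrap (C := (K * 8) ^ (2 / 3 : ℝ)) (by norm_num) (by positivity) fun g hg hm hs hB => ?_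
  have hA := A2_ne_top hm
  have hi := int_of_supp hg hm hD hDf hs
  have key := opt (X := ∫⁻ x, ‖T g x‖ₑ ^ 6) (K := ENNReal.ofReal K) (k := 3)
    hA hB (by simp) (fun l hl => by
      rw [← aw_int hl hg, mul_comm]
      refine conv6 hg hi hm (aw_meas l hg) (bw_meas l hD) (aw_bw hl hs) fun ξ => ?_
      simp only [bw_sq hl]
      exact h l hl ξ)
  have hi := interp (T_memLp hm).1 (p := 2) (q := 6) (r := 2 * (4 / 3) + 2) (θ := 2 / 3)
    (by norm_num) (by norm_num) (by norm_num) (by norm_num) (by norm_num)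
  rw [A2_T hm] at hi
  have e : ∀ x, ‖T g x‖ₑ ^ (6 : ℝ) = ‖T g x‖ₑ ^ 6 := by
    intro x
    rw [show (6 : ℝ) = ((6 : ℕ) : ℝ) by norm_num, ENNReal.rpow_natCast]
  simp only [e] at hi
  refine hi.trans ?_
  refine (mul_le_mul_right (ENNReal.rpow_le_rpow key (by norm_num)) _).trans (le_of_eq ?_)
  have e8 : ENNReal.ofReal K * 2 ^ 3 = ENNReal.ofReal (K * 8) := by
    rw [ENNReal.ofReal_mul hK.le]; norm_num
  rw [e8, ENNReal.mul_rpow_of_nonneg _ _ (by norm_num), ← ENNReal.rpow_mul,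
    ENNReal.ofReal_rpow_of_pos (by positivity)]
  have e9 : ((3 : ℕ) : ℝ) / 2 * (2 / 3) = 1 := by norm_num
  rw [e9, ENNReal.rpow_one, show (4 / 3 : ℝ) = (1 - 2 / 3) + 1 by norm_num,
    ENNReal.rpow_add_of_nonneg _ _ (by norm_num) (by norm_num), ENNReal.rpow_one]
  ring

end SW
end P10

section P11
open scoped FourierTransform SchwartzMap ENNReal
open LineDeriv
namespace SW
variable {N : ℕ}

/-- adding a coordinate -/
def econs {n : ℕ} (t : ℝ) (y : Esp n) : Esp (n + 1) :=
  WithLp.toLp 2 ((Fin.insertNthEquiv (fun _ : Fin (n + 1) => ℝ) 0) (t, y.ofLp))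

lemma econs_mp {n : ℕ} : MeasurePreserving (fun p : ℝ × Esp n => econs p.1 p.2) := by
  have h1 : MeasurePreserving (fun p : ℝ × Esp n => (p.1, p.2.ofLp)) :=
    (MeasurePreserving.id (volume : Measure ℝ)).prod (PiLp.volume_preserving_ofLp (Fin n))
  have h2 := (volume_preserving_piFinSuccAbove (fun _ : Fin (n + 1) => ℝ) 0).symm
  exact (PiLp.volume_preserving_toLp (Fin (n + 1))).comp (h2.comp h1)

lemma econs_zero {n : ℕ} (t : ℝ) (y : Esp n) : (econs t y) 0 = t := by
  simp [econs]

lemma econs_succ {n : ℕ} (t : ℝ) (y : Esp n) (i : Fin n) : (econs t y) i.succ = y i := by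
  simp [econs]

lemma econs_norm {n : ℕ} (t : ℝ) (y : Esp n) : ‖econs t y‖ ^ 2 = t ^ 2 + ‖y‖ ^ 2 := by
  rw [EuclideanSpace.norm_sq_eq, EuclideanSpace.norm_sq_eq, Fin.sum_univ_succ]
  simp [econs_zero, econs_succ]

lemma econs_sub {n : ℕ} (t t' : ℝ) (y y' : Esp n) : econs t y - econs t' y' = econs (t - t') (y - y') := by
  ext i
  refine Fin.cases ?_ (fun i => ?_) i
  · simp [econs_zero]
  · simp [econs_succ]

lemma lint_split {n : ℕ} {F : Esp (n + 1) → ℝ≥0∞} (hF : Measurable F) :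
    ∫⁻ η, F η = ∫⁻ t : ℝ, ∫⁻ y : Esp n, F (econs t y) := by
  rw [← econs_mp.lintegral_comp hF, Measure.volume_eq_prod, lintegral_prod]
  exact (hF.comp econs_mp.measurable).aemeasurable

lemma rot_exists {ξ ζ : Esp N} (h : ‖ξ‖ = ‖ζ‖) : ∃ R : Esp N ≃ₗᵢ[ℝ] Esp N, R ξ = ζ :=
  ⟨_, Submodule.reflection_sub h⟩

lemma rot_lint (R : Esp N ≃ₗᵢ[ℝ] Esp N) {F : Esp N → ℝ≥0∞} (hF : Measurable F) :
    ∫⁻ η, F (R η) = ∫⁻ η, F η :=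
  R.measurePreserving.lintegral_comp hF

/-- `Esp 2` as a product -/
lemma lint_two {F : Esp 2 → ℝ≥0∞} (hF : Measurable F) :
    ∫⁻ η, F η = ∫⁻ p : ℝ × ℝ, F (!₂[p.1, p.2]) := by
  have h2 := (volume_preserving_finTwoArrow ℝ).symm
  have h3 := (PiLp.volume_preserving_toLp (Fin 2)).comp h2
  rw [← h3.lintegral_comp hF]
  rfl

lemma norm_two (a b : ℝ) : ‖(!₂[a, b] : Esp 2)‖ ^ 2 = a ^ 2 + b ^ 2 := by
  rw [EuclideanSpace.norm_sq_eq, Fin.sum_univ_two]; simp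

/-- polar coordinates -/
lemma polar {F : ℝ × ℝ → ℝ≥0∞} (hF : Measurable F) :
    ∫⁻ p, F p = ∫⁻ θ in Set.Ioo (-Real.pi) Real.pi, ∫⁻ r in Set.Ioi (0 : ℝ),
      ENNReal.ofReal r * F (r * Real.cos θ, r * Real.sin θ) := by
  rw [← lintegral_comp_polarCoord_symm, polarCoord_target, Measure.volume_eq_prod,
    ← Measure.prod_restrict, lintegral_prod_symm]
  · rfl
  · simp only [polarCoord_symm_apply, smul_eq_mul]
    fun_prop

lemma radial2 {F : ℝ → ℝ≥0∞} (hF : Measurable F) :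
    ∫⁻ y : Esp 2, F (‖y‖ ^ 2) ≤ ENNReal.ofReal Real.pi * ∫⁻ x, F x := by
  rw [lint_two (by fun_prop)]
  simp only [norm_two]
  rw [polar (by fun_prop)]
  have key : ∀ θ : ℝ, ∫⁻ r in Set.Ioi (0 : ℝ), ENNReal.ofReal r *
      F ((r * Real.cos θ) ^ 2 + (r * Real.sin θ) ^ 2) ≤ ENNReal.ofReal (1 / 2) * ∫⁻ x, F x := by
    intro θ
    have e : ∀ r : ℝ, ENNReal.ofReal r * F ((r * Real.cos θ) ^ 2 + (r * Real.sin θ) ^ 2) =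
        ENNReal.ofReal (1 / 2) * (ENNReal.ofReal (2 * r) * F (r ^ 2)) := by
      intro r
      have : (r * Real.cos θ) ^ 2 + (r * Real.sin θ) ^ 2 = r ^ 2 := by
        have := Real.sin_sq_add_cos_sq θ
        linear_combination r ^ 2 * this
      rw [this, ← mul_assoc, ← ENNReal.ofReal_mul (by norm_num)]
      congr 2; ring
    simp only [e]
    rw [lintegral_const_mul _ (by fun_prop)]
    refine mul_le_mul_right (sub1 (f := fun r => r ^ 2) (f' := fun r => 2 * r) measurableSet_Ioi ?_ ?_ F) _
    · intro x _
      simpa using (hasDerivAt_pow 2 x).hasDerivWithinAt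
    · intro x hx y hy hxy
      simp only [Set.mem_Ioi] at hx
      exact pow_le_pow_left₀ hx.le hxy 2
  refine (lintegral_mono fun θ => key θ).trans ?_
  rw [setLIntegral_const, Real.volume_Ioo, mul_right_comm, ← ENNReal.ofReal_mul (by norm_num)]
  apply le_of_eq; congr 2; ring

lemma J3 {l : ℝ} (hl : 0 < l) {L : ℝ} (hL : 0 < L) (c : ℝ) :
    ∫⁻ η : Esp 3, Pk l (4 * Real.pi ^ 2 * ‖η‖ ^ 2 + c) *
      Pk l (4 * Real.pi ^ 2 * ‖econs L 0 - η‖ ^ 2 + c) ≤ ENNReal.ofReal (Real.pi / L) := by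
  rw [lint_split (by fun_prop)]
  simp only [econs_sub, econs_norm, zero_sub, norm_neg]
  have pi0 := Real.pi_pos
  calc _ ≤ ∫⁻ t : ℝ, ENNReal.ofReal Real.pi * ∫⁻ x : ℝ, Pk l (4 * Real.pi ^ 2 * x + c) *
        Pk l (4 * Real.pi ^ 2 * (L ^ 2 - 2 * L * t + x) + c) := by
        refine lintegral_mono fun t => ?_
        refine (radial2 (F := fun x => Pk l (4 * Real.pi ^ 2 * (t ^ 2 + x) + c) *
          Pk l (4 * Real.pi ^ 2 * ((L - t) ^ 2 + x) + c)) (by fun_prop)).trans (le_of_eq ?_)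
        congr 1
        rw [← lintegral_add_left_eq_self (fun x => Pk l (4 * Real.pi ^ 2 * x + c) *
          Pk l (4 * Real.pi ^ 2 * (L ^ 2 - 2 * L * t + x) + c)) (t ^ 2)]
        congr 1; ext x
        congr 2; ring
    _ = ENNReal.ofReal Real.pi * ∫⁻ x : ℝ, ∫⁻ t : ℝ, Pk l (4 * Real.pi ^ 2 * x + c) *
        Pk l (4 * Real.pi ^ 2 * (L ^ 2 - 2 * L * t + x) + c) := by
        rw [lintegral_const_mul, lintegral_lintegral_swap (by fun_prop)]
        exact Measurable.lintegral_prod_right' (f := fun p : ℝ × ℝ => Pk l (4 * Real.pi ^ 2 * p.2 + c) *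
          Pk l (4 * Real.pi ^ 2 * (L ^ 2 - 2 * L * p.1 + p.2) + c)) (by fun_prop)
    _ = ENNReal.ofReal Real.pi * ∫⁻ x : ℝ, Pk l (4 * Real.pi ^ 2 * x + c) *
        ENNReal.ofReal (Real.pi / |-(8 * Real.pi ^ 2 * L)|) := by
        congr 2; ext x
        rw [lintegral_const_mul _ (by fun_prop), ← Pk_int hl (a := -(8 * Real.pi ^ 2 * L))
          (by have : 0 < 8 * Real.pi ^ 2 * L := by positivity
              linarith) (4 * Real.pi ^ 2 * (L ^ 2 + x) + c)]
        congr 2; ext t; congr 1; ring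
    _ = ENNReal.ofReal (Real.pi * ((Real.pi / |4 * Real.pi ^ 2|) * (Real.pi / |-(8 * Real.pi ^ 2 * L)|))) := by
        rw [lintegral_mul_const _ (by fun_prop), Pk_int hl (by positivity),
          ← ENNReal.ofReal_mul (by positivity), ← ENNReal.ofReal_mul (by positivity)]
    _ ≤ _ := by
        apply ENNReal.ofReal_le_ofReal
        rw [abs_neg, abs_of_pos (by positivity), abs_of_pos (by positivity)]
        have : Real.pi * (Real.pi / (4 * Real.pi ^ 2) * (Real.pi / (8 * Real.pi ^ 2 * L))) =
          (1 / (32 * Real.pi)) / L := by field_simp; norm_num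
        rw [this]
        gcongr
        rw [div_le_iff₀ (by positivity)]
        nlinarith [Real.pi_gt_three]
end SW
end P11

section P12
open scoped FourierTransform SchwartzMap ENNReal
open LineDeriv
namespace SW
variable {N : ℕ}

lemma wt_eq (η : Esp N) : wt η = 4 * Real.pi ^ 2 * ‖η‖ ^ 2 + (-1) := by unfold wt; ring

lemma I2_red (ξ₀ : Esp N) (h0 : ξ₀ ≠ 0) {K : ℝ}
    (h : ∀ l : ℝ, 0 < l → ∀ ξ : Esp N, ‖ξ₀‖ ≤ ‖ξ‖ →
      ∫⁻ t, (Metric.closedBall 0 (2 * ‖ξ₀‖)).indicator (fun t => Pk l (wt t) * Pk l (wt (ξ - t))) t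
        ≤ ENNReal.ofReal K) (hK : 0 < K) :
    Good 1 (Metric.ball ξ₀ (‖ξ₀‖ / 2)) := by
  have hn : 0 < ‖ξ₀‖ := norm_pos_iff.2 h0
  refine good_of_I2 measurableSet_ball measure_ball_lt_top.ne hK fun l hl ξ => ?_
  by_cases hξ : ‖ξ₀‖ ≤ ‖ξ‖
  · refine le_trans (lintegral_mono fun t => ?_) (h l hl ξ hξ)
    by_cases h1 : t ∈ Metric.ball ξ₀ (‖ξ₀‖ / 2)
    · by_cases h2 : ξ - t ∈ Metric.ball ξ₀ (‖ξ₀‖ / 2)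
      · have : t ∈ Metric.closedBall (0 : Esp N) (2 * ‖ξ₀‖) := by
          rw [mem_closedBall_zero_iff]
          rw [mem_ball_iff_norm] at h1
          have := norm_sub_norm_le t ξ₀
          linarith
        simp only [Set.indicator_of_mem h1, Set.indicator_of_mem h2, Set.indicator_of_mem this]
        exact le_rfl
      · simp [h2]
    · simp [h1]
  · refine le_of_eq_of_le ?_ zero_le
    rw [lintegral_eq_zero_of_ae_eq_zero]
    refine Eventually.of_forall fun t => ?_
    by_cases h1 : t ∈ Metric.ball ξ₀ (‖ξ₀‖ / 2)
    · by_cases h2 : ξ - t ∈ Metric.ball ξ₀ (‖ξ₀‖ / 2)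
      · exfalso; apply hξ
        rw [mem_ball_iff_norm] at h1 h2
        have e : (2 : ℝ) • ξ₀ = ξ - ((t - ξ₀) + (ξ - t - ξ₀)) := by rw [two_smul]; abel
        have := norm_sub_le ξ ((t - ξ₀) + (ξ - t - ξ₀))
        rw [← e, norm_smul] at this
        have h3 := norm_add_le (t - ξ₀) (ξ - t - ξ₀)
        simp only [Real.norm_ofNat] at this
        linarith
      · simp [h2]
    · simp [h1]

lemma I2_rot {l M : ℝ} {ξ ζ : Esp N} (h : ‖ξ‖ = ‖ζ‖) :
    ∫⁻ t, (Metric.closedBall 0 M).indicator (fun t => Pk l (wt t) * Pk l (wt (ξ - t))) t =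
    ∫⁻ t, (Metric.closedBall 0 M).indicator (fun t => Pk l (wt t) * Pk l (wt (ζ - t))) t := by
  obtain ⟨R, hR⟩ := rot_exists h
  have hw := (wt_cont (N := N)).measurable
  rw [← rot_lint R (F := (Metric.closedBall 0 M).indicator (fun t => Pk l (wt t) * Pk l (wt (ζ - t))))
    ((by fun_prop : Measurable (fun t : Esp N => Pk l (wt t) * Pk l (wt (ζ - t)))).indicator
      measurableSet_closedBall)]
  congr 1; ext t
  have e1 : R t ∈ Metric.closedBall (0 : Esp N) M ↔ t ∈ Metric.closedBall (0 : Esp N) M := by simp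
  have e2 : wt (ζ - R t) = wt (ξ - t) := by
    rw [wt_eq, wt_eq, ← hR, ← map_sub, R.norm_map]
  have e3 : wt (R t) = wt t := by rw [wt_eq, wt_eq, R.norm_map]
  by_cases ht : t ∈ Metric.closedBall (0 : Esp N) M
  · rw [Set.indicator_of_mem ht, Set.indicator_of_mem (e1.2 ht), e2, e3]
  · rw [Set.indicator_of_notMem ht, Set.indicator_of_notMem (fun hh => ht (e1.1 hh))]

lemma econs_norm' {n : ℕ} {t : ℝ} (ht : 0 ≤ t) : ‖econs t (0 : Esp n)‖ = t := by
  have := econs_norm t (0 : Esp n)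
  rw [norm_zero] at this
  refine (pow_left_inj₀ (norm_nonneg _) ht two_ne_zero).1 ?_
  rw [this]; ring

lemma econs_norm'' {n : ℕ} (y : Esp n) : ‖econs 0 y‖ = ‖y‖ := by
  have := econs_norm 0 y
  refine (pow_left_inj₀ (norm_nonneg _) (norm_nonneg _) two_ne_zero).1 ?_
  rw [this]; ring

lemma good3 (ξ₀ : Esp 3) (h0 : ξ₀ ≠ 0) : Good 1 (Metric.ball ξ₀ (‖ξ₀‖ / 2)) := by
  have hn : 0 < ‖ξ₀‖ := norm_pos_iff.2 h0
  refine I2_red ξ₀ h0 (K := Real.pi / ‖ξ₀‖) (fun l hl ξ hξ => ?_) (by have := Real.pi_pos; positivity)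
  have hL : 0 < ‖ξ‖ := hn.trans_le hξ
  rw [I2_rot (ζ := econs ‖ξ‖ 0) (econs_norm' hL.le).symm]
  refine (lintegral_mono fun t => Set.indicator_le_self _ _ t).trans ?_
  simp only [wt_eq]
  refine (J3 hl hL (-1)).trans (ENNReal.ofReal_le_ofReal ?_)
  have := Real.pi_pos
  gcongr

lemma good4 (ξ₀ : Esp 4) (h0 : ξ₀ ≠ 0) : Good 1 (Metric.ball ξ₀ (‖ξ₀‖ / 2)) := by
  have hn : 0 < ‖ξ₀‖ := norm_pos_iff.2 h0
  have pi0 := Real.pi_pos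
  refine I2_red ξ₀ h0 (K := 4 * ‖ξ₀‖ * (Real.pi / ‖ξ₀‖)) (fun l hl ξ hξ => ?_) (by positivity)
  have hL : 0 < ‖ξ‖ := hn.trans_le hξ
  rw [I2_rot (ζ := econs 0 (econs ‖ξ‖ 0)) (by rw [econs_norm'', econs_norm' hL.le])]
  have hw := (wt_cont (N := 4)).measurable
  rw [lint_split ((by fun_prop : Measurable (fun t : Esp 4 => Pk l (wt t) *
    Pk l (wt (econs 0 (econs ‖ξ‖ 0) - t)))).indicator measurableSet_closedBall)]
  calc _ ≤ ∫⁻ t : ℝ, (Set.Icc (-(2 * ‖ξ₀‖)) (2 * ‖ξ₀‖)).indicator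
        (fun _ => ENNReal.ofReal (Real.pi / ‖ξ₀‖)) t := by
        refine lintegral_mono fun t => ?_
        by_cases ht : t ∈ Set.Icc (-(2 * ‖ξ₀‖)) (2 * ‖ξ₀‖)
        · simp only [Set.indicator_of_mem ht]
          refine (lintegral_mono fun t => Set.indicator_le_self _ _ _).trans ?_
          refine le_trans (le_of_eq ?_) ((J3 hl hL (4 * Real.pi ^ 2 * t ^ 2 - 1)).trans
            (ENNReal.ofReal_le_ofReal (by gcongr)))
          congr 1; ext y
          rw [econs_sub, wt_eq, wt_eq, econs_norm, econs_norm]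
          congr 2 <;> ring
        · rw [Set.indicator_of_notMem ht]
          refine le_of_eq ?_
          rw [lintegral_eq_zero_of_ae_eq_zero]
          refine Eventually.of_forall fun y => Set.indicator_of_notMem ?_ _
          intro hh
          rw [mem_closedBall_zero_iff] at hh
          apply ht
          have := econs_norm t y
          exact abs_le_of_sq_le_sq' (by nlinarith [norm_nonneg y, norm_nonneg (econs t y)]) (by positivity)
    _ = _ := by
        rw [lintegral_indicator_const measurableSet_Icc, Real.volume_Icc,
          ← ENNReal.ofReal_mul (by positivity)]
        congr 1; ring

lemma good1 (ξ₀ : Esp 1) (h0 : ξ₀ ≠ 0) : Good 2 (Metric.ball ξ₀ (‖ξ₀‖ / 2)) := by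
  have hn : 0 < ‖ξ₀‖ := norm_pos_iff.2 h0
  have pi0 := Real.pi_pos
  set c := ‖ξ₀‖ / 2 with hc
  have hc0 : 0 < c := by positivity
  refine good_of_I1 measurableSet_ball (K := 2 * ((8 * Real.pi ^ 2 * c)⁻¹ * Real.pi)) (by positivity)
    fun l hl => ?_
  have hw := (wt_cont (N := 1)).measurable
  have q : ∫⁻ x in Set.Ioi c, Pk l (4 * Real.pi ^ 2 * x ^ 2 + (-1)) ≤
      ENNReal.ofReal ((8 * Real.pi ^ 2 * c)⁻¹ * Real.pi) := by
    have s := sub1 (f := fun x => 4 * Real.pi ^ 2 * x ^ 2 + (-1)) (f' := fun x => 8 * Real.pi ^ 2 * x)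
      (s := Set.Ioi c) measurableSet_Ioi (fun x _ => by
        have := (((hasDerivAt_pow 2 x).const_mul (4 * Real.pi ^ 2)).add_const (-1)).hasDerivWithinAt
          (s := Set.Ioi c)
        refine this.congr_deriv ?_; push_cast; ring) (fun x hx y hy hxy => by
          simp only [Set.mem_Ioi] at hx
          have : 0 < x := hc0.trans hx
          simp only; gcongr) (Pk l)
    have e : ∫⁻ x, Pk l x = ENNReal.ofReal Real.pi := by
      have := Pk_int hl (a := 1) one_ne_zero 0
      simpa using this
    rw [e] at s
    rw [ENNReal.ofReal_mul (by positivity)]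
    refine le_trans ?_ (mul_le_mul_right s _)
    rw [← lintegral_const_mul' _ _ (by simp)]
    refine setLIntegral_mono' measurableSet_Ioi fun x hx => ?_
    rw [← mul_assoc, ← ENNReal.ofReal_mul (by positivity)]
    refine le_mul_of_one_le_left zero_le ?_
    rw [ENNReal.one_le_ofReal, inv_mul_eq_div, one_le_div (by positivity)]
    simp only [Set.mem_Ioi] at hx
    gcongr
  have q' : ∫⁻ x in Set.Iio (-c), Pk l (4 * Real.pi ^ 2 * x ^ 2 + (-1)) ≤
      ENNReal.ofReal ((8 * Real.pi ^ 2 * c)⁻¹ * Real.pi) := by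
    refine le_trans (le_of_eq ?_) q
    rw [← lintegral_indicator measurableSet_Iio, ← lintegral_indicator measurableSet_Ioi,
      ← lintegral_neg_eq_self]
    congr 1; ext x
    simp only [Set.indicator, Set.mem_Iio, Set.mem_Ioi, neg_lt_neg_iff, neg_sq]
  have hp : MeasurePreserving (fun x : ℝ => (WithLp.toLp 2 (fun _ => x) : Esp 1)) :=
    (PiLp.volume_preserving_toLp (Fin 1)).comp (volume_preserving_funUnique (Fin 1) ℝ).symm
  rw [← hp.lintegral_comp ((by fun_prop : Measurable fun η : Esp 1 => Pk l (wt η)).indicator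
    measurableSet_ball)]
  have nn : ∀ x : ℝ, ‖(WithLp.toLp 2 (fun _ => x) : Esp 1)‖ = |x| := by
    intro x; simp [EuclideanSpace.norm_eq, Real.sqrt_sq_eq_abs]
  calc _ ≤ ∫⁻ x, ((Set.Ioi c).indicator (fun x => Pk l (4 * Real.pi ^ 2 * x ^ 2 + (-1))) x +
        (Set.Iio (-c)).indicator (fun x => Pk l (4 * Real.pi ^ 2 * x ^ 2 + (-1))) x) := by
        refine lintegral_mono fun x => ?_
        by_cases hx : (WithLp.toLp 2 (fun _ => x) : Esp 1) ∈ Metric.ball ξ₀ c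
        · rw [Set.indicator_of_mem hx]
          have e : wt (WithLp.toLp 2 (fun _ => x) : Esp 1) = 4 * Real.pi ^ 2 * x ^ 2 + (-1) := by
            rw [wt_eq, nn, sq_abs]
          rw [e]
          have : c < |x| := by
            rw [mem_ball_iff_norm'] at hx
            have := norm_sub_norm_le ξ₀ (WithLp.toLp 2 (fun _ => x) : Esp 1)
            rw [nn] at this
            have : ‖ξ₀‖ = 2 * c := by rw [hc]; ring
            linarith
          rcases lt_abs.1 this with h | h
          · rw [Set.indicator_of_mem (show x ∈ Set.Ioi c from h)]
            exact le_self_add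
          · rw [Set.indicator_of_mem (show x ∈ Set.Iio (-c) from by simp; linarith)]
            exact le_add_self
        · rw [Set.indicator_of_notMem hx]; exact zero_le
    _ ≤ _ := by
        rw [lintegral_add_left ((by fun_prop : Measurable (fun x : ℝ =>
          Pk l (4 * Real.pi ^ 2 * x ^ 2 + (-1)))).indicator measurableSet_Ioi),
          lintegral_indicator measurableSet_Ioi, lintegral_indicator measurableSet_Iio, two_mul,
          ENNReal.ofReal_add (by positivity) (by positivity)]
        exact add_le_add q q'
end SW
end P12

section P13
open scoped FourierTransform SchwartzMap ENNReal
open LineDeriv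
namespace SW
variable {N : ℕ}

lemma x_sin_ge {x : ℝ} (hx : |x| ≤ 1) : 3 / 4 * x ^ 2 ≤ x * Real.sin x := by
  have key : ∀ y : ℝ, 0 < y → y ≤ 1 → 3 / 4 * y ^ 2 ≤ y * Real.sin y := by
    intro y h0 h1
    have := Real.sin_gt_sub_cube h0
    nlinarith [mul_pos h0 h0, mul_le_mul_of_nonneg_left h1 h0.le,
      mul_le_mul_of_nonneg_left this.le h0.le, mul_nonneg (mul_pos h0 h0).le (sub_nonneg.2 h1),
      mul_nonneg (mul_nonneg (mul_pos h0 h0).le h0.le) (sub_nonneg.2 h1)]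
  rcases lt_trichotomy x 0 with h | h | h
  · have := key (-x) (by linarith) (by rw [abs_of_neg h] at hx; exact hx)
    rw [Real.sin_neg] at this
    linarith
  · simp [h]
  · exact key x h (by rwa [abs_of_pos h] at hx)

lemma x_sin_le (x : ℝ) : x * Real.sin x ≤ x ^ 2 := by
  have := Real.abs_sin_le_abs (x := x)
  calc x * Real.sin x ≤ |x * Real.sin x| := le_abs_self _
    _ = |x| * |Real.sin x| := abs_mul _ _
    _ ≤ |x| * |x| := by gcongr
    _ = x ^ 2 := by rw [← sq, sq_abs]

/-- the phase -/
def Ph (X a b θ φ : ℝ) : ℝ := X ^ 2 + a ^ 2 + b ^ 2 - 2 * X * a * Real.cos θ - 2 * X * b * Real.cos φ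
  + 2 * a * b * Real.cos (θ - φ)

lemma Ph_deriv (X a b u v r : ℝ) :
    HasDerivAt (fun r => Ph X a b (r * u) (r * v))
      (2 * X * a * (u * Real.sin (r * u)) + 2 * X * b * (v * Real.sin (r * v))
        - 2 * a * b * ((u - v) * Real.sin (r * u - r * v))) r := by
  have h1 : HasDerivAt (fun r : ℝ => r * u) u r := by simpa using (hasDerivAt_id r).mul_const u
  have h2 : HasDerivAt (fun r : ℝ => r * v) v r := by simpa using (hasDerivAt_id r).mul_const v
  have := ((((hasDerivAt_const r (X ^ 2 + a ^ 2 + b ^ 2)).sub (h1.cos.const_mul (2 * X * a))).sub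
    (h2.cos.const_mul (2 * X * b))).add ((h1.sub h2).cos.const_mul (2 * a * b)))
  refine this.congr_deriv ?_
  simp only [Pi.sub_apply]
  ring

lemma Ph_lower {Y a b : ℝ} (hY : 0 < Y) (ha : |a - Y| ≤ Y / 50) (hb : |b - Y| ≤ Y / 50)
    {u v r : ℝ} (huv : u ^ 2 + v ^ 2 = 1) (h0 : 0 < r) (h1 : r < 1) :
    Y ^ 2 / 10 * r ≤ 2 * (3 * Y) * a * (u * Real.sin (r * u)) + 2 * (3 * Y) * b * (v * Real.sin (r * v))
        - 2 * a * b * ((u - v) * Real.sin (r * u - r * v)) := by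
  rw [abs_le] at ha hb
  have ha1 : 49 / 50 * Y ≤ a := by linarith
  have ha2 : a ≤ 51 / 50 * Y := by linarith
  have hb1 : 49 / 50 * Y ≤ b := by linarith
  have hb2 : b ≤ 51 / 50 * Y := by linarith
  have a0 : 0 < a := by linarith
  have b0 : 0 < b := by linarith
  have hu : |r * u| ≤ 1 := by
    rw [abs_le]; constructor <;> nlinarith [sq_nonneg (u-1), sq_nonneg (u+1), sq_nonneg v]
  have hv : |r * v| ≤ 1 := by
    rw [abs_le]; constructor <;> nlinarith [sq_nonneg (v-1), sq_nonneg (v+1), sq_nonneg u]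
  have s1 := x_sin_ge hu
  have s2 := x_sin_ge hv
  have s3 := x_sin_le (r * u - r * v)
  set S1 := Real.sin (r * u)
  set S2 := Real.sin (r * v)
  set S3 := Real.sin (r * u - r * v)
  have t1 : 3 / 4 * r * u ^ 2 ≤ u * S1 := by
    refine le_of_mul_le_mul_left ?_ h0; nlinarith
  have t2 : 3 / 4 * r * v ^ 2 ≤ v * S2 := by
    refine le_of_mul_le_mul_left ?_ h0; nlinarith
  have t3 : (u - v) * S3 ≤ r * (u - v) ^ 2 := by
    refine le_of_mul_le_mul_left ?_ h0; nlinarith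
  have p1 : 49 / 50 * Y * (3 / 4 * r * u ^ 2) ≤ a * (u * S1) :=
    mul_le_mul ha1 t1 (by positivity) a0.le
  have p2 : 49 / 50 * Y * (3 / 4 * r * v ^ 2) ≤ b * (v * S2) :=
    mul_le_mul hb1 t2 (by positivity) b0.le
  have p3 : a * b * ((u - v) * S3) ≤ (51 / 50 * Y) * (51 / 50 * Y) * (r * (u - v) ^ 2) := by
    refine (mul_le_mul_of_nonneg_left t3 (by positivity)).trans ?_
    refine mul_le_mul_of_nonneg_right ?_ (by positivity)
    exact mul_le_mul ha2 hb2 b0.le (by positivity)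
  have p4 : (u - v) ^ 2 ≤ 2 := by nlinarith [sq_nonneg (u + v)]
  have p5 : (51 / 50 * Y) * (51 / 50 * Y) * (r * (u - v) ^ 2) ≤ (51 / 50 * Y) * (51 / 50 * Y) * (r * 2) := by
    gcongr
  have p6 := mul_le_mul_of_nonneg_left (add_le_add p1 p2) hY.le
  have e : Y * (49 / 50 * Y * (3 / 4 * r * u ^ 2) + 49 / 50 * Y * (3 / 4 * r * v ^ 2)) =
    147 / 200 * (Y ^ 2 * r) := by linear_combination 147 / 200 * (Y ^ 2 * r) * huv
  have q : 0 < Y ^ 2 * r := by positivity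
  nlinarith

lemma Jang {l : ℝ} (hl : 0 < l) {Y a b : ℝ} (hY : 0 < Y) (ha : |a - Y| ≤ Y / 50) (hb : |b - Y| ≤ Y / 50) :
    ∫⁻ p : ℝ × ℝ, ({p : ℝ × ℝ | p.1 ^ 2 + p.2 ^ 2 < 1}).indicator
      (fun p => Pk l (4 * Real.pi ^ 2 * Ph (3 * Y) a b p.1 p.2 + (-1))) p ≤ ENNReal.ofReal (5 / Y ^ 2) := by
  have pi0 := Real.pi_pos
  have hP : Measurable (fun p : ℝ × ℝ => Pk l (4 * Real.pi ^ 2 * Ph (3 * Y) a b p.1 p.2 + (-1))) := by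
    unfold Ph; fun_prop
  have hS : MeasurableSet {p : ℝ × ℝ | p.1 ^ 2 + p.2 ^ 2 < 1} :=
    measurableSet_lt (by fun_prop) measurable_const
  rw [polar (hP.indicator hS)]
  have key : ∀ θ : ℝ, ∫⁻ r in Set.Ioi (0 : ℝ), ENNReal.ofReal r *
      ({p : ℝ × ℝ | p.1 ^ 2 + p.2 ^ 2 < 1}).indicator
      (fun p => Pk l (4 * Real.pi ^ 2 * Ph (3 * Y) a b p.1 p.2 + (-1)))
        (r * Real.cos θ, r * Real.sin θ) ≤ ENNReal.ofReal (5 / (2 * Real.pi * Y ^ 2)) := by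
    intro θ
    have huv : Real.cos θ ^ 2 + Real.sin θ ^ 2 = 1 := Real.cos_sq_add_sin_sq θ
    set u := Real.cos θ
    set v := Real.sin θ
    set f : ℝ → ℝ := fun r => 4 * Real.pi ^ 2 * Ph (3 * Y) a b (r * u) (r * v) + (-1) with hf
    set f' : ℝ → ℝ := fun r => 4 * Real.pi ^ 2 * (2 * (3 * Y) * a * (u * Real.sin (r * u)) +
      2 * (3 * Y) * b * (v * Real.sin (r * v))
        - 2 * a * b * ((u - v) * Real.sin (r * u - r * v))) with hf'
    have hd : ∀ r, HasDerivAt f (f' r) r := fun r =>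
      ((Ph_deriv (3 * Y) a b u v r).const_mul (4 * Real.pi ^ 2)).add_const (-1)
    have hlow : ∀ r ∈ Set.Ioo (0 : ℝ) 1, 4 * Real.pi ^ 2 * (Y ^ 2 / 10 * r) ≤ f' r := fun r hr => by
      have := Ph_lower hY ha hb huv hr.1 hr.2
      exact mul_le_mul_of_nonneg_left this (by positivity)
    have hmono : MonotoneOn f (Set.Ioo 0 1) := by
      refine monotoneOn_of_deriv_nonneg (convex_Ioo 0 1) (fun r _ => (hd r).continuousAt.continuousWithinAt)
        (fun r _ => (hd r).differentiableAt.differentiableWithinAt) fun r hr => ?_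
      rw [interior_Ioo] at hr
      rw [(hd r).deriv]
      refine le_trans ?_ (hlow r hr)
      have := hr.1
      positivity
    have s := sub1 (s := Set.Ioo 0 1) measurableSet_Ioo (fun r _ => (hd r).hasDerivWithinAt) hmono (Pk l)
    have e : ∫⁻ x, Pk l x = ENNReal.ofReal Real.pi := by
      have := Pk_int hl (a := 1) one_ne_zero 0
      simpa using this
    rw [e] at s
    have e2 : 5 / (2 * Real.pi * Y ^ 2) = (4 * Real.pi ^ 2 * (Y ^ 2 / 10))⁻¹ * Real.pi := by
      field_simp; norm_num
    rw [e2, ENNReal.ofReal_mul (by positivity)]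
    refine le_trans ?_ (mul_le_mul_right s _)
    rw [← lintegral_const_mul' _ _ (by simp), ← lintegral_indicator measurableSet_Ioi,
      ← lintegral_indicator measurableSet_Ioo]
    refine lintegral_mono fun r => ?_
    by_cases h0 : r ∈ Set.Ioi (0 : ℝ)
    · rw [Set.indicator_of_mem h0]
      have h0' : 0 < r := h0
      by_cases h1 : r < 1
      · rw [Set.indicator_of_mem (show r ∈ Set.Ioo 0 1 from ⟨h0, h1⟩), Set.indicator_of_mem, ← mul_assoc]
        · refine mul_le_mul_left ?_ _
          rw [← ENNReal.ofReal_mul (by positivity)]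
          apply ENNReal.ofReal_le_ofReal
          rw [inv_mul_eq_div, le_div_iff₀ (by positivity)]
          have := hlow r ⟨h0, h1⟩
          linarith
        · simp only [Set.mem_ofPred_eq]
          have : (r * u) ^ 2 + (r * v) ^ 2 = r ^ 2 := by linear_combination r ^ 2 * huv
          rw [this]; nlinarith
      · rw [Set.indicator_of_notMem]
        · simp
        · simp only [Set.mem_ofPred_eq, not_lt]
          have : (r * u) ^ 2 + (r * v) ^ 2 = r ^ 2 := by linear_combination r ^ 2 * huv
          rw [this]; nlinarith
    · rw [Set.indicator_of_notMem h0]; exact zero_le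
  refine (lintegral_mono fun θ => key θ).trans ?_
  rw [setLIntegral_const, Real.volume_Ioo, ← ENNReal.ofReal_mul (by positivity)]
  apply le_of_eq; congr 1; field_simp; norm_num

/-- radial part -/
def qr (l a : ℝ) : ℝ≥0∞ := (Set.Ioi (0 : ℝ)).indicator
  (fun a => ENNReal.ofReal a * Pk l (4 * Real.pi ^ 2 * a ^ 2 + (-1))) a

lemma qr_meas (l : ℝ) : Measurable (qr l) :=
  Measurable.indicator (by fun_prop) measurableSet_Ioi

lemma qr_int {l : ℝ} (hl : 0 < l) : ∫⁻ a, qr l a ≤ 1 := by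
  have pi0 := Real.pi_pos
  unfold qr
  rw [lintegral_indicator measurableSet_Ioi]
  have s := sub1 (f := fun x => 4 * Real.pi ^ 2 * x ^ 2 + (-1)) (f' := fun x => 8 * Real.pi ^ 2 * x)
      (s := Set.Ioi 0) measurableSet_Ioi (fun x _ => by
        have := (((hasDerivAt_pow 2 x).const_mul (4 * Real.pi ^ 2)).add_const (-1)).hasDerivWithinAt
          (s := Set.Ioi 0)
        refine this.congr_deriv ?_; push_cast; ring) (fun x hx y hy hxy => by
          simp only [Set.mem_Ioi] at hx
          simp only; gcongr) (Pk l)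
  have e : ∫⁻ x, Pk l x = ENNReal.ofReal Real.pi := by
    have := Pk_int hl (a := 1) one_ne_zero 0
    simpa using this
  rw [e] at s
  have s' := mul_le_mul_right s (ENNReal.ofReal (8 * Real.pi ^ 2)⁻¹)
  rw [← lintegral_const_mul' _ _ (by simp), ← ENNReal.ofReal_mul (by positivity)] at s'
  refine le_trans (le_trans (le_of_eq ?_) s') ?_
  · congr 1; ext x
    rw [← mul_assoc, ← ENNReal.ofReal_mul (by positivity)]
    congr 2; field_simp
  · rw [ENNReal.ofReal_le_one, inv_mul_eq_div, div_le_one (by positivity)]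
    nlinarith [Real.pi_gt_three]
end SW
end P13

section P14
open scoped FourierTransform SchwartzMap ENNReal
open LineDeriv
namespace SW
variable {N : ℕ}

lemma swap4 (v α : Measure ℝ) [SFinite v] [SFinite α] {q : ℝ → ℝ≥0∞} (hq : Measurable q)
    {P : ℝ → ℝ → ℝ → ℝ → ℝ≥0∞}
    (hP : Measurable (fun z : ℝ × ℝ × ℝ × ℝ => P z.1 z.2.1 z.2.2.1 z.2.2.2)) {C : ℝ≥0∞}
    (h1 : ∫⁻ a, q a ∂α ≤ 1)
    (h : ∀ᵐ a ∂α, ∀ᵐ b ∂α, ∫⁻ φ, ∫⁻ θ, P a b θ φ ∂v ∂v ≤ C) :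
    ∫⁻ φ, ∫⁻ b, q b * ∫⁻ θ, ∫⁻ a, q a * P a b θ φ ∂α ∂v ∂α ∂v ≤ C := by
  have m4 : ∀ {f1 f2 f3 f4 : ℝ × ℝ × ℝ × ℝ → ℝ}, Measurable f1 → Measurable f2 → Measurable f3 →
      Measurable f4 → Measurable (fun z => P (f1 z) (f2 z) (f3 z) (f4 z)) := by
    intro f1 f2 f3 f4 m1 m2 m3 m4
    exact hP.comp (m1.prodMk (m2.prodMk (m3.prodMk m4)))
  -- inner integral over a, as function of (b, θ, φ)
  have mA : Measurable (fun w : (ℝ × ℝ) × ℝ => ∫⁻ a, q a * P a w.1.2 w.2 w.1.1 ∂α) := by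
    refine Measurable.lintegral_prod_right' (f := fun z : ((ℝ × ℝ) × ℝ) × ℝ =>
      q z.2 * P z.2 z.1.1.2 z.1.2 z.1.1.1) ?_
    exact (hq.comp measurable_snd).mul (hP.comp (by fun_prop :
      Measurable (fun z : ((ℝ × ℝ) × ℝ) × ℝ => (z.2, z.1.1.2, z.1.2, z.1.1.1))))
  have mB : Measurable (fun w : ℝ × ℝ => ∫⁻ θ, ∫⁻ a, q a * P a w.2 θ w.1 ∂α ∂v) :=
    mA.lintegral_prod_right'
  rw [lintegral_lintegral_swap ((hq.comp measurable_snd).mul mB).aemeasurable]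
  have mth : ∀ b, Measurable (fun w : ℝ × ℝ => ∫⁻ θ, P w.2 b θ w.1 ∂v) := fun b => by
    refine Measurable.lintegral_prod_right' (f := fun z : (ℝ × ℝ) × ℝ => P z.1.2 b z.2 z.1.1) ?_
    exact hP.comp (by fun_prop :
      Measurable (fun z : (ℝ × ℝ) × ℝ => (z.1.2, b, z.2, z.1.1)))
  have key : ∀ b, (∀ᵐ a ∂α, ∫⁻ φ, ∫⁻ θ, P a b θ φ ∂v ∂v ≤ C) →
      ∫⁻ φ, ∫⁻ θ, ∫⁻ a, q a * P a b θ φ ∂α ∂v ∂v ≤ C := by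
    intro b hb
    calc ∫⁻ φ, ∫⁻ θ, ∫⁻ a, q a * P a b θ φ ∂α ∂v ∂v
        = ∫⁻ φ, ∫⁻ a, ∫⁻ θ, q a * P a b θ φ ∂v ∂α ∂v := by
          congr 1; ext φ
          refine lintegral_lintegral_swap (Measurable.aemeasurable ?_)
          exact (hq.comp measurable_snd).mul (hP.comp (by fun_prop :
            Measurable (fun z : ℝ × ℝ => (z.2, b, z.1, φ))))
      _ = ∫⁻ φ, ∫⁻ a, q a * ∫⁻ θ, P a b θ φ ∂v ∂α ∂v := by
          congr 1; ext φ; congr 1; ext a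
          refine lintegral_const_mul _ ?_
          exact hP.comp (by fun_prop : Measurable (fun θ : ℝ => (a, b, θ, φ)))
      _ = ∫⁻ a, ∫⁻ φ, q a * ∫⁻ θ, P a b θ φ ∂v ∂v ∂α :=
          lintegral_lintegral_swap ((hq.comp measurable_snd).mul (mth b)).aemeasurable
      _ = ∫⁻ a, q a * ∫⁻ φ, ∫⁻ θ, P a b θ φ ∂v ∂v ∂α := by
          congr 1; ext a
          refine lintegral_const_mul _ ?_
          exact (mth b).comp (by fun_prop : Measurable (fun φ : ℝ => (φ, a)))
      _ ≤ ∫⁻ a, q a * C ∂α := by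
          refine lintegral_mono_ae ?_
          filter_upwards [hb] with a ha
          gcongr
      _ = (∫⁻ a, q a ∂α) * C := lintegral_mul_const _ hq
      _ ≤ 1 * C := by gcongr
      _ = C := one_mul _
  have h' : ∀ᵐ b ∂α, ∀ᵐ a ∂α, ∫⁻ φ, ∫⁻ θ, P a b θ φ ∂v ∂v ≤ C := by
    rw [Measure.ae_ae_comm] at h
    · exact h
    · refine measurableSet_le ?_ measurable_const
      have : Measurable (fun w : (ℝ × ℝ) × ℝ => ∫⁻ θ, P w.1.1 w.1.2 θ w.2 ∂v) := by
        refine Measurable.lintegral_prod_right' (f := fun z : ((ℝ × ℝ) × ℝ) × ℝ =>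
          P z.1.1.1 z.1.1.2 z.2 z.1.2) ?_
        exact hP.comp (by fun_prop :
          Measurable (fun z : ((ℝ × ℝ) × ℝ) × ℝ => (z.1.1.1, z.1.1.2, z.2, z.1.2)))
      exact this.lintegral_prod_right'
  calc ∫⁻ b, ∫⁻ φ, q b * ∫⁻ θ, ∫⁻ a, q a * P a b θ φ ∂α ∂v ∂v ∂α
      = ∫⁻ b, q b * ∫⁻ φ, ∫⁻ θ, ∫⁻ a, q a * P a b θ φ ∂α ∂v ∂v ∂α := by
        congr 1; ext b
        refine lintegral_const_mul _ ?_
        exact mB.comp (by fun_prop : Measurable (fun φ : ℝ => (φ, b)))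
    _ ≤ ∫⁻ b, q b * C ∂α := by
        refine lintegral_mono_ae ?_
        filter_upwards [h'] with b hb
        gcongr
        exact key b hb
    _ = (∫⁻ a, q a ∂α) * C := lintegral_mul_const _ hq
    _ ≤ 1 * C := by gcongr
    _ = C := one_mul _

lemma pol1 {l Y : ℝ} (hY : 0 < Y) {H : Esp 2 → ℝ≥0∞} (hH : Measurable H) :
    ∫⁻ s, (Metric.ball (!₂[Y, 0] : Esp 2) (Y / 50)).indicator (fun η => Pk l (wt η)) s * H s ≤
    ∫⁻ θ in {θ : ℝ | θ ^ 2 < 1 / 2}, ∫⁻ a in {a : ℝ | |a - Y| ≤ Y / 50},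
      qr l a * H (!₂[a * Real.cos θ, a * Real.sin θ]) := by
  have hw := (wt_cont (N := 2)).measurable
  have hm2 : Measurable (fun p : ℝ × ℝ => (!₂[p.1, p.2] : Esp 2)) := by
    refine (WithLp.measurable_toLp 2 _).comp ?_
    refine measurable_pi_lambda _ fun i => ?_
    fin_cases i <;> simp <;> fun_prop
  have hF : Measurable (fun s => (Metric.ball (!₂[Y, 0] : Esp 2) (Y / 50)).indicator
      (fun η => Pk l (wt η)) s * H s) :=
    (Measurable.indicator (by fun_prop) measurableSet_ball).mul hH
  rw [lint_two hF]
  refine (polar (hF.comp hm2)).trans_le ?_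
  simp only [Function.comp_apply]
  have mV : MeasurableSet {θ : ℝ | θ ^ 2 < 1 / 2} := measurableSet_lt (by fun_prop) (by fun_prop)
  have mA : MeasurableSet {a : ℝ | |a - Y| ≤ Y / 50} := measurableSet_le (by fun_prop) (by fun_prop)
  have pt : ∀ θ ∈ Set.Ioo (-Real.pi) Real.pi, ∀ r ∈ Set.Ioi (0:ℝ),
      ENNReal.ofReal r * ((Metric.ball (!₂[Y, 0] : Esp 2) (Y / 50)).indicator
      (fun η => Pk l (wt η)) (!₂[r * Real.cos θ, r * Real.sin θ]) * H (!₂[r * Real.cos θ, r * Real.sin θ]))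
      ≤ ({θ : ℝ | θ ^ 2 < 1 / 2}).indicator (fun θ => ({a : ℝ | |a - Y| ≤ Y / 50}).indicator (fun a =>
        qr l a * H (!₂[a * Real.cos θ, a * Real.sin θ])) r) θ := by
    intro θ hθ r hr
    have hr' : 0 < r := hr
    by_cases hb : (!₂[r * Real.cos θ, r * Real.sin θ] : Esp 2) ∈ Metric.ball (!₂[Y, 0] : Esp 2) (Y / 50)
    · rw [Set.indicator_of_mem hb]
      rw [Metric.mem_ball, dist_eq_norm] at hb
      have hb2 : (r * Real.cos θ - Y) ^ 2 + (r * Real.sin θ) ^ 2 < (Y / 50) ^ 2 := by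
        have := pow_lt_pow_left₀ hb (norm_nonneg _) two_ne_zero
        have e : (!₂[r * Real.cos θ, r * Real.sin θ] - !₂[Y, 0] : Esp 2) =
            !₂[r * Real.cos θ - Y, r * Real.sin θ] := by
          ext i; fin_cases i <;> simp
        rwa [e, norm_two] at this
      have hcs := Real.sin_sq_add_cos_sq θ
      have hA : |r - Y| ≤ Y / 50 := by
        apply abs_le_of_sq_le_sq _ (by positivity)
        have hc1 := Real.cos_le_one θ
        nlinarith [mul_pos hr' hY]
      have hcos : 0 < Real.cos θ := by
        by_contra hc
        push Not at hc
        nlinarith [sq_nonneg (r * Real.sin θ), mul_nonneg hr'.le (neg_nonneg.2 hc), mul_pos hY hY]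
      have hrY : 49 / 50 * Y ≤ r := by rw [abs_le] at hA; linarith [hA.1]
      have hsin : (Real.sin θ) ^ 2 ≤ 1 / 49 ^ 2 := by
        have h1 : (r * Real.sin θ) ^ 2 ≤ (Y / 50) ^ 2 := by nlinarith [sq_nonneg (r * Real.cos θ - Y)]
        have h2 : (49 / 50 * Y) ^ 2 * Real.sin θ ^ 2 ≤ (Y / 50) ^ 2 := by
          refine le_trans ?_ h1
          rw [mul_pow r]
          exact mul_le_mul_of_nonneg_right (pow_le_pow_left₀ (by positivity) hrY 2) (sq_nonneg _)
        have : (Y/50)^2 * (49 ^ 2 * Real.sin θ ^ 2) ≤ (Y / 50) ^ 2 * 1 := by nlinarith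
        have := le_of_mul_le_mul_left this (by positivity)
        linarith
      have hθ2 : |θ| < Real.pi / 2 := by
        by_contra hc
        push Not at hc
        have : Real.cos |θ| ≤ 0 := Real.cos_nonpos_of_pi_div_two_le_of_le hc (by
          have : |θ| < Real.pi := abs_lt.2 ⟨hθ.1, hθ.2⟩
          linarith [Real.pi_pos])
        rw [Real.cos_abs] at this
        linarith
      have hms := Real.mul_le_sin (abs_nonneg θ) hθ2.le
      have hsa : Real.sin |θ| ^ 2 ≤ 1 / 49 ^ 2 := by
        rcases abs_choice θ with h | h <;> rw [h]
        · exact hsin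
        · rw [Real.sin_neg, neg_sq]; exact hsin
      have hV : θ ^ 2 < 1 / 2 := by
        have h4 : 1 / 2 * |θ| ≤ 2 / Real.pi * |θ| := by
          refine mul_le_mul_of_nonneg_right ?_ (abs_nonneg _)
          rw [div_le_div_iff₀ (by norm_num) Real.pi_pos]
          linarith [Real.pi_le_four]
        rw [← sq_abs]
        have h5 : 1 / 2 * |θ| ≤ Real.sin |θ| := h4.trans hms
        have := pow_le_pow_left₀ (by positivity) h5 2
        nlinarith
      rw [Set.indicator_of_mem (show θ ∈ {θ : ℝ | θ ^ 2 < 1 / 2} from hV), Set.indicator_of_mem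
        (show r ∈ {a : ℝ | |a - Y| ≤ Y / 50} from hA)]
      unfold qr
      rw [Set.indicator_of_mem hr, wt_eq, norm_two]
      rw [show (r * Real.cos θ) ^ 2 + (r * Real.sin θ) ^ 2 = r ^ 2 by nlinarith, ← mul_assoc]
    · rw [Set.indicator_of_notMem hb]; simp
  rw [← lintegral_indicator mV]
  calc _ ≤ ∫⁻ θ in Set.Ioo (-Real.pi) Real.pi, ∫⁻ r in Set.Ioi (0:ℝ),
        ({θ : ℝ | θ ^ 2 < 1 / 2}).indicator (fun θ => ({a : ℝ | |a - Y| ≤ Y / 50}).indicator (fun a =>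
        qr l a * H (!₂[a * Real.cos θ, a * Real.sin θ])) r) θ := by
        refine setLIntegral_mono' measurableSet_Ioo fun θ hθ => ?_
        refine setLIntegral_mono' measurableSet_Ioi fun r hr => ?_
        exact pt θ hθ r hr
    _ ≤ ∫⁻ θ, ∫⁻ r,
        ({θ : ℝ | θ ^ 2 < 1 / 2}).indicator (fun θ => ({a : ℝ | |a - Y| ≤ Y / 50}).indicator (fun a =>
        qr l a * H (!₂[a * Real.cos θ, a * Real.sin θ])) r) θ :=
        (setLIntegral_le_lintegral _ _).trans (lintegral_mono fun θ => setLIntegral_le_lintegral _ _)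
    _ ≤ _ := by
        refine lintegral_mono fun θ => ?_
        by_cases hθ : θ ∈ {θ : ℝ | θ ^ 2 < 1 / 2}
        · simp only [Set.indicator_of_mem hθ]
          rw [lintegral_indicator mA]
        · simp only [Set.indicator_of_notMem hθ]; simp

lemma I3core {l Y : ℝ} (hl : 0 < l) (hY : 0 < Y) :
    ∫⁻ t, ∫⁻ s, (Metric.ball (!₂[Y, 0] : Esp 2) (Y / 50)).indicator (fun η => Pk l (wt η)) t *
      ((Metric.ball (!₂[Y, 0] : Esp 2) (Y / 50)).indicator (fun η => Pk l (wt η)) s *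
      Pk l (wt (!₂[3 * Y, 0] - s - t))) ≤ ENNReal.ofReal (5 / Y ^ 2) := by
  have hw := (wt_cont (N := 2)).measurable
  have hI : Measurable ((Metric.ball (!₂[Y, 0] : Esp 2) (Y / 50)).indicator (fun η => Pk l (wt η))) :=
    Measurable.indicator (by fun_prop) measurableSet_ball
  have mV : MeasurableSet {θ : ℝ | θ ^ 2 < 1 / 2} := measurableSet_lt (by fun_prop) (by fun_prop)
  have mA : MeasurableSet {a : ℝ | |a - Y| ≤ Y / 50} := measurableSet_le (by fun_prop) (by fun_prop)
  have mH : Measurable (fun t : Esp 2 => ∫⁻ s, (Metric.ball (!₂[Y, 0] : Esp 2) (Y / 50)).indicator (fun η => Pk l (wt η)) s *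
      Pk l (wt (!₂[3 * Y, 0] - s - t))) := by
    refine Measurable.lintegral_prod_right' (f := fun z : Esp 2 × Esp 2 =>
      (Metric.ball (!₂[Y, 0] : Esp 2) (Y / 50)).indicator (fun η => Pk l (wt η)) z.2 *
      Pk l (wt (!₂[3 * Y, 0] - z.2 - z.1))) ?_
    exact (hI.comp measurable_snd).mul (by fun_prop)
  have hphase : ∀ a b θ φ : ℝ, wt ((!₂[3 * Y, 0] : Esp 2) - !₂[a * Real.cos θ, a * Real.sin θ] -
      !₂[b * Real.cos φ, b * Real.sin φ]) = 4 * Real.pi ^ 2 * Ph (3 * Y) a b θ φ + (-1) := by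
    intro a b θ φ
    have e : ((!₂[3 * Y, 0] : Esp 2) - !₂[a * Real.cos θ, a * Real.sin θ] -
      !₂[b * Real.cos φ, b * Real.sin φ]) = !₂[3 * Y - a * Real.cos θ - b * Real.cos φ,
        0 - a * Real.sin θ - b * Real.sin φ] := by
      ext i; fin_cases i <;> simp
    rw [wt_eq, e, norm_two, Ph, Real.cos_sub]
    have h1 := Real.sin_sq_add_cos_sq θ
    have h2 := Real.sin_sq_add_cos_sq φ
    linear_combination (4 * Real.pi ^ 2 * a ^ 2) * h1 + (4 * Real.pi ^ 2 * b ^ 2) * h2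
  calc _ = ∫⁻ t, (Metric.ball (!₂[Y, 0] : Esp 2) (Y / 50)).indicator (fun η => Pk l (wt η)) t *
      ∫⁻ s, ((Metric.ball (!₂[Y, 0] : Esp 2) (Y / 50)).indicator (fun η => Pk l (wt η)) s *
      Pk l (wt (!₂[3 * Y, 0] - s - t))) := by
        congr 1; ext t
        exact lintegral_const_mul _ (hI.mul (by fun_prop))
    _ ≤ ∫⁻ φ in {θ : ℝ | θ ^ 2 < 1 / 2}, ∫⁻ b in {a : ℝ | |a - Y| ≤ Y / 50}, qr l b *
        ∫⁻ s, ((Metric.ball (!₂[Y, 0] : Esp 2) (Y / 50)).indicator (fun η => Pk l (wt η)) s *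
      Pk l (wt (!₂[3 * Y, 0] - s - !₂[b * Real.cos φ, b * Real.sin φ]))) := pol1 hY mH
    _ ≤ ∫⁻ φ in {θ : ℝ | θ ^ 2 < 1 / 2}, ∫⁻ b in {a : ℝ | |a - Y| ≤ Y / 50}, qr l b *
        ∫⁻ θ in {θ : ℝ | θ ^ 2 < 1 / 2}, ∫⁻ a in {a : ℝ | |a - Y| ≤ Y / 50}, qr l a *
          Pk l (4 * Real.pi ^ 2 * Ph (3 * Y) a b θ φ + (-1)) := by
        refine lintegral_mono fun φ => lintegral_mono fun b => ?_
        refine mul_le_mul_right ?_ _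
        refine (pol1 hY (by fun_prop)).trans_eq ?_
        simp only [hphase]
    _ ≤ ENNReal.ofReal (5 / Y ^ 2) := by
        refine swap4 _ _ (qr_meas l) (P := fun a b θ φ => Pk l (4 * Real.pi ^ 2 * Ph (3 * Y) a b θ φ + (-1)))
          (by unfold Ph; fun_prop) ((setLIntegral_le_lintegral _ _).trans (qr_int hl)) ?_
        filter_upwards [ae_restrict_mem mA] with a ha
        filter_upwards [ae_restrict_mem mA] with b hb
        refine le_trans ?_ (Jang hl hY ha hb)
        rw [lintegral_indicator (measurableSet_lt (by fun_prop) (by fun_prop))]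
        have hm : Measurable (fun p : ℝ × ℝ => Pk l (4 * Real.pi ^ 2 * Ph (3 * Y) a b p.1 p.2 + (-1))) := by
          unfold Ph; fun_prop
        rw [← lintegral_prod_symm (μ := volume.restrict _) (ν := volume.restrict _) _ hm.aemeasurable, Measure.prod_restrict, ← Measure.volume_eq_prod]
        refine lintegral_mono_set ?_
        rintro ⟨x, y⟩ ⟨h1, h2⟩
        simp only [Set.mem_ofPred_eq] at h1 h2 ⊢
        linarith

lemma rot_lint2 (R : Esp N ≃ₗᵢ[ℝ] Esp N) {F : Esp N → Esp N → ℝ≥0∞}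
    (hF : Measurable (fun z : Esp N × Esp N => F z.1 z.2)) :
    ∫⁻ t, ∫⁻ s, F (R t) (R s) = ∫⁻ t, ∫⁻ s, F t s := by
  have h1 : ∀ t, Measurable (F t) := fun t => hF.comp measurable_prodMk_left
  have h2 : Measurable (fun t => ∫⁻ s, F t s) := hF.lintegral_prod_right'
  rw [← rot_lint R h2]
  congr 1; ext t
  exact rot_lint R (h1 (R t))

lemma good2 (ξ₀ : Esp 2) (h0 : ξ₀ ≠ 0) : Good (4 / 3) (Metric.ball ξ₀ (‖ξ₀‖ / 200)) := by
  have hn : 0 < ‖ξ₀‖ := norm_pos_iff.2 h0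
  have hw := (wt_cont (N := 2)).measurable
  refine good_of_I3 measurableSet_ball measure_ball_lt_top.ne (K := 20 / ‖ξ₀‖ ^ 2) (by positivity) ?_
  intro l hl ξ
  set D := Metric.ball ξ₀ (‖ξ₀‖ / 200) with hD
  by_cases hξ : ‖ξ - (3 : ℝ) • ξ₀‖ < 3 * (‖ξ₀‖ / 200)
  swap
  · refine le_of_eq_of_le ?_ zero_le
    have : ∀ t s, D.indicator (fun η => Pk l (wt η)) s *
      D.indicator (fun η => Pk l (wt η)) t *
      D.indicator (fun η => Pk l (wt η)) (ξ - s - t) = 0 := by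
      intro t s
      by_cases hs : s ∈ D
      swap
      · simp [hs]
      by_cases ht : t ∈ D
      swap
      · simp [ht]
      by_cases hst : ξ - s - t ∈ D
      swap
      · simp [hst]
      exfalso; apply hξ
      rw [hD, Metric.mem_ball, dist_eq_norm] at hs ht hst
      have e : ξ - (3 : ℝ) • ξ₀ = (s - ξ₀) + (t - ξ₀) + (ξ - s - t - ξ₀) := by module
      rw [e]
      have := norm_add₃_le (a := s - ξ₀) (b := t - ξ₀) (c := ξ - s - t - ξ₀)
      linarith
    simp [this]
  set Y := ‖ξ‖ / 3 with hYd
  have hY1 : ‖ξ₀‖ / 2 ≤ Y := by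
    have h1 : ‖(3 : ℝ) • ξ₀‖ ≤ ‖ξ‖ + ‖ξ - (3 : ℝ) • ξ₀‖ := by
      have e : (3 : ℝ) • ξ₀ = ξ - (ξ - (3 : ℝ) • ξ₀) := by module
      rw [e]; refine (norm_sub_le _ _).trans_eq ?_; congr 2; module
    rw [norm_smul, Real.norm_ofNat] at h1
    rw [hYd]; linarith
  have hY : 0 < Y := by linarith
  have hnorm : ‖ξ‖ = ‖(!₂[3 * Y, 0] : Esp 2)‖ := by
    refine (pow_left_inj₀ (norm_nonneg _) (norm_nonneg _) two_ne_zero).1 ?_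
    rw [norm_two, hYd]; ring
  obtain ⟨R, hR⟩ := rot_exists hnorm
  have hRY : R ((1 / 3 : ℝ) • ξ) = !₂[Y, 0] := by
    rw [map_smul, hR]; ext i; fin_cases i <;> simp
  set I := (Metric.ball (!₂[Y, 0] : Esp 2) (Y / 50)).indicator (fun η => Pk l (wt η)) with hIdef
  have hI : Measurable I := Measurable.indicator (by fun_prop) measurableSet_ball
  have hsub : ∀ s, s ∈ D → R s ∈ Metric.ball (!₂[Y, 0] : Esp 2) (Y / 50) := by
    intro s hs
    rw [hD, Metric.mem_ball, dist_eq_norm] at hs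
    rw [Metric.mem_ball, dist_eq_norm, ← hRY, ← map_sub, R.norm_map]
    have e : s - (1 / 3 : ℝ) • ξ = (s - ξ₀) - (1 / 3 : ℝ) • (ξ - (3 : ℝ) • ξ₀) := by module
    rw [e]
    have h2 := norm_sub_le (s - ξ₀) ((1 / 3 : ℝ) • (ξ - (3 : ℝ) • ξ₀))
    rw [norm_smul] at h2
    norm_num at h2
    norm_num at hξ
    linarith
  have hwR : ∀ s, wt (R s) = wt s := fun s => by rw [wt_eq, wt_eq, R.norm_map]
  have hle : ∀ s, D.indicator (fun η => Pk l (wt η)) s ≤ I (R s) := by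
    intro s
    by_cases hs : s ∈ D
    · rw [hIdef, Set.indicator_of_mem hs, Set.indicator_of_mem (hsub s hs), hwR]
    · rw [Set.indicator_of_notMem hs]; exact zero_le
  have hle2 : ∀ s, D.indicator (fun η => Pk l (wt η)) s ≤ Pk l (wt s) := fun s =>
    Set.indicator_le_self' (fun _ _ => zero_le) s
  set F : Esp 2 → Esp 2 → ℝ≥0∞ := fun t s => I t * (I s * Pk l (wt (!₂[3 * Y, 0] - s - t))) with hF
  have hFm : Measurable (fun z : Esp 2 × Esp 2 => F z.1 z.2) :=
    (hI.comp measurable_fst).mul ((hI.comp measurable_snd).mul (by fun_prop))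
  calc _ ≤ ∫⁻ t, ∫⁻ s, F (R t) (R s) := by
        refine lintegral_mono fun t => lintegral_mono fun s => ?_
        have e : wt (!₂[3 * Y, 0] - R s - R t) = wt (ξ - s - t) := by
          rw [← hR, ← map_sub, ← map_sub, hwR]
        simp only [hF, e]
        calc _ ≤ I (R s) * I (R t) * Pk l (wt (ξ - s - t)) :=
              mul_le_mul' (mul_le_mul' (hle s) (hle t)) (hle2 _)
          _ = _ := by ring
    _ = ∫⁻ t, ∫⁻ s, F t s := rot_lint2 R hFm
    _ ≤ ENNReal.ofReal (5 / Y ^ 2) := I3core hl hY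
    _ ≤ ENNReal.ofReal (20 / ‖ξ₀‖ ^ 2) := by
        refine ENNReal.ofReal_le_ofReal ?_
        rw [div_le_div_iff₀ (by positivity) (by positivity)]
        have hY2 := pow_le_pow_left₀ (by positivity) hY1 2
        clear * - hY2
        linarith

lemma good_all (hN : 1 ≤ N) {σ : ℝ} (h1 : max 1 (4 / ((N : ℝ) + 1)) ≤ σ) (h2 : σ ≤ 4 / (N : ℝ)) :
    Good σ (Set.univ : Set (Esp N)) := by
  have hN4 : N ≤ 4 := by
    have h3 : (1:ℝ) ≤ 4 / (N : ℝ) := (le_max_left _ _).trans (h1.trans h2)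
    have : (0:ℝ) < N := by exact_mod_cast hN
    rw [le_div_iff₀ this] at h3
    have : (N : ℝ) ≤ 4 := by linarith
    exact_mod_cast this
  have ha := (le_max_left _ _).trans h1
  have hb := (le_max_right _ _).trans h1
  interval_cases N
  · exact good_univ hN (σ₀ := 2) (by norm_num) (by norm_num at hb; linarith) h2
      fun ξ₀ h0 => ⟨_, by have := norm_pos_iff.2 h0; positivity, good1 ξ₀ h0⟩
  · exact good_univ hN (σ₀ := 4 / 3) (by norm_num) (by norm_num at hb; linarith) h2
      fun ξ₀ h0 => ⟨_, by have := norm_pos_iff.2 h0; positivity, good2 ξ₀ h0⟩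
  · exact good_univ hN (σ₀ := 1) (by norm_num) ha h2
      fun ξ₀ h0 => ⟨_, by have := norm_pos_iff.2 h0; positivity, good3 ξ₀ h0⟩
  · exact good_univ hN (σ₀ := 1) (by norm_num) ha h2
      fun ξ₀ h0 => ⟨_, by have := norm_pos_iff.2 h0; positivity, good4 ξ₀ h0⟩

end SW
end P14

section P15
open scoped FourierTransform SchwartzMap ENNReal
open LineDeriv
namespace SW
variable {N : ℕ}

lemma cos_ge_half {x : ℝ} (hx : |x| ≤ 1) : 1 / 2 ≤ Real.cos x := by
  have := Real.one_sub_sq_div_two_le_cos (x := x)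
  have h2 : x ^ 2 ≤ 1 := by rw [← sq_abs]; nlinarith [abs_nonneg x]
  linarith

lemma four_ind_lower {S : Set (Esp N)} (hS : MeasurableSet S) (hSf : volume S ≠ ⊤) {a : ℝ} (ha : 0 ≤ a)
    {e x : Esp N} (h : ∀ ξ ∈ S, |2 * Real.pi * inner ℝ (ξ - e) x| ≤ 1) :
    a * (volume S).toReal / 2 ≤ ‖(𝓕⁻ (S.indicator (fun _ => (a : ℂ)))) x‖ := by
  set c : ℂ := Complex.exp (((-(2 * Real.pi * inner ℝ e x) : ℝ) : ℂ) * Complex.I) with hc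
  have hcn : ‖c‖ = 1 := Complex.norm_exp_ofReal_mul_I _
  set F : Esp N → ℂ := fun ξ => S.indicator (fun ξ => (a : ℂ) *
    Complex.exp (((2 * Real.pi * inner ℝ (ξ - e) x : ℝ) : ℂ) * Complex.I)) ξ with hF
  have hcF : c * (𝓕⁻ (S.indicator (fun _ => (a : ℂ)))) x = ∫ ξ, F ξ := by
    rw [Real.fourierInv_eq', ← integral_const_mul]
    congr 1; ext ξ
    by_cases hξ : ξ ∈ S
    · simp only [hF, Set.indicator_of_mem hξ, smul_eq_mul]
      rw [hc, ← mul_assoc, ← Complex.exp_add, mul_comm]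
      congr 2
      rw [inner_sub_left]; push_cast; ring
    · simp [hF, Set.indicator_of_notMem hξ]
  have hFi : Integrable F volume := by
    rw [hF, integrable_indicator_iff hS]
    refine Measure.integrableOn_of_bounded (M := a) hSf (Continuous.aestronglyMeasurable (by fun_prop)) ?_
    refine Eventually.of_forall fun ξ => ?_
    rw [norm_mul, Complex.norm_exp_ofReal_mul_I, mul_one, Complex.norm_real, Real.norm_of_nonneg ha]
  have hre : (∫ ξ, F ξ).re = ∫ ξ, (F ξ).re := (Complex.reCLM.integral_comp_comm hFi).symm
  have hlow : ∫ ξ, S.indicator (fun _ => a / 2) ξ ≤ ∫ ξ, (F ξ).re := by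
    refine integral_mono ((integrable_indicator_iff hS).2 (integrableOn_const hSf)) hFi.re fun ξ => ?_
    by_cases hξ : ξ ∈ S
    · simp only [hF, Set.indicator_of_mem hξ]
      rw [Complex.re_ofReal_mul, Complex.exp_ofReal_mul_I_re]
      have := cos_ge_half (h ξ hξ)
      nlinarith
    · simp [hF, Set.indicator_of_notMem hξ]
  rw [integral_indicator hS, setIntegral_const, smul_eq_mul, Measure.real] at hlow
  calc a * (volume S).toReal / 2 = (volume S).toReal * (a / 2) := by ring
    _ ≤ (∫ ξ, F ξ).re := by rw [hre]; exact hlow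
    _ ≤ ‖∫ ξ, F ξ‖ := Complex.re_le_norm _
    _ = _ := by rw [← hcF, norm_mul, hcn, one_mul]

/-- test functions -/
lemma test {σ : ℝ} (hσ : 0 < σ) {S Q : Set (Esp N)} (hS : MeasurableSet S) (hS0 : volume S ≠ 0)
    (hSf : volume S ≠ ⊤) {ρ : ℝ} (hSb : ∀ ξ ∈ S, ‖ξ‖ ≤ ρ) {δ : ℝ} (hδ : ∀ ξ ∈ S, |wt ξ| ≤ δ) (e : Esp N)
    (hQ : MeasurableSet Q) (h : ∀ ξ ∈ S, ∀ x ∈ Q, |2 * Real.pi * inner ℝ (ξ - e) x| ≤ 1)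
    {m : ℝ} (hm : 0 < m) :
    ∃ U : H2 N, U.massSq = m ∧ Bsq U ≤ δ ^ 2 * m ∧
      (m * (volume S).toReal / 4) ^ (σ + 1) * (volume Q).toReal ≤ U.pPow σ := by
  set V := (volume S).toReal with hV
  have hV0 : 0 < V := ENNReal.toReal_pos hS0 hSf
  set a := Real.sqrt (m / V) with ha
  have ha0 : 0 ≤ a := Real.sqrt_nonneg _
  have ha2 : a ^ 2 = m / V := Real.sq_sqrt (by positivity)
  set g : Esp N → ℂ := S.indicator (fun _ => (a : ℂ)) with hg
  have hgm : Measurable g := measurable_const.indicator hS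
  have hgn : ∀ ξ, ‖g ξ‖ = S.indicator (fun _ => a) ξ := by
    intro ξ
    by_cases hξ : ξ ∈ S
    · simp [hg, hξ, abs_of_nonneg ha0]
    · simp [hg, hξ]
  have hgi : Integrable g volume := (integrable_indicator_iff hS).2 (integrableOn_const hSf)
  have hgl : MemLp g 2 (volume : Measure (Esp N)) := memLp_indicator_const 2 hS _ (Or.inr hSf)
  have hD2 : MemLp (D2 g) 2 (volume : Measure (Esp N)) := by
    refine MemLp.of_le_mul (c := 4 * Real.pi ^ 2 * ρ ^ 2) hgl (D2_meas hgm.aestronglyMeasurable)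
      (Eventually.of_forall fun ξ => ?_)
    rw [norm_D2]
    by_cases hξ : ξ ∈ S
    · have := hSb ξ hξ
      gcongr
    · simp [hg, hξ]
  have hR := rep_mkH2 hgl hD2
  have hsq : ∀ ξ, ‖g ξ‖ ^ 2 = S.indicator (fun _ => a ^ 2) ξ := by
    intro ξ; rw [hgn]
    by_cases hξ : ξ ∈ S <;> simp [hξ]
  have hmass : (mkH2 g hgl hD2).massSq = m := by
    rw [hR.massSq]
    simp only [hsq]
    rw [integral_indicator hS, setIntegral_const, smul_eq_mul, Measure.real, ha2, ← hV]
    field_simp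
  have hgT := T_eq_integral hgi hgl
  refine ⟨mkH2 g hgl hD2, hmass, ?_, ?_⟩
  · rw [hR.Bsq, ← hmass, hR.massSq, ← integral_const_mul]
    refine integral_mono hR.intB (hR.int0.const_mul _) fun ξ => ?_
    by_cases hξ : ξ ∈ S
    · have := hδ ξ hξ
      have h2 : wt ξ ^ 2 ≤ δ ^ 2 := by rw [← sq_abs]; gcongr
      exact mul_le_mul_of_nonneg_right h2 (by positivity)
    · simp [hg, hξ]
  · rw [pPow_eq σ hσ]
    have hfin : ∫⁻ x, ‖(mkH2 g hgl hD2).u x‖ₑ ^ (2 * σ + 2) ≠ ⊤ := by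
      set K := ∫⁻ y, ‖g y‖ₑ with hK
      have hKf : K ≠ ⊤ := hgi.2.ne
      refine ne_top_of_le_ne_top (b := K ^ (2 * σ) * A2 g) (ENNReal.mul_ne_top
        (ENNReal.rpow_ne_top_of_nonneg (by positivity) hKf) (A2_ne_top hgl)) ?_
      have : A2 g = ∫⁻ x, ‖T g x‖ₑ ^ 2 := (T_lintegral hgl).symm
      rw [this, ← lintegral_const_mul' _ _ (ENNReal.rpow_ne_top_of_nonneg (by positivity) hKf)]
      refine lintegral_mono_ae ?_
      filter_upwards [hgT] with x hx
      change ‖T g x‖ₑ ^ (2 * σ + 2) ≤ _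
      rw [ENNReal.rpow_add_of_nonneg _ _ (by positivity) (by norm_num), ENNReal.rpow_two]
      gcongr
      rw [hx]; exact norm_fourierInv_le g x
    have hlow : ENNReal.ofReal ((m * V / 4) ^ (σ + 1)) * volume Q ≤
        ∫⁻ x, ‖(mkH2 g hgl hD2).u x‖ₑ ^ (2 * σ + 2) := by
      rw [← setLIntegral_const]
      refine le_trans ?_ (setLIntegral_le_lintegral Q _)
      refine setLIntegral_mono_ae' hQ ?_
      filter_upwards [hgT] with x hx hxQ
      change _ ≤ ‖T g x‖ₑ ^ (2 * σ + 2)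
      have h1 := four_ind_lower hS hSf ha0 (e := e) (x := x) (fun ξ hξ => h ξ hξ x hxQ)
      rw [hx, ← ofReal_norm, ENNReal.ofReal_rpow_of_nonneg (norm_nonneg _) (by positivity)]
      refine ENNReal.ofReal_le_ofReal ?_
      calc (m * V / 4) ^ (σ + 1) = ((a * V / 2) ^ 2) ^ (σ + 1) := by
            congr 1
            rw [div_pow, mul_pow, ha2]; field_simp; norm_num
        _ = (a * V / 2) ^ (2 * σ + 2) := by
            rw [← Real.rpow_natCast_mul (by positivity)]; congr 1; push_cast; ring
        _ ≤ _ := Real.rpow_le_rpow (by positivity) h1 (by positivity)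
    have := ENNReal.toReal_mono hfin hlow
    rwa [ENNReal.toReal_mul, ENNReal.toReal_ofReal (by positivity)] at this

lemma small_pow {K A p q : ℝ} (hA : 0 < A) (hpq : p < q) :
    ∃ ε : ℝ, 0 < ε ∧ ε < 1 ∧ K * ε ^ q < A * ε ^ p := by
  have h1 : Tendsto (fun ε : ℝ => K * ε ^ (q - p)) (𝓝[>] 0) (𝓝 (K * 0)) := by
    refine Tendsto.const_mul _ ?_
    have := (Real.continuousAt_rpow_const 0 (q - p) (Or.inr (by linarith))).tendsto
    rw [Real.zero_rpow (by linarith)] at this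
    exact this.mono_left nhdsWithin_le_nhds
  rw [mul_zero] at h1
  have h2 := h1.eventually (gt_mem_nhds hA)
  have h3 : ∀ᶠ ε : ℝ in 𝓝[>] 0, ε ∈ Set.Ioo (0:ℝ) 1 := Ioo_mem_nhdsGT (by norm_num)
  obtain ⟨ε, h4, h5⟩ := (h2.and h3).exists
  refine ⟨ε, h5.1, h5.2, ?_⟩
  have e0 := h5.1
  have hp : 0 < ε ^ p := Real.rpow_pos_of_pos e0 p
  calc K * ε ^ q = K * ε ^ (q - p) * ε ^ p := by
        rw [mul_assoc, ← Real.rpow_add e0]; congr 2; ring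
    _ < A * ε ^ p := mul_lt_mul_of_pos_right h4 hp

lemma ann (hN : 1 ≤ N) {σ : ℝ} (hσ : 0 < σ) : ∃ A : ℝ, 0 < A ∧ ∀ m : ℝ, 0 < m → ∀ ε : ℝ, 0 < ε → ε < 1 →
    ∃ U : H2 N, U.massSq = m ∧ Bsq U ≤ 9 * ε ^ 2 * m ∧ A * (m * ε) ^ (σ + 1) ≤ U.pPow σ := by
  have pi0 := Real.pi_pos
  set R : ℝ := 1 / (2 * Real.pi) with hR
  have hR0 : 0 < R := by positivity
  have : Nonempty (Fin N) := ⟨⟨0, hN⟩⟩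
  set v := (volume (Metric.ball (0 : Esp N) 1)).toReal with hv
  have hvf : volume (Metric.ball (0 : Esp N) 1) ≠ ⊤ := measure_ball_lt_top.ne
  have hv0 : 0 < v := ENNReal.toReal_pos (Metric.measure_ball_pos _ _ one_pos).ne' hvf
  set v' := (volume (Metric.ball (0 : Esp N) (1/2))).toReal with hv'
  have hv'0 : 0 < v' := ENNReal.toReal_pos (Metric.measure_ball_pos _ _ (by norm_num)).ne' measure_ball_lt_top.ne
  refine ⟨(R ^ N * v / 4) ^ (σ + 1) * v', by positivity, fun m hm ε e0 e1 => ?_⟩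
  set S : Set (Esp N) := Metric.ball 0 (R * (1 + ε)) \ Metric.ball 0 R with hSd
  have hball : ∀ r : ℝ, 0 < r → (volume (Metric.ball (0 : Esp N) r)).toReal = r ^ N * v := by
    intro r hr
    rw [Measure.addHaar_ball _ _ hr.le, ENNReal.toReal_mul, ENNReal.toReal_ofReal (by positivity),
      finrank_euclideanSpace, Fintype.card_fin]
  have hSm : MeasurableSet S := measurableSet_ball.diff measurableSet_ball
  have hSf : volume S ≠ ⊤ := ne_top_of_le_ne_top (measure_ball_lt_top (x := (0 : Esp N)) (r := R * (1 + ε))).ne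
    (measure_mono Set.sdiff_subset)
  have hSv : R ^ N * v * ε ≤ (volume S).toReal := by
    rw [hSd, measure_sdiff (Metric.ball_subset_ball (by nlinarith)) measurableSet_ball.nullMeasurableSet
      measure_ball_lt_top.ne, ENNReal.toReal_sub_of_le (measure_mono (Metric.ball_subset_ball (by nlinarith)))
      measure_ball_lt_top.ne, hball _ (by positivity), hball _ hR0, mul_pow]
    have : 1 + ε ≤ (1 + ε) ^ N := le_self_pow₀ (by linarith) (by omega)
    have h3 : R ^ N * v * (1 + ε) ≤ R ^ N * v * (1 + ε) ^ N := by gcongr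
    nlinarith
  have hS0 : volume S ≠ 0 := by
    intro h0
    rw [h0, ENNReal.toReal_zero] at hSv
    have : 0 < R ^ N * v * ε := by positivity
    linarith
  have hmem : ∀ ξ ∈ S, R ≤ ‖ξ‖ ∧ ‖ξ‖ ≤ R * (1 + ε) := by
    rintro ξ ⟨h1, h2⟩
    rw [mem_ball_zero_iff] at h1 h2
    exact ⟨not_lt.1 h2, h1.le⟩
  have hRR : 4 * Real.pi ^ 2 * R ^ 2 = 1 := by rw [hR]; field_simp; norm_num
  obtain ⟨U, h1, h2, h3⟩ := test hσ hSm hS0 hSf (ρ := R * (1 + ε)) (fun ξ h => (hmem ξ h).2) (δ := 3 * ε)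
    (fun ξ hξ => by
      obtain ⟨h1, h2⟩ := hmem ξ hξ
      have h3 := pow_le_pow_left₀ hR0.le h1 2
      have h4 := pow_le_pow_left₀ (norm_nonneg _) h2 2
      have h5 : 4 * Real.pi ^ 2 * R ^ 2 ≤ 4 * Real.pi ^ 2 * ‖ξ‖ ^ 2 := by gcongr
      have h6 : 4 * Real.pi ^ 2 * ‖ξ‖ ^ 2 ≤ 4 * Real.pi ^ 2 * (R * (1 + ε)) ^ 2 := by gcongr
      have h7 : 4 * Real.pi ^ 2 * (R * (1 + ε)) ^ 2 = (1 + ε) ^ 2 := by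
        rw [mul_pow, ← mul_assoc, hRR, one_mul]
      rw [wt_eq, abs_le]
      constructor <;> nlinarith) 0 (Q := Metric.ball 0 (1 / 2)) measurableSet_ball
    (fun ξ hξ x hx => by
      obtain ⟨h1, h2⟩ := hmem ξ hξ
      rw [mem_ball_zero_iff] at hx
      rw [sub_zero, abs_mul, abs_of_pos (by positivity : 0 < 2 * Real.pi)]
      have := abs_real_inner_le_norm ξ x
      calc 2 * Real.pi * |inner ℝ ξ x| ≤ 2 * Real.pi * ((R * (1 + ε)) * (1 / 2)) := by
            gcongr
            refine this.trans ?_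
            gcongr
        _ = (1 + ε) / 2 := by rw [hR]; field_simp
        _ ≤ 1 := by linarith) hm
  refine ⟨U, h1, h2.trans_eq (by ring), le_trans ?_ h3⟩
  rw [← hv', mul_right_comm, ← Real.mul_rpow (by positivity) (by positivity)]
  gcongr ?_ ^ _ * _
  calc R ^ N * v / 4 * (m * ε) = m * (R ^ N * v * ε) / 4 := by ring
    _ ≤ _ := by gcongr

lemma knapp (hN : 1 ≤ N) {σ : ℝ} (hσ : 0 < σ) : ∃ A K : ℝ, 0 < A ∧ ∀ m : ℝ, 0 < m → ∀ ε : ℝ, 0 < ε → ε < 1 →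
    ∃ U : H2 N, U.massSq = m ∧ Bsq U ≤ K * ε ^ 4 * m ∧
      A * m ^ (σ + 1) * ε ^ (((N : ℝ) + 1) * σ) ≤ U.pPow σ := by
  have pi0 := Real.pi_pos
  obtain ⟨n, rfl⟩ : ∃ n, N = n + 1 := ⟨N - 1, by omega⟩
  set R : ℝ := 1 / (2 * Real.pi) with hR
  have hR0 : 0 < R := by positivity
  set c : ℝ := 1 / (2 * Real.pi * (n + 1)) with hc
  have hc0 : 0 < c := by positivity
  set K : ℝ := 4 * Real.pi ^ 2 * (2 * R + (n + 1)) with hK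
  refine ⟨(2 ^ (n + 1) / 4) ^ (σ + 1) * (2 * c) ^ (n + 1), K ^ 2, by positivity, fun m hm ε e0 e1 => ?_⟩
  set w : Fin (n + 1) → ℝ := fun i => if i = 0 then ε ^ 2 else ε with hw
  have hw0 : ∀ i, 0 < w i := by intro i; simp only [hw]; split_ifs <;> positivity
  have hwε : ∀ i, w i ≤ ε := by intro i; simp only [hw]; split_ifs <;> nlinarith
  have hwp : ∏ i, w i = ε ^ (n + 2) := by
    rw [Fin.prod_univ_succ]
    simp [hw, Fin.succ_ne_zero]
    ring
  set e : Esp (n + 1) := EuclideanSpace.single 0 R with he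
  have box : ∀ (z : Esp (n + 1)) (d : Fin (n + 1) → ℝ), (∀ i, 0 < d i) →
      MeasurableSet {x : Esp (n + 1) | ∀ i, |x i - z i| ≤ d i} ∧
      volume {x : Esp (n + 1) | ∀ i, |x i - z i| ≤ d i} = ENNReal.ofReal (∏ i, (2 * d i)) := by
    intro z d hd
    have hset : {x : Esp (n + 1) | ∀ i, |x i - z i| ≤ d i} =
        WithLp.ofLp ⁻¹' (Set.Icc (fun i => z i - d i) (fun i => z i + d i)) := by
      ext x
      simp only [Set.mem_ofPred_eq, Set.mem_preimage, Set.mem_Icc, Pi.le_def, ← forall_and]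
      refine forall_congr' fun i => ?_
      rw [abs_le]
      constructor
      · rintro ⟨h1, h2⟩; constructor <;> linarith
      · rintro ⟨h1, h2⟩; constructor <;> linarith
    rw [hset]
    refine ⟨(PiLp.volume_preserving_ofLp (Fin (n + 1))).measurable measurableSet_Icc, ?_⟩
    rw [(PiLp.volume_preserving_ofLp (Fin (n + 1))).measure_preimage measurableSet_Icc.nullMeasurableSet,
      Real.volume_Icc_pi, ENNReal.ofReal_prod_of_nonneg (fun i _ => by have := hd i; positivity)]
    congr 1; ext i; congr 1; ring
  obtain ⟨hSm, hSv⟩ := box e w hw0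
  obtain ⟨hQm, hQv⟩ := box 0 (fun i => c / w i) (fun i => div_pos hc0 (hw0 i))
  set S := {x : Esp (n + 1) | ∀ i, |x i - e i| ≤ w i} with hSd
  set Q := {x : Esp (n + 1) | ∀ i, |x i - (0 : Esp (n + 1)) i| ≤ c / w i} with hQd
  have hSv' : (volume S).toReal = 2 ^ (n + 1) * ε ^ (n + 2) := by
    rw [hSv, Finset.prod_mul_distrib, hwp, ENNReal.toReal_ofReal (by positivity)]
    simp
  have hQv' : (volume Q).toReal = (2 * c) ^ (n + 1) / ε ^ (n + 2) := by
    rw [hQv, ← hwp, ENNReal.toReal_ofReal (Finset.prod_nonneg fun i _ => by have := hw0 i; positivity)]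
    rw [Finset.prod_mul_distrib, Finset.prod_div_distrib]
    simp [mul_pow]
    ring
  have hnsq : ∀ ξ ∈ S, |‖ξ‖ ^ 2 - R ^ 2| ≤ (2 * R + (n + 1)) * ε ^ 2 := by
    intro ξ hξ
    have h0 := hξ 0
    have hs : ∀ i : Fin n, (ξ i.succ) ^ 2 ≤ ε ^ 2 := by
      intro i
      have := hξ i.succ
      simp [he, hw, Fin.succ_ne_zero] at this
      rw [← sq_abs]; gcongr
    simp [he, hw] at h0
    rw [EuclideanSpace.norm_sq_eq, Fin.sum_univ_succ]
    simp only [Real.norm_eq_abs, sq_abs]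
    have h1 : ∑ i : Fin n, ξ i.succ ^ 2 ≤ n * ε ^ 2 := by
      refine (Finset.sum_le_card_nsmul _ _ _ fun i _ => hs i).trans_eq ?_
      simp
    have h2 : 0 ≤ ∑ i : Fin n, ξ i.succ ^ 2 := Finset.sum_nonneg fun i _ => sq_nonneg _
    have e2 : ε ^ 2 ≤ 1 := by nlinarith
    have e20 : 0 < ε ^ 2 := by positivity
    rw [abs_le] at h0 ⊢
    obtain ⟨h3, h4⟩ := h0
    have h5 : ξ 0 ^ 2 - R ^ 2 = 2 * R * (ξ 0 - R) + (ξ 0 - R) ^ 2 := by ring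
    have h6 : (ξ 0 - R) ^ 2 ≤ ε ^ 2 := by nlinarith
    constructor <;> nlinarith [mul_le_mul_of_nonneg_left h4 hR0.le, mul_le_mul_of_nonneg_left h3 hR0.le, sq_nonneg (ξ 0 - R)]
  have hRR : 4 * Real.pi ^ 2 * R ^ 2 = 1 := by rw [hR]; field_simp; norm_num
  have hSp : 0 < (volume S).toReal := by rw [hSv']; positivity
  obtain ⟨U, h1, h2, h3⟩ := test hσ hSm (fun h => by rw [h] at hSp; simp at hSp) (by rw [hSv]; simp)
    (ρ := R + (2 * R + (n + 1)) + 1) (fun ξ hξ => by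
      have := (abs_le.1 (hnsq ξ hξ)).2
      have e2 : ε ^ 2 ≤ 1 := by nlinarith
      have h3 : (2 * R + (n + 1)) * ε ^ 2 ≤ (2 * R + (n + 1)) * 1 := by gcongr
      refine (pow_le_pow_iff_left₀ (norm_nonneg _) (by positivity) two_ne_zero).1 ?_
      nlinarith [norm_nonneg ξ])
    (δ := K * ε ^ 2) (fun ξ hξ => by
      have := hnsq ξ hξ
      have e3 : wt ξ = 4 * Real.pi ^ 2 * (‖ξ‖ ^ 2 - R ^ 2) := by rw [wt_eq]; linear_combination hRR
      rw [e3, abs_mul, abs_of_pos (by positivity : 0 < 4 * Real.pi ^ 2), hK, mul_assoc (4 * Real.pi ^ 2)]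
      gcongr) e hQm
    (fun ξ hξ x hx => by
      rw [abs_mul, abs_of_pos (by positivity : 0 < 2 * Real.pi)]
      have h4 : |inner ℝ (ξ - e) x| ≤ (n + 1) * c := by
        rw [PiLp.inner_apply]
        refine (Finset.abs_sum_le_sum_abs _ _).trans ?_
        refine (Finset.sum_le_card_nsmul _ _ c fun i _ => ?_).trans_eq (by simp)
        have ha := hξ i
        have hb := hx i
        simp only [PiLp.zero_apply, sub_zero] at hb
        rw [RCLike.inner_apply, abs_mul]
        simp only [conj_trivial, PiLp.sub_apply]
        calc |x i| * |ξ i - e i| ≤ c / w i * w i := by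
              have := hw0 i
              gcongr
          _ = c := div_mul_cancel₀ _ (hw0 i).ne'
      calc 2 * Real.pi * |inner ℝ (ξ - e) x| ≤ 2 * Real.pi * ((n + 1) * c) := by gcongr
        _ = 1 := by rw [hc]; field_simp) hm
  refine ⟨U, h1, h2.trans_eq (by ring), le_trans (le_of_eq ?_) h3⟩
  rw [hSv', hQv']
  have e4 : m * (2 ^ (n + 1) * ε ^ (n + 2)) / 4 = (2 ^ (n + 1) / 4) * m * ε ^ (n + 2) := by ring
  rw [e4, Real.mul_rpow (by positivity) (by positivity), Real.mul_rpow (by positivity) (by positivity)]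
  have e5 : (ε ^ (n + 2)) ^ (σ + 1) = ε ^ (((n + 1 : ℕ) + 1 : ℝ) * σ) * ε ^ (n + 2) := by
    rw [Real.rpow_add_one (by positivity), ← Real.rpow_natCast_mul e0.le]
    push_cast; congr 2; ring
  rw [e5]
  field_simp

end SW
end P15

section P16
open scoped FourierTransform SchwartzMap ENNReal
open LineDeriv
namespace SW
variable {N : ℕ}

lemma Emin_le {σ m : ℝ} (U : H2 N) (h : U.massSq = m) : EminE N σ m ≤ ((U.energy σ : ℝ) : EReal) :=
  iInf₂_le U h

lemma Emin_lt {σ m : ℝ} (U : H2 N) (h : U.massSq = m) (h2 : Bsq U < 1 / (σ + 1) * U.pPow σ) :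
    EminE N σ m < ((-m : ℝ) : EReal) := by
  refine (Emin_le U h).trans_lt ?_
  rw [energy_eq, h]
  exact_mod_cast (by linarith)

lemma part1 (hN : 1 ≤ N) {σ : ℝ} (hσ : 0 < σ) (h : σ < max 1 (4 / ((N : ℝ) + 1))) {m : ℝ} (hm : 0 < m) :
    ∃ U : H2 N, U.massSq = m ∧ Bsq U < 1 / (σ + 1) * U.pPow σ := by
  rcases lt_max_iff.1 h with h | h
  · obtain ⟨A, hA, hU⟩ := ann hN hσ
    obtain ⟨ε, e0, e1, he⟩ := small_pow (K := 9 * m) (A := 1 / (σ + 1) * (A * m ^ (σ + 1))) (p := σ + 1) (q := 2)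
      (by positivity) (by linarith)
    obtain ⟨U, h1, h2, h3⟩ := hU m hm ε e0 e1
    refine ⟨U, h1, h2.trans_lt ?_⟩
    rw [Real.rpow_two] at he
    calc 9 * ε ^ 2 * m = 9 * m * ε ^ 2 := by ring
      _ < _ := he
      _ = 1 / (σ + 1) * (A * (m * ε) ^ (σ + 1)) := by
        rw [Real.mul_rpow hm.le e0.le]; ring
      _ ≤ _ := by gcongr
  · obtain ⟨A, K, hA, hU⟩ := knapp hN hσ
    have hN1 : (0:ℝ) < (N : ℝ) + 1 := by positivity
    obtain ⟨ε, e0, e1, he⟩ := small_pow (K := K * m) (A := 1 / (σ + 1) * (A * m ^ (σ + 1)))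
      (p := ((N : ℝ) + 1) * σ) (q := 4)
      (by positivity) (by rw [lt_div_iff₀ hN1] at h; linarith)
    obtain ⟨U, h1, h2, h3⟩ := hU m hm ε e0 e1
    refine ⟨U, h1, h2.trans_lt ?_⟩
    have e4 : ε ^ (4 : ℝ) = ε ^ 4 := by exact_mod_cast Real.rpow_natCast ε 4
    rw [e4] at he
    calc K * ε ^ 4 * m = K * m * ε ^ 4 := by ring
      _ < _ := he
      _ = 1 / (σ + 1) * (A * m ^ (σ + 1) * ε ^ (((N : ℝ) + 1) * σ)) := by ring
      _ ≤ _ := by gcongr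

/-- The quotient. -/
def qM (σ : ℝ) (U : H2 N) : ℝ := rLp (2 * σ + 2) U.u /
      (rLp 2 U.u ^ (σ / (σ + 1)) *
        rLp 2 (fun x => U.lapl x + U.u x) ^ (1 - σ / (σ + 1)))

def Mset (N : ℕ) (σ : ℝ) : Set ℝ := {r : ℝ | ∃ U : H2 N, U.Nontriv ∧ r = qM σ U}

lemma Mconst_eq (σ : ℝ) : Mconst N σ = sSup (Mset N σ) := rfl

lemma qM_nonneg (σ : ℝ) (U : H2 N) : 0 ≤ qM σ U := by
  unfold qM rLp; positivity

lemma qM_pow {σ : ℝ} (hσ : 0 < σ) (U : H2 N) :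
    qM σ U ^ (2 * σ + 2) = U.pPow σ / (U.massSq ^ σ * Bsq U) := by
  have h1 := massSq_nonneg U
  have h2 := Bsq_nonneg U
  have h3 := pPow_nonneg σ U
  have e1 : rLp 2 U.u = Real.sqrt U.massSq := rLp_two U.u_mem.1
  have e2 : rLp 2 (fun x => U.lapl x + U.u x) = Real.sqrt (Bsq U) :=
    rLp_two (U.lapl_mem.1.add U.u_mem.1)
  unfold qM
  rw [rLp_pow σ hσ, e1, e2, Real.sqrt_eq_rpow, Real.sqrt_eq_rpow, Real.div_rpow (by positivity) (by positivity),
    Real.mul_rpow (by positivity) (by positivity), ← Real.rpow_mul h3, ← Real.rpow_mul h1,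
    ← Real.rpow_mul h2, ← Real.rpow_mul h1, ← Real.rpow_mul h2]
  rw [show 1 / (2 * σ + 2) * (2 * σ + 2) = 1 by field_simp,
    show 1 / 2 * (σ / (σ + 1)) * (2 * σ + 2) = σ by field_simp,
    show 1 / 2 * (1 - σ / (σ + 1)) * (2 * σ + 2) = 1 by field_simp; ring, Real.rpow_one, Real.rpow_one]

lemma Bsq_pos {U : H2 N} (h : U.Nontriv) : 0 < Bsq U := by
  refine lt_of_le_of_ne (Bsq_nonneg U) fun h0 => ?_
  obtain ⟨g, hg⟩ := exists_rep U
  rw [hg.Bsq] at h0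
  have h1 := (integral_eq_zero_iff_of_nonneg (fun x => by positivity) hg.intB).1 h0.symm
  have h2 : ∀ᵐ x : Esp N, wt x ≠ 0 := by
    rw [ae_iff]
    refine measure_mono_null ?_ (Measure.addHaar_sphere_of_ne_zero volume (0 : Esp N)
      (r := 1 / (2 * Real.pi)) (by have := Real.pi_pos; positivity))
    intro x hx
    simp only [ne_eq, not_not, Set.mem_ofPred_eq] at hx
    have pi0 := Real.pi_pos
    rw [mem_sphere_zero_iff_norm]
    refine (pow_left_inj₀ (norm_nonneg _) (by positivity) two_ne_zero).1 ?_
    rw [wt_eq] at hx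
    field_simp
    linarith
  have h3 : U.massSq = 0 := by
    rw [hg.massSq]
    refine integral_eq_zero_of_ae ?_
    filter_upwards [h1, h2] with x h1 h2
    simp only [Pi.zero_apply, mul_eq_zero] at h1 ⊢
    rcases h1 with h1 | h1
    · exact absurd (pow_eq_zero_iff two_ne_zero |>.1 h1) h2
    · exact h1
  rw [nontriv_iff] at h
  linarith

lemma scale_to {σ m : ℝ} (hm : 0 < m) {U : H2 N} (hU : 0 < U.massSq) :
    ∃ V : H2 N, V.massSq = m ∧ Bsq V = (m / U.massSq) * Bsq U ∧
      V.pPow σ = (m / U.massSq) ^ σ * (m / U.massSq) * U.pPow σ := by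
  set k := m / U.massSq with hk
  have hk0 : 0 < k := by positivity
  have hn : ‖((Real.sqrt k : ℝ) : ℂ)‖ = Real.sqrt k := by
    rw [Complex.norm_real, Real.norm_of_nonneg (Real.sqrt_nonneg _)]
  refine ⟨smulH ((Real.sqrt k : ℝ) : ℂ) U, ?_, ?_, ?_⟩
  · rw [smulH_mass, hn, Real.sq_sqrt hk0.le, hk]; field_simp
  · rw [smulH_B, hn, Real.sq_sqrt hk0.le]
  · rw [smulH_p, hn, Real.sqrt_eq_rpow, ← Real.rpow_mul hk0.le, ← Real.rpow_add_one hk0.ne']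
    congr 2; ring

lemma Mpos (hN : 1 ≤ N) {σ : ℝ} (hσ : 0 < σ) (hb : BddAbove (Mset N σ)) : 0 < Mconst N σ := by
  obtain ⟨A, hA, hU⟩ := ann hN hσ
  obtain ⟨U, h1, h2, h3⟩ := hU 1 one_pos (1 / 2) (by norm_num) (by norm_num)
  have hp : 0 < U.pPow σ := lt_of_lt_of_le (by positivity) h3
  have hnt : U.Nontriv := by rw [nontriv_iff, h1]; exact one_pos
  have hB := Bsq_pos hnt
  have hq : 0 < qM σ U := by
    refine lt_of_le_of_ne (qM_nonneg σ U) fun h0 => ?_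
    have := qM_pow hσ U
    rw [← h0, Real.zero_rpow (by positivity), h1] at this
    have h5 : 0 < U.pPow σ / (1 ^ σ * Bsq U) := by positivity
    linarith
  exact hq.trans_le (le_csSup hb ⟨U, hnt, rfl⟩)

lemma M_bound {σ : ℝ} (hσ : 0 < σ) (hb : BddAbove (Mset N σ)) {U : H2 N} (hU : U.Nontriv) :
    U.pPow σ ≤ Mconst N σ ^ (2 * σ + 2) * (U.massSq ^ σ * Bsq U) := by
  have h1 := le_csSup hb ⟨U, hU, rfl⟩
  have h2 := Real.rpow_le_rpow (qM_nonneg σ U) h1 (z := 2 * σ + 2) (by positivity)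
  rw [qM_pow hσ] at h2
  have hm := (nontriv_iff U).1 hU
  have hB := Bsq_pos hU
  rwa [div_le_iff₀ (by positivity)] at h2

lemma m0_pow {σ M : ℝ} (hσ : 0 < σ) (hM : 0 < M) :
    ((σ + 1) ^ (1 / σ) * M ^ (-((2 * σ + 2) / σ))) ^ σ = (σ + 1) / M ^ (2 * σ + 2) := by
  rw [Real.mul_rpow (by positivity) (by positivity), ← Real.rpow_mul (by positivity), ← Real.rpow_mul hM.le,
    show 1 / σ * σ = 1 by field_simp, show -((2 * σ + 2) / σ) * σ = -(2 * σ + 2) by field_simp,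
    Real.rpow_one, Real.rpow_neg hM.le]
  rfl

lemma part2 (hN : 1 ≤ N) {σ : ℝ} (hσ : 0 < σ) (hb : BddAbove (Mset N σ)) :
    0 < m0c N σ ∧
      (∀ m : ℝ, 0 < m → m ≤ m0c N σ → EminE N σ m = ((-m : ℝ) : EReal)) ∧
      (∀ m : ℝ, m0c N σ < m → EminE N σ m < ((-m : ℝ) : EReal)) := by
  have hM := Mpos hN hσ hb
  have hm0 : 0 < m0c N σ := by unfold m0c; positivity
  have hpow : m0c N σ ^ σ = (σ + 1) / Mconst N σ ^ (2 * σ + 2) := m0_pow hσ hM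
  have hMp : 0 < Mconst N σ ^ (2 * σ + 2) := by positivity
  refine ⟨hm0, fun m hm hle => le_antisymm ?_ ?_, fun m hlt => ?_⟩
  · obtain ⟨A, hA, hU⟩ := ann hN hσ
    by_contra hc
    rw [not_le, EReal.lt_iff_exists_real_btwn] at hc
    obtain ⟨c, h1, h2⟩ := hc
    have h1' : -m < c := by exact_mod_cast h1
    obtain ⟨ε, e0, e1, he⟩ := small_pow (K := 9 * m) (A := c + m) (p := 0) (q := 2) (by linarith) (by norm_num)
    rw [Real.rpow_zero, mul_one, Real.rpow_two] at he
    obtain ⟨U, h3, h4, h5⟩ := hU m hm ε e0 e1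
    have h6 := h2.trans_le (Emin_le (σ := σ) U h3)
    rw [energy_eq, h3] at h6
    have h7 : c < Bsq U - 1 / (σ + 1) * U.pPow σ - m := by exact_mod_cast h6
    have h8 : 0 ≤ 1 / (σ + 1) * U.pPow σ := mul_nonneg (by positivity) (pPow_nonneg σ U)
    linarith
  · refine le_iInf₂ fun U hU => ?_
    have hnt : U.Nontriv := by rw [nontriv_iff, hU]; exact hm
    have h1 := M_bound hσ hb hnt
    have h2 : m ^ σ ≤ (σ + 1) / Mconst N σ ^ (2 * σ + 2) := by
      rw [← hpow]; exact Real.rpow_le_rpow hm.le hle hσ.le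
    rw [le_div_iff₀ hMp] at h2
    rw [energy_eq, hU] at *
    have hB := Bsq_nonneg U
    have h3 : U.pPow σ ≤ (σ + 1) * Bsq U := by
      calc _ ≤ _ := h1
        _ = (m ^ σ * Mconst N σ ^ (2 * σ + 2)) * Bsq U := by ring
        _ ≤ _ := by gcongr
    have h4 : 1 / (σ + 1) * U.pPow σ ≤ Bsq U := by
      rw [one_div_mul_eq_div, div_le_iff₀ (by positivity)]; linarith
    exact_mod_cast (by linarith)
  · have hm : 0 < m := hm0.trans hlt
    have h2 : (σ + 1) / Mconst N σ ^ (2 * σ + 2) < m ^ σ := by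
      rw [← hpow]; exact Real.rpow_lt_rpow hm0.le hlt hσ
    have hmσ : 0 < m ^ σ := by positivity
    have h3 : ((σ + 1) / m ^ σ) ^ (2 * σ + 2)⁻¹ < Mconst N σ := by
      rw [Real.rpow_inv_lt_iff_of_pos (by positivity) hM.le (by positivity)]
      rw [div_lt_iff₀ hMp] at h2
      rw [div_lt_iff₀ hmσ]; linarith
    have hne : (Mset N σ).Nonempty := by
      by_contra hc
      rw [Set.not_nonempty_iff_eq_empty] at hc
      rw [Mconst_eq, hc, Real.sSup_empty] at hM
      exact lt_irrefl _ hM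
    obtain ⟨r, ⟨U, hU, rfl⟩, hr⟩ := exists_lt_of_lt_csSup hne h3
    rw [Real.rpow_inv_lt_iff_of_pos (by positivity) (qM_nonneg σ U) (by positivity), qM_pow hσ] at hr
    have hmU := (nontriv_iff U).1 hU
    have hB := Bsq_pos hU
    obtain ⟨V, hV1, hV2, hV3⟩ := scale_to (σ := σ) hm hmU
    refine Emin_lt V hV1 ?_
    rw [hV2, hV3, one_div_mul_eq_div, lt_div_iff₀ (by positivity), Real.div_rpow hm.le hmU.le]
    rw [div_lt_div_iff₀ hmσ (by positivity)] at hr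
    have hUσ : 0 < U.massSq ^ σ := by positivity
    have h9 : Bsq U * (σ + 1) < m ^ σ / U.massSq ^ σ * U.pPow σ := by
      rw [div_mul_eq_mul_div, lt_div_iff₀ hUσ]; linarith
    have hk : 0 < m / U.massSq := by positivity
    nlinarith [mul_lt_mul_of_pos_left h9 hk]

lemma Mset_bdd_of_good {σ : ℝ} (hσ : 0 < σ) (h : Good σ (Set.univ : Set (Esp N))) : BddAbove (Mset N σ) := by
  obtain ⟨C, hC, h⟩ := h
  refine ⟨C ^ (2 * σ + 2)⁻¹, ?_⟩
  rintro r ⟨U, hU, rfl⟩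
  rw [Real.le_rpow_inv_iff_of_pos (qM_nonneg σ U) hC.le (by positivity), qM_pow hσ]
  have hm := (nontriv_iff U).1 hU
  have hB := Bsq_pos hU
  obtain ⟨g, hgm, hg⟩ := exists_rep' U
  have h1 := h g hgm hg.mem (fun ξ hξ => absurd (Set.mem_univ ξ) hξ)
  have hA2 : A2 g = ENNReal.ofReal U.massSq := by
    rw [hg.massSq, integral_sq_eq hg.mem.1]
    exact (ENNReal.ofReal_toReal (A2_ne_top hg.mem)).symm
  have hB2 : B2 g = ENNReal.ofReal (Bsq U) := by
    rw [hg.Bsq, ofReal_integral_eq_lintegral_ofReal hg.intB (Eventually.of_forall fun x => by positivity)]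
    unfold B2
    congr 1; ext x
    rw [ENNReal.ofReal_mul (sq_nonneg _), ENNReal.ofReal_pow (norm_nonneg _), ofReal_norm]
  rw [hA2, hB2, ENNReal.ofReal_rpow_of_pos hm, ← ENNReal.ofReal_mul (by positivity),
    ← ENNReal.ofReal_mul hC.le] at h1
  rw [div_le_iff₀ (by positivity), pPow_eq σ hσ]
  refine ENNReal.toReal_le_of_le_ofReal (by positivity) (le_of_eq_of_le ?_ h1)
  refine lintegral_congr_ae ?_
  filter_upwards [hg.eq] with x hx
  rw [hx]

end SW
end P16

section P17
open scoped FourierTransform SchwartzMap ENNReal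
open LineDeriv
namespace SW
variable {N : ℕ}

lemma lint_wt {f : Esp N → ℝ} (hf : ∀ x, 0 ≤ f x) {g : Esp N → ℂ}
    (hi : Integrable (fun x => f x * ‖g x‖ ^ 2) volume) :
    ∫⁻ x, ENNReal.ofReal (f x) * ‖g x‖ₑ ^ 2 = ENNReal.ofReal (∫ x, f x * ‖g x‖ ^ 2) := by
  rw [ofReal_integral_eq_lintegral_ofReal hi (Eventually.of_forall fun x => mul_nonneg (hf x) (sq_nonneg _))]
  congr 1; ext x
  rw [ENNReal.ofReal_mul (hf x), ENNReal.ofReal_pow (norm_nonneg _), ofReal_norm]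

lemma gn1' (hN : 1 ≤ N) : ∃ C : ℝ, 0 < C ∧ ∀ U : H2 N, 0 < U.massSq →
    U.pPow (4 / (N : ℝ)) ≤ C * (U.massSq ^ (4 / (N : ℝ)) * U.lapSq) := by
  have hN0 : (0 : ℝ) < N := by exact_mod_cast hN
  obtain ⟨C, hC, h⟩ := gn1 N hN
  refine ⟨C, hC, fun U hU => ?_⟩
  obtain ⟨g, hgm, hg⟩ := exists_rep' U
  have h1 := h g hgm hg.mem
  have hA2 : ∫⁻ ξ, ‖g ξ‖ₑ ^ 2 = ENNReal.ofReal U.massSq := by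
    rw [hg.massSq, integral_sq_eq hg.mem.1]
    exact (ENNReal.ofReal_toReal (A2_ne_top hg.mem)).symm
  have hL := lapSq_nonneg U
  rw [hA2, lint_wt (fun x => by positivity) hg.int2, ← hg.lapSq, ENNReal.ofReal_rpow_of_pos hU,
    ← ENNReal.ofReal_mul (by positivity), ← ENNReal.ofReal_mul hC.le] at h1
  rw [pPow_eq _ (by positivity)]
  refine ENNReal.toReal_le_of_le_ofReal (by positivity) (le_of_eq_of_le ?_ h1)
  refine lintegral_congr_ae ?_
  filter_upwards [hg.eq] with x hx
  rw [hx]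

lemma gn2' (hN : 1 ≤ N) (hN4 : N ≤ 4) : ∃ C : ℝ, 0 < C ∧ ∀ U : H2 N, 0 < U.massSq →
    U.pPow (4 / (N : ℝ)) ≤ C * (U.massSq ^ (4 / (N : ℝ)) * (U.gradSq ^ 2 / U.massSq)) := by
  have hN0 : (0 : ℝ) < N := by exact_mod_cast hN
  obtain ⟨C, hC, h⟩ := gn2 N hN hN4
  refine ⟨C, hC, fun U hU => ?_⟩
  obtain ⟨g, hgm, hg⟩ := exists_rep' U
  have hA2 : ∫⁻ ξ, ‖g ξ‖ₑ ^ 2 = ENNReal.ofReal U.massSq := by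
    rw [hg.massSq, integral_sq_eq hg.mem.1]
    exact (ENNReal.ofReal_toReal (A2_ne_top hg.mem)).symm
  have hG := gradSq_nonneg U
  have hG2 : ∫⁻ ξ, ENNReal.ofReal (4 * Real.pi ^ 2 * ‖ξ‖ ^ 2) * ‖g ξ‖ₑ ^ 2 = ENNReal.ofReal U.gradSq := by
    rw [lint_wt (fun x => by positivity) hg.int1, ← hg.gradSq]
  have h1 := h g hgm hg.mem (by rw [hG2]; simp)
  rw [hA2, hG2, ENNReal.ofReal_rpow_of_pos hU, ← ENNReal.ofReal_pow hG,
    ← ENNReal.ofReal_mul (by positivity), ← ENNReal.ofReal_mul hC.le] at h1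
  rw [pPow_eq _ (by positivity)]
  refine (ENNReal.toReal_le_of_le_ofReal (by positivity) (le_of_eq_of_le ?_ h1)).trans_eq ?_
  · refine lintegral_congr_ae ?_
    filter_upwards [hg.eq] with x hx
    rw [hx]
  · rw [Real.rpow_sub_one hU.ne']; ring

def qG (σ : ℝ) (U : H2 N) : ℝ := U.pPow σ /
      (rLp 2 U.lapl ^ ((N : ℝ) * σ / 2) * rLp 2 U.u ^ (2 + 2 * σ - (N : ℝ) * σ / 2))

def Gset (N : ℕ) (σ : ℝ) : Set ℝ := {r : ℝ | ∃ U : H2 N, U.Nontriv ∧ r = qG σ U}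

lemma GN_eq (σ : ℝ) : GNconst N σ = sSup (Gset N σ) := rfl

lemma qG_eq (hN : 1 ≤ N) (U : H2 N) :
    qG (4 / (N : ℝ)) U = U.pPow (4 / (N : ℝ)) / (U.lapSq * U.massSq ^ (4 / (N : ℝ))) := by
  have hN0 : (0 : ℝ) < N := by exact_mod_cast hN
  have e1 : rLp 2 U.u = Real.sqrt U.massSq := rLp_two U.u_mem.1
  have e2 : rLp 2 U.lapl = Real.sqrt U.lapSq := rLp_two U.lapl_mem.1
  have h1 := massSq_nonneg U
  have h2 := lapSq_nonneg U
  unfold qG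
  rw [e1, e2, show (N : ℝ) * (4 / (N : ℝ)) / 2 = 2 by field_simp; norm_num,
    show 2 + 2 * (4 / (N : ℝ)) - 2 = 2 * (4 / (N : ℝ)) by ring, Real.rpow_two, Real.sq_sqrt h2,
    Real.sqrt_eq_rpow, ← Real.rpow_mul h1]
  congr 3; ring

lemma Gbdd_le (hN : 1 ≤ N) {C : ℝ} (hC : 0 ≤ C) (h : ∀ U : H2 N, 0 < U.massSq →
    U.pPow (4 / (N : ℝ)) ≤ C * (U.massSq ^ (4 / (N : ℝ)) * U.lapSq)) :
    ∀ r ∈ Gset N (4 / (N : ℝ)), r ≤ C := by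
  rintro r ⟨U, hU, rfl⟩
  have hm := (nontriv_iff U).1 hU
  rw [qG_eq hN]
  rcases (lapSq_nonneg U).eq_or_lt with h0 | h0
  · rw [← h0]; simpa using hC
  · rw [div_le_iff₀ (by positivity)]
    refine (h U hm).trans_eq (by ring)

lemma G_bound (hN : 1 ≤ N) {U : H2 N} (hm : 0 < U.massSq) :
    U.pPow (4 / (N : ℝ)) ≤ GNconst N (4 / (N : ℝ)) * (U.massSq ^ (4 / (N : ℝ)) * U.lapSq) := by
  obtain ⟨C, hC, h⟩ := gn1' hN
  have hb : BddAbove (Gset N (4 / (N : ℝ))) := ⟨C, Gbdd_le hN hC.le h⟩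
  have h1 := le_csSup hb ⟨U, (nontriv_iff U).2 hm, rfl⟩
  rw [qG_eq hN, ← GN_eq] at h1
  rcases (lapSq_nonneg U).eq_or_lt with h0 | h0
  · have := h U hm
    rw [← h0] at this ⊢
    simpa using this
  · rw [div_le_iff₀ (by positivity)] at h1
    refine h1.trans_eq (by ring)

lemma Gpos (hN : 1 ≤ N) : 0 < GNconst N (4 / (N : ℝ)) := by
  have hN0 : (0 : ℝ) < N := by exact_mod_cast hN
  have hσ : (0:ℝ) < 4 / (N : ℝ) := by positivity
  obtain ⟨A, hA, hU⟩ := ann hN hσ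
  obtain ⟨U, h1, h2, h3⟩ := hU 1 one_pos (1 / 2) (by norm_num) (by norm_num)
  have hp : 0 < U.pPow (4 / (N : ℝ)) := lt_of_lt_of_le (by positivity) h3
  have hm : 0 < U.massSq := by rw [h1]; exact one_pos
  have h4 := G_bound hN hm
  have hx : 0 ≤ U.massSq ^ (4 / (N : ℝ)) * U.lapSq := mul_nonneg (by positivity) (lapSq_nonneg U)
  by_contra hc
  push Not at hc
  nlinarith [mul_nonneg (neg_nonneg.2 hc) hx]

lemma kstar_pow {σ G : ℝ} (hσ : 0 < σ) (hG : 0 < G) :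
    ((σ + 1) ^ (1 / σ) * G ^ (-(1 / σ))) ^ σ = (σ + 1) / G := by
  rw [Real.mul_rpow (by positivity) (by positivity), ← Real.rpow_mul (by positivity), ← Real.rpow_mul hG.le,
    show 1 / σ * σ = 1 by field_simp, show -(1 / σ) * σ = -1 by field_simp,
    Real.rpow_one, Real.rpow_neg_one]
  rfl

lemma kstar_pos (hN : 1 ≤ N) : 0 < kstar N (4 / (N : ℝ)) := by
  have hN0 : (0 : ℝ) < N := by exact_mod_cast hN
  have := Gpos hN
  unfold kstar; positivity

lemma below (hN : 1 ≤ N) {m : ℝ} (hm : 0 < m) (hk : m < kstar N (4 / (N : ℝ))) :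
    ⊥ < EminE N (4 / (N : ℝ)) m := by
  have hN0 : (0 : ℝ) < N := by exact_mod_cast hN
  have hσ : (0:ℝ) < 4 / (N : ℝ) := by positivity
  have hG := Gpos hN
  have hkp : kstar N (4 / (N : ℝ)) ^ (4 / (N : ℝ)) = _ := kstar_pow hσ hG
  have h1 : m ^ (4 / (N : ℝ)) < (4 / (N : ℝ) + 1) / GNconst N (4 / (N : ℝ)) := by
    rw [← hkp]; exact Real.rpow_lt_rpow hm.le hk hσ
  rw [lt_div_iff₀ hG] at h1
  set σ : ℝ := 4 / (N : ℝ) with hσd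
  set θ : ℝ := 1 - m ^ σ * GNconst N σ / (σ + 1) with hθ
  have hθ0 : 0 < θ := by
    rw [hθ, sub_pos, div_lt_one (by positivity)]; exact h1
  refine lt_of_lt_of_le (EReal.bot_lt_coe (-(m / θ))) (le_iInf₂ fun U hU => ?_)
  have h2 := G_bound hN (U := U) (by rw [hU]; exact hm)
  have h3 := grad_cs U
  have hg := gradSq_nonneg U
  have hL := lapSq_nonneg U
  rw [hU] at h3
  rw [hU, ← hσd] at h2
  have h4 : 1 / (σ + 1) * U.pPow σ ≤ (1 - θ) * U.lapSq := by
    calc 1 / (σ + 1) * U.pPow σ ≤ 1 / (σ + 1) * (GNconst N σ * (m ^ σ * U.lapSq)) := by gcongr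
      _ = _ := by rw [hθ]; ring
  have h5 : 2 * U.gradSq ≤ θ * U.lapSq + m / θ := by
    refine abs_le_of_sq_le_sq' ?_ (by positivity) |>.2
    have h6 : θ * U.lapSq * (m / θ) = U.lapSq * m := by field_simp
    nlinarith [sq_nonneg (θ * U.lapSq - m / θ)]
  have h7 : -(m / θ) ≤ U.energy σ := by
    unfold H2.energy; linarith
  exact_mod_cast h7

lemma M_dil (hN : 1 ≤ N) (hb : BddAbove (Mset N (4 / (N : ℝ)))) {U : H2 N} (hm : 0 < U.massSq)
    (hg : 0 < U.gradSq) : U.pPow (4 / (N : ℝ)) ≤ Mconst N (4 / (N : ℝ)) ^ (2 * (4 / (N : ℝ)) + 2) *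
      (U.massSq ^ (4 / (N : ℝ)) * (U.lapSq - U.gradSq ^ 2 / U.massSq)) := by
  have hN0 : (0 : ℝ) < N := by exact_mod_cast hN
  have hσ : (0:ℝ) < 4 / (N : ℝ) := by positivity
  set t : ℝ := Real.sqrt (U.massSq / U.gradSq) with ht
  have ht0 : 0 < t := Real.sqrt_pos.2 (by positivity)
  have ht2 : t ^ 2 = U.massSq / U.gradSq := Real.sq_sqrt (by positivity)
  have hdm : (dil t ht0 U).massSq = (t ^ N)⁻¹ * U.massSq := dil_mass t ht0 U
  have hnt : (dil t ht0 U).Nontriv := by rw [nontriv_iff, hdm]; positivity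
  have h1 := M_bound hσ hb hnt
  rw [Bsq_eq, dil_p, hdm, dil_lap, dil_grad] at h1
  have e1 : ((t ^ N)⁻¹ * U.massSq) ^ (4 / (N : ℝ)) = (t ^ 4)⁻¹ * U.massSq ^ (4 / (N : ℝ)) := by
    rw [Real.mul_rpow (by positivity) hm.le, Real.inv_rpow (by positivity), ← Real.rpow_natCast_mul ht0.le,
      show (N : ℝ) * (4 / (N : ℝ)) = (4 : ℕ) by field_simp; norm_num, Real.rpow_natCast]
  rw [e1] at h1
  have hT : 0 < (t ^ N)⁻¹ := by positivity
  refine le_of_mul_le_mul_left (h1.trans_eq ?_) hT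
  have e4 : t ^ 4 = (U.massSq / U.gradSq) ^ 2 := by rw [← ht2]; ring
  rw [e4, ht2]
  field_simp
  ring

lemma G_lt (hN : 1 ≤ N) (hN4 : N ≤ 4) (hb : BddAbove (Mset N (4 / (N : ℝ)))) :
    GNconst N (4 / (N : ℝ)) < Mconst N (4 / (N : ℝ)) ^ (2 * (4 / (N : ℝ)) + 2) := by
  have hN0 : (0 : ℝ) < N := by exact_mod_cast hN
  have hσ : (0:ℝ) < 4 / (N : ℝ) := by positivity
  obtain ⟨C, hC, h⟩ := gn2' hN hN4
  have hM := Mpos hN hσ hb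
  set Mp := Mconst N (4 / (N : ℝ)) ^ (2 * (4 / (N : ℝ)) + 2) with hMp
  have hMp0 : 0 < Mp := by positivity
  have key : ∀ U : H2 N, 0 < U.massSq →
      U.pPow (4 / (N : ℝ)) ≤ (Mp * C / (Mp + C)) * (U.massSq ^ (4 / (N : ℝ)) * U.lapSq) := by
    intro U hU
    have h1 := h U hU
    have hL := lapSq_nonneg U
    rw [div_mul_eq_mul_div, le_div_iff₀ (by positivity)]
    rcases (gradSq_nonneg U).eq_or_lt with h0 | h0
    · rw [← h0] at h1
      have h2 : U.pPow (4 / (N : ℝ)) ≤ 0 := by simpa using h1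
      have h3 : 0 ≤ Mp * C * (U.massSq ^ (4 / (N : ℝ)) * U.lapSq) := by positivity
      nlinarith
    · have h2 := M_dil hN hb hU h0
      rw [← hMp] at h2
      have h3 := mul_le_mul_of_nonneg_left h1 hMp0.le
      have h4 := mul_le_mul_of_nonneg_left h2 hC.le
      linarith
  have hle : GNconst N (4 / (N : ℝ)) ≤ Mp * C / (Mp + C) := by
    rw [GN_eq]
    exact Real.sSup_le (Gbdd_le hN (by positivity) key) (by positivity)
  refine hle.trans_lt ?_
  rw [div_lt_iff₀ (by positivity)]
  nlinarith

lemma m0_lt (hN : 1 ≤ N) (hN4 : N ≤ 4) (hb : BddAbove (Mset N (4 / (N : ℝ)))) :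
    m0c N (4 / (N : ℝ)) < kstar N (4 / (N : ℝ)) := by
  have hN0 : (0 : ℝ) < N := by exact_mod_cast hN
  have hσ : (0:ℝ) < 4 / (N : ℝ) := by positivity
  have hG := Gpos hN
  have hM := Mpos hN hσ hb
  have hkp : kstar N (4 / (N : ℝ)) ^ (4 / (N : ℝ)) = _ := kstar_pow hσ hG
  have hmp : m0c N (4 / (N : ℝ)) ^ (4 / (N : ℝ)) = _ := m0_pow hσ hM
  refine (Real.rpow_lt_rpow_iff (by unfold m0c; positivity) (kstar_pos hN).le hσ).1 ?_
  rw [hkp, hmp]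
  exact div_lt_div_of_pos_left (by positivity) hG (G_lt hN hN4 hb)

lemma part3 (hN : 1 ≤ N) : m0c N (4 / (N : ℝ)) < kstar N (4 / (N : ℝ)) ∧
      (∀ m : ℝ, 0 < m → m ≤ m0c N (4 / (N : ℝ)) → EminE N (4 / (N : ℝ)) m = ((-m : ℝ) : EReal)) ∧
      (∀ m : ℝ, m0c N (4 / (N : ℝ)) < m → m < kstar N (4 / (N : ℝ)) →
        ⊥ < EminE N (4 / (N : ℝ)) m ∧ EminE N (4 / (N : ℝ)) m < ((-m : ℝ) : EReal)) := by
  have hN0 : (0 : ℝ) < N := by exact_mod_cast hN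
  have hσ : (0:ℝ) < 4 / (N : ℝ) := by positivity
  by_cases hN4 : N ≤ 4
  · have hN4' : (N : ℝ) ≤ 4 := by exact_mod_cast hN4
    have hmax : max 1 (4 / ((N : ℝ) + 1)) ≤ 4 / (N : ℝ) := by
      refine max_le ?_ ?_
      · rw [le_div_iff₀ hN0]; linarith
      · gcongr; linarith
    have hb := Mset_bdd_of_good hσ (good_all hN hmax le_rfl)
    obtain ⟨h1, h2, h3⟩ := part2 hN hσ hb
    exact ⟨m0_lt hN hN4 hb, h2, fun m hm hk => ⟨below hN (h1.trans hm) hk, h3 m hm⟩⟩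
  · have hN5 : (5 : ℝ) ≤ N := by exact_mod_cast (by omega : 5 ≤ N)
    have hlt : 4 / (N : ℝ) < max 1 (4 / ((N : ℝ) + 1)) := by
      refine lt_max_of_lt_left ?_
      rw [div_lt_one hN0]; linarith
    have hnb : ¬ BddAbove (Mset N (4 / (N : ℝ))) := by
      intro hb
      obtain ⟨h1, h2, h3⟩ := part2 hN hσ hb
      obtain ⟨U, hU1, hU2⟩ := part1 hN hσ hlt h1
      have h4 := Emin_lt U hU1 hU2
      rw [h2 _ h1 le_rfl] at h4
      exact lt_irrefl _ h4
    have hM0 : Mconst N (4 / (N : ℝ)) = 0 := by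
      rw [Mconst_eq]; exact Real.sSup_of_not_bddAbove hnb
    have hm0 : m0c N (4 / (N : ℝ)) = 0 := by
      unfold m0c
      rw [hM0, Real.zero_rpow, mul_zero]
      have : 0 < (2 * (4 / (N : ℝ)) + 2) / (4 / (N : ℝ)) := by positivity
      linarith
    rw [hm0]
    refine ⟨kstar_pos hN, fun m h1 h2 => absurd h1 (not_lt.2 h2), fun m hm hk => ⟨below hN hm hk, ?_⟩⟩
    obtain ⟨U, hU1, hU2⟩ := part1 hN hσ hlt hm
    exact Emin_lt U hU1 hU2

end SW
end P17

/-- (i) If `0 < σ < max(1, 4/(N+1))` then `E_min(m) < -m` for all `m > 0`.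
(ii) If `max(1, 4/(N+1)) ≤ σ ≤ 4/N` then `m₀ > 0`, `E_min(m) = -m` on `(0, m₀]` and
`E_min(m) < -m` for `m > m₀`. (iii) If `σ = 4/N` then `m₀ < k*`, `E_min(m) = -m` on
`(0, m₀]` and `-∞ < E_min(m) < -m` on `(m₀, k*)`. -/
theorem stmt8 (N : ℕ) (σ : ℝ) (hN : 1 ≤ N) (hσ : 0 < σ) :
    (σ < max 1 (4 / ((N : ℝ) + 1)) → ∀ m : ℝ, 0 < m →
      EminE N σ m < ((-m : ℝ) : EReal)) ∧
    (max 1 (4 / ((N : ℝ) + 1)) ≤ σ → σ ≤ 4 / (N : ℝ) →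
      0 < m0c N σ ∧
      (∀ m : ℝ, 0 < m → m ≤ m0c N σ → EminE N σ m = ((-m : ℝ) : EReal)) ∧
      (∀ m : ℝ, m0c N σ < m → EminE N σ m < ((-m : ℝ) : EReal))) ∧
    (σ = 4 / (N : ℝ) →
      m0c N σ < kstar N σ ∧
      (∀ m : ℝ, 0 < m → m ≤ m0c N σ → EminE N σ m = ((-m : ℝ) : EReal)) ∧
      (∀ m : ℝ, m0c N σ < m → m < kstar N σ →
        ⊥ < EminE N σ m ∧ EminE N σ m < ((-m : ℝ) : EReal))) := by
  refine ⟨fun h m hm => ?_, fun h1 h2 => ?_, fun h => ?_⟩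
  · obtain ⟨U, h1, h2⟩ := SW.part1 hN hσ h hm
    exact SW.Emin_lt U h1 h2
  · exact SW.part2 hN hσ (SW.Mset_bdd_of_good hσ (SW.good_all hN h1 h2))
  · subst h
    exact SW.part3 hN

end
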